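/- Fix p ≥ 2n−1 and set Λ_p = sup{λ_{1,p}(γ) : γ ∈ R_h}. Assume either x₀ ≠ y₀, or x₀ = y₀ and Λ_p > λ_{1,p}(σ). Then there exists a curve α ∈ R_g^* such that λ_{1,p}(α) = Λ_p. -/

import Mathlib

open Set MeasureTheory Filter Topology

noncomputable section

/-- The closed quarter plane `P`. -/
def Pset : Set (ℝ × ℝ) := {z | 0 ≤ z.1 ∧ 0 ≤ z.2}

/-- The interior `P°` of the quarter plane. -/
def Pint : Set (ℝ × ℝ) := {z | 0 < z.1 ∧ 0 < z.2}

/-- The boundary `∂P` of the quarter plane. -/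
def Pbdry : Set (ℝ × ℝ) := {z | (0 ≤ z.1 ∧ 0 ≤ z.2) ∧ (z.1 = 0 ∨ z.2 = 0)}

/-- `F(x,y) = c_n x^(n-1) y^(n-1)`. -/
def Fvol (n : ℕ) (cn : ℝ) (z : ℝ × ℝ) : ℝ := cn * z.1 ^ (n - 1) * z.2 ^ (n - 1)

/-- Euclidean speed of a curve at `t`, computed with derivatives within `s`. -/
def gSpeedOn (s : Set ℝ) (α : ℝ → ℝ × ℝ) (t : ℝ) : ℝ :=
  Real.sqrt ((derivWithin (fun u => (α u).1) s t) ^ 2 + (derivWithin (fun u => (α u).2) s t) ^ 2)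

/-- Euclidean speed of a curve defined on `[0,1]`. -/
def gSpeed (α : ℝ → ℝ × ℝ) : ℝ → ℝ := gSpeedOn (Icc 0 1) α

/-- Euclidean length `L_g` of a curve on `[0,1]`. -/
def Lg (α : ℝ → ℝ × ℝ) : ℝ := ∫ t in (0:ℝ)..1, gSpeed α t

/-- The `h`-speed `|γ'|_h = F(γ) |γ'|_g`, with derivatives within `s`. -/
def hSpeedOn (n : ℕ) (cn : ℝ) (s : Set ℝ) (α : ℝ → ℝ × ℝ) (t : ℝ) : ℝ :=
  Fvol n cn (α t) * gSpeedOn s α t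

/-- The `h`-speed for curves defined on `[0,1)`. -/
def hSpeed (n : ℕ) (cn : ℝ) (α : ℝ → ℝ × ℝ) : ℝ → ℝ := hSpeedOn n cn (Ico 0 1) α

/-- The `h`-length `L_h` of a curve on `[0,1)`. -/
def Lh (n : ℕ) (cn : ℝ) (α : ℝ → ℝ × ℝ) : ℝ := ∫ t in (0:ℝ)..1, hSpeed n cn α t

/-- Numerator integrand of the `g`-Rayleigh quotient:
`|w'(t)|^p F(α t) |α'(t)|_g^(1-p)`. -/
def numG (n : ℕ) (cn p : ℝ) (s : Set ℝ) (α : ℝ → ℝ × ℝ) (w : ℝ → ℝ) (t : ℝ) : ℝ :=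
  |derivWithin w (Icc 0 1) t| ^ p * Fvol n cn (α t) * gSpeedOn s α t ^ (1 - p)

/-- Denominator integrand of the `g`-Rayleigh quotient:
`|w(t)|^p F(α t) |α'(t)|_g`. -/
def denG (n : ℕ) (cn p : ℝ) (s : Set ℝ) (α : ℝ → ℝ × ℝ) (w : ℝ → ℝ) (t : ℝ) : ℝ :=
  |w t| ^ p * Fvol n cn (α t) * gSpeedOn s α t

/-- First Dirichlet eigenvalue of the `p`-Laplacian along a curve, `g`-form:
infimum of the Rayleigh quotient over Lipschitz test functions on `[0,1]`
vanishing at `0` (with admissible, i.e. integrable with positive denominator,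
Rayleigh quotients). -/
def lambdaGOn (n : ℕ) (cn p : ℝ) (s : Set ℝ) (α : ℝ → ℝ × ℝ) : ℝ :=
  sInf {q | ∃ w : ℝ → ℝ, (∃ K, LipschitzOnWith K w (Icc 0 1)) ∧ w 0 = 0 ∧
    IntervalIntegrable (numG n cn p s α w) volume 0 1 ∧
    IntervalIntegrable (denG n cn p s α w) volume 0 1 ∧
    (0 < ∫ t in (0:ℝ)..1, denG n cn p s α w t) ∧
    q = (∫ t in (0:ℝ)..1, numG n cn p s α w t) / (∫ t in (0:ℝ)..1, denG n cn p s α w t)}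

/-- `λ_{1,p}` in the `g`-form for curves on `[0,1]`. -/
def lambdaG (n : ℕ) (cn p : ℝ) (α : ℝ → ℝ × ℝ) : ℝ := lambdaGOn n cn p (Icc 0 1) α

/-- Numerator integrand of the `h`-Rayleigh quotient on `[c,d]`:
`|w'(t)|^p F(γ t)^p |γ'(t)|_h^(1-p)`. -/
def numH (n : ℕ) (cn p c d : ℝ) (s : Set ℝ) (γ : ℝ → ℝ × ℝ) (w : ℝ → ℝ) (t : ℝ) : ℝ :=
  |derivWithin w (Icc c d) t| ^ p * Fvol n cn (γ t) ^ p * hSpeedOn n cn s γ t ^ (1 - p)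

/-- Denominator integrand of the `h`-Rayleigh quotient: `|w(t)|^p |γ'(t)|_h`. -/
def denH (n : ℕ) (cn p : ℝ) (s : Set ℝ) (γ : ℝ → ℝ × ℝ) (w : ℝ → ℝ) (t : ℝ) : ℝ :=
  |w t| ^ p * hSpeedOn n cn s γ t

/-- `λ_{1,p}` in the `h`-form for a curve on `[c,d)`, with test functions
Lipschitz on `[c,d]` vanishing at `c`. -/
def lambdaHOn (n : ℕ) (cn p c d : ℝ) (s : Set ℝ) (γ : ℝ → ℝ × ℝ) : ℝ :=
  sInf {q | ∃ w : ℝ → ℝ, (∃ K, LipschitzOnWith K w (Icc c d)) ∧ w c = 0 ∧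
    IntervalIntegrable (numH n cn p c d s γ w) volume c d ∧
    IntervalIntegrable (denH n cn p s γ w) volume c d ∧
    (0 < ∫ t in c..d, denH n cn p s γ w t) ∧
    q = (∫ t in c..d, numH n cn p c d s γ w t) / (∫ t in c..d, denH n cn p s γ w t)}

/-- `λ_{1,p}` in the `h`-form for curves on `[0,1)`. -/
def lambdaH (n : ℕ) (cn p : ℝ) (γ : ℝ → ℝ × ℝ) : ℝ :=
  lambdaHOn n cn p 0 1 (Ico 0 1) γ

/-- The class `𝒞` of `C¹` curves from `(x₀,y₀)` to the boundary, with constant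
speed, interior image on `[0,1)`, endpoint away from the origin, and meeting the
boundary orthogonally. -/
def MemC (x0 y0 : ℝ) (α : ℝ → ℝ × ℝ) : Prop :=
  ContDiffOn ℝ 1 α (Icc 0 1) ∧
  α 0 = (x0, y0) ∧
  (∀ t ∈ Ico (0:ℝ) 1, α t ∈ Pint) ∧
  α 1 ∈ Pbdry ∧ α 1 ≠ ((0 : ℝ), (0 : ℝ)) ∧
  (∀ t ∈ Icc (0:ℝ) 1, gSpeed α t = Lg α) ∧
  ((α 1).1 = 0 → derivWithin (fun u => (α u).2) (Icc 0 1) 1 = 0) ∧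
  ((α 1).2 = 0 → derivWithin (fun u => (α u).1) (Icc 0 1) 1 = 0)

/-- The Simons cone curve `σ(t) = (1-t)·(R,R)`. -/
def simonsCurve (R : ℝ) : ℝ → ℝ × ℝ := fun t => ((1 - t) * R, (1 - t) * R)

/-- The class `R_h`: locally Lipschitz curves on `[0,1)` with image in `P°`,
starting at `(x₀,y₀)`, with essentially bounded `h`-speed, reaching the collapsed
boundary point as `t → 1` (i.e. `x(γ t)·y(γ t) → 0`). -/
def MemRh (n : ℕ) (cn x0 y0 : ℝ) (γ : ℝ → ℝ × ℝ) : Prop :=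
  γ 0 = (x0, y0) ∧
  (∀ t ∈ Ico (0:ℝ) 1, γ t ∈ Pint) ∧
  (∀ a ∈ Ico (0:ℝ) 1, ∃ K, LipschitzOnWith K γ (Icc 0 a)) ∧
  (∃ M : ℝ, ∀ᵐ t ∂(volume : Measure ℝ), t ∈ Ico (0:ℝ) 1 → hSpeed n cn γ t ≤ M) ∧
  Tendsto (fun t => (γ t).1 * (γ t).2) (𝓝[<] (1:ℝ)) (𝓝 0)

/-- The class `R_h^+`: continuous curves on `[0,1]` into `P` ending on `∂P`
whose restriction to `[0,1)` belongs to `R_h`. -/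
def MemRhPlus (n : ℕ) (cn x0 y0 : ℝ) (α : ℝ → ℝ × ℝ) : Prop :=
  ContinuousOn α (Icc 0 1) ∧ (∀ t ∈ Icc (0:ℝ) 1, α t ∈ Pset) ∧ α 1 ∈ Pbdry ∧
  MemRh n cn x0 y0 α

/-- The class `R_g`: Lipschitz curves on `[0,1]` from `(x₀,y₀)` to `∂P` with
interior image on `[0,1)`. -/
def MemRg (x0 y0 : ℝ) (α : ℝ → ℝ × ℝ) : Prop :=
  (∃ K, LipschitzOnWith K α (Icc 0 1)) ∧ α 0 = (x0, y0) ∧ α 1 ∈ Pbdry ∧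
  ∀ t ∈ Ico (0:ℝ) 1, α t ∈ Pint

/-- The coordinate `u(x,y) = (x² - y²)/2`. -/
def ucoord (z : ℝ × ℝ) : ℝ := (z.1 ^ 2 - z.2 ^ 2) / 2

/-- The coordinate `v(x,y) = xy`. -/
def vcoord (z : ℝ × ℝ) : ℝ := z.1 * z.2

/-- The coordinate `r = √(u² + v²)`. -/
def rcoord (z : ℝ × ℝ) : ℝ := Real.sqrt (ucoord z ^ 2 + vcoord z ^ 2)

/-- The class `R_g^*`: simple curves in `R_g` with a.e. constant speed,
`u(α(1)) > 0`, and `v(α(t)) ≥ c(1-t)` for some `c > 0`. -/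
def MemRgStar (x0 y0 : ℝ) (α : ℝ → ℝ × ℝ) : Prop :=
  MemRg x0 y0 α ∧ InjOn α (Icc 0 1) ∧
  (∀ᵐ t ∂(volume : Measure ℝ), t ∈ Icc (0:ℝ) 1 → gSpeed α t = Lg α) ∧
  0 < ucoord (α 1) ∧
  ∃ c > (0:ℝ), ∀ t ∈ Icc (0:ℝ) 1, c * (1 - t) ≤ vcoord (α t)

lemma MeasureTheory.LocallyIntegrable.intervalIntegrable_real {E : Type*} [NormedAddCommGroup E]
    {f : ℝ → E} (hf : LocallyIntegrable f volume) (a b : ℝ) : IntervalIntegrable f volume a b :=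
  intervalIntegrable_iff.mpr <|
    (hf.integrableOn_isCompact isCompact_uIcc).mono_set uIoc_subset_uIcc

section LipschitzCalculus

variable {E : Type*} [NormedAddCommGroup E] [NormedSpace ℝ E] [FiniteDimensional ℝ E]

lemma LipschitzWith.locallyIntegrable_deriv {c : ℝ → E} {K : NNReal} (hc : LipschitzWith K c) :
    LocallyIntegrable (deriv c) volume := by
  have : CompleteSpace E := FiniteDimensional.complete ℝ E
  have : SecondCountableTopology E := secondCountable_of_proper
  refine (locallyIntegrable_const (K : ℝ)).mono (aestronglyMeasurable_deriv c volume) ?_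
  exact Eventually.of_forall fun t => by
    simpa using norm_deriv_le_of_lipschitz hc

lemma LipschitzWith.integral_deriv_eq {c : ℝ → E} {K : NNReal} (hc : LipschitzWith K c)
    (a b : ℝ) : ∫ t in a..b, deriv c t = c b - c a := by
  have : CompleteSpace E := FiniteDimensional.complete ℝ E
  have hli := hc.locallyIntegrable_deriv
  have hg : LipschitzWith K (fun x => ∫ t in a..x, deriv c t) := by
    refine LipschitzWith.of_dist_le_mul fun x y => ?_
    rw [dist_eq_norm, intervalIntegral.integral_interval_sub_left (hli.intervalIntegrable_real _ _)
      (hli.intervalIntegrable_real _ _), Real.dist_eq]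
    exact intervalIntegral.norm_integral_le_of_norm_le_const
      fun t _ => norm_deriv_le_of_lipschitz hc
  obtain ⟨C, hC⟩ := AbsolutelyContinuousOnInterval.const_of_ae_hasDerivAt_zero
    (f := fun x => (∫ t in a..x, deriv c t) - c x) (a := a) (b := b)
    ((hg.sub hc).lipschitzOnWith.absolutelyContinuousOnInterval) (by
      filter_upwards [LocallyIntegrable.ae_hasDerivAt_integral hli,
        hc.ae_differentiableAt_real] with x h1 h2 _
      have h3 := (h1 a).fun_sub h2.hasDerivAt
      rwa [sub_self] at h3)
  have h1 := hC a left_mem_uIcc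
  have h2 := hC b right_mem_uIcc
  simp only [intervalIntegral.integral_same] at h1
  rw [← h1] at h2
  rw [zero_sub, sub_eq_iff_eq_add] at h2
  rw [h2]; abel

lemma LipschitzWith.norm_sub_le_integral_norm_deriv {c : ℝ → E} {K : NNReal}
    (hc : LipschitzWith K c) {a b : ℝ} (hab : a ≤ b) :
    ‖c b - c a‖ ≤ ∫ t in a..b, ‖deriv c t‖ := by
  rw [← hc.integral_deriv_eq a b]
  exact intervalIntegral.norm_integral_le_integral_norm hab

lemma lipschitzWith_of_ae_norm_deriv_le {c : ℝ → E} {K : NNReal} (hc : LipschitzWith K c)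
    {L : NNReal} (h : ∀ᵐ t, ‖deriv c t‖ ≤ L) : LipschitzWith L c := by
  refine LipschitzWith.of_dist_le_mul fun x y => ?_
  rw [dist_eq_norm, ← hc.integral_deriv_eq y x, Real.dist_eq]
  exact intervalIntegral.norm_integral_le_of_norm_le_const_ae (h.mono fun t ht _ => ht)

end LipschitzCalculus

lemma LipschitzWith.volume_image_eq_zero {s : ℝ → ℝ} {K : NNReal} (hs : LipschitzWith K s)
    {A : Set ℝ} (hA : volume A = 0) : volume (s '' A) = 0 := by
  rw [← hausdorffMeasure_real] at hA ⊢
  have := hs.hausdorffMeasure_image_le (zero_le_one) A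
  rw [hA, mul_zero] at this
  exact le_antisymm this bot_le

/-- Change of variables along a monotone Lipschitz function. -/
lemma LipschitzWith.integral_comp_mul_deriv_of_monotone {s : ℝ → ℝ} {K : NNReal}
    (hs : LipschitzWith K s) (hm : Monotone s) {a b : ℝ} (hab : a ≤ b) (h : ℝ → ℝ) :
    ∫ t in a..b, deriv s t * h (s t) = ∫ x in (s a)..(s b), h x := by
  rw [intervalIntegral.integral_of_le hab, intervalIntegral.integral_of_le (hm hab),
    ← integral_Icc_eq_integral_Ioc, ← integral_Icc_eq_integral_Ioc]
  set A := Icc a b ∩ {t | DifferentiableAt ℝ s t} with hA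
  have hAm : MeasurableSet A := measurableSet_Icc.inter (measurableSet_of_differentiableAt ℝ s)
  have hnull : volume (Icc a b \ A) = 0 := by
    refine measure_mono_null ?_ (ae_iff.1 hs.ae_differentiableAt_real)
    rintro t ⟨h1, h2⟩ h3
    exact h2 ⟨h1, h3⟩
  have himg : s '' Icc a b = Icc (s a) (s b) := by
    refine Subset.antisymm ?_ (intermediate_value_Icc hab hs.continuous.continuousOn)
    rintro _ ⟨t, ht, rfl⟩
    exact ⟨hm ht.1, hm ht.2⟩
  have e1 : (s '' A : Set ℝ) =ᵐ[volume] Icc (s a) (s b) := by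
    rw [← himg]
    refine LE.le.eventuallyLE (image_mono inter_subset_left) |>.antisymm ?_
    rw [ae_le_set]
    refine measure_mono_null ?_ (hs.volume_image_eq_zero hnull)
    rintro _ ⟨⟨t, ht, rfl⟩, h2⟩
    exact ⟨t, ⟨ht, fun h3 => h2 ⟨t, h3, rfl⟩⟩, rfl⟩
  have e2 : (A : Set ℝ) =ᵐ[volume] Icc a b := by
    refine LE.le.eventuallyLE inter_subset_left |>.antisymm ?_
    rw [ae_le_set]
    exact hnull
  rw [← setIntegral_congr_set e1, ← setIntegral_congr_set e2,
    integral_image_eq_integral_deriv_smul_of_monotoneOn hAm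
      (fun x hx => (hx.2.hasDerivAt).hasDerivWithinAt) (hm.monotoneOn _)]
  rfl

lemma LipschitzWith.ae_deriv_eq_zero_of_null {s : ℝ → ℝ} {K : NNReal}
    (hs : LipschitzWith K s) (hm : Monotone s) {N : Set ℝ} (hNm : MeasurableSet N)
    (hN : volume N = 0) : ∀ᵐ t, s t ∈ N → deriv s t = 0 := by
  have key : ∀ k : ℕ, ∀ᵐ t, t ∈ Ioc (-(k:ℝ)) k → s t ∈ N → deriv s t = 0 := by
    intro k
    have hk : (-(k:ℝ)) ≤ k := by linarith [(Nat.cast_nonneg k : (0:ℝ) ≤ k)]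
    have h1 := hs.integral_comp_mul_deriv_of_monotone hm hk (N.indicator 1)
    have h2 : ∫ x in (s (-(k:ℝ)))..(s k), N.indicator (1 : ℝ → ℝ) x = 0 := by
      refine intervalIntegral.integral_zero_ae ?_
      filter_upwards [measure_eq_zero_iff_ae_notMem.1 hN] with x hx _
      simp [hx]
    rw [h2, intervalIntegral.integral_of_le hk] at h1
    have hmeas : Measurable fun t => deriv s t * N.indicator (1 : ℝ → ℝ) (s t) :=
      (measurable_deriv s).mul
        ((measurable_one.indicator hNm).comp hs.continuous.measurable)
    have h_int : IntegrableOn (fun t => deriv s t * N.indicator (1 : ℝ → ℝ) (s t))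
        (Ioc (-(k:ℝ)) k) := by
      refine Measure.integrableOn_of_bounded (M := K) (by simp) hmeas.aestronglyMeasurable ?_
      refine Eventually.of_forall fun t => ?_
      rw [norm_mul]
      have a1 : ‖deriv s t‖ ≤ K := norm_deriv_le_of_lipschitz hs
      have a2 : ‖N.indicator (1 : ℝ → ℝ) (s t)‖ ≤ 1 := by
        by_cases h : s t ∈ N <;> simp [h]
      calc _ ≤ (K:ℝ) * 1 := mul_le_mul a1 a2 (norm_nonneg _) K.2
        _ = K := mul_one _
    rw [setIntegral_eq_zero_iff_of_nonneg_ae ?_ h_int] at h1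
    · rw [EventuallyEq, ae_restrict_iff' measurableSet_Ioc] at h1
      filter_upwards [h1] with t ht htk htN
      simpa [htN] using ht htk
    · refine Eventually.of_forall fun t => mul_nonneg hm.deriv_nonneg ?_
      exact indicator_nonneg (fun _ _ => zero_le_one) _
  filter_upwards [ae_all_iff.2 key] with t ht
  obtain ⟨k, hk⟩ := exists_nat_gt |t|
  exact ht k ⟨by linarith [neg_abs_le t], by linarith [le_abs_self t]⟩

lemma LipschitzWith.ae_deriv_comp {s ω : ℝ → ℝ} {K L : NNReal}
    (hs : LipschitzWith K s) (hm : Monotone s) (hω : LipschitzWith L ω) :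
    ∀ᵐ t, deriv (fun t => ω (s t)) t = deriv ω (s t) * deriv s t := by
  have hN : volume {x | DifferentiableAt ℝ ω x}ᶜ = 0 := ae_iff.1 hω.ae_differentiableAt_real
  filter_upwards [hs.ae_deriv_eq_zero_of_null hm
    (measurableSet_of_differentiableAt ℝ ω).compl hN, hs.ae_differentiableAt_real] with t h1 h2
  by_cases h : DifferentiableAt ℝ ω (s t)
  · exact (h.hasDerivAt.comp t h2.hasDerivAt).deriv
  · have h3 := h1 h
    rw [h3, mul_zero]
    have h4 : HasDerivAt s 0 t := h3 ▸ h2.hasDerivAt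
    refine HasDerivAt.deriv ?_
    rw [hasDerivAt_iff_isLittleO] at h4 ⊢
    simp only [smul_zero, sub_zero] at h4 ⊢
    refine Asymptotics.IsBigO.trans_isLittleO ?_ h4
    refine Asymptotics.IsBigO.of_bound L (Eventually.of_forall fun r => ?_)
    simpa [dist_eq_norm] using hω.dist_le_mul (s r) (s t)

/-- Arclength reparametrization of a Lipschitz curve. -/
lemma exists_arclength {c : ℝ → ℂ} {K : NNReal} (hc : LipschitzWith K c) {T : ℝ} (hT : 0 ≤ T) :
    ∃ (s : ℝ → ℝ) (z : ℝ → ℂ), Monotone s ∧ LipschitzWith K s ∧ s 0 = 0 ∧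
      s T = ∫ t in (0:ℝ)..T, ‖deriv c t‖ ∧
      LipschitzWith 1 z ∧ (∀ t ∈ Icc 0 T, z (s t) = c t) ∧
      (∀ᵐ t, HasDerivAt s ‖deriv c t‖ t) ∧
      (∀ a b, s b - s a = ∫ t in a..b, ‖deriv c t‖) := by
  have hli : LocallyIntegrable (fun t => ‖deriv c t‖) volume := by
    intro x
    obtain ⟨U, hU, h⟩ := hc.locallyIntegrable_deriv x
    exact ⟨U, hU, h.norm⟩
  set s : ℝ → ℝ := fun x => ∫ t in (0:ℝ)..x, ‖deriv c t‖ with hs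
  have hsub : ∀ a b, s b - s a = ∫ t in a..b, ‖deriv c t‖ := fun a b =>
    intervalIntegral.integral_interval_sub_left (hli.intervalIntegrable_real _ _)
      (hli.intervalIntegrable_real _ _)
  have hmono : Monotone s := by
    intro a b hab
    rw [← sub_nonneg, hsub]
    exact intervalIntegral.integral_nonneg hab fun _ _ => norm_nonneg _
  have hlip : LipschitzWith K s := by
    refine LipschitzWith.of_dist_le_mul fun x y => ?_
    rw [Real.dist_eq, hsub, Real.dist_eq, ← Real.norm_eq_abs]
    refine intervalIntegral.norm_integral_le_of_norm_le_const fun t _ => ?_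
    rw [norm_norm]
    exact norm_deriv_le_of_lipschitz hc
  have hs0 : s 0 = 0 := by simp [hs]
  have hdist : ∀ a b, ‖c b - c a‖ ≤ |s b - s a| := by
    intro a b
    rcases le_total a b with h | h
    · rw [hsub]
      exact (hc.norm_sub_le_integral_norm_deriv h).trans (le_abs_self _)
    · rw [norm_sub_rev, abs_sub_comm, hsub]
      exact (hc.norm_sub_le_integral_norm_deriv h).trans (le_abs_self _)
  have hex : ∀ σ, ∃ t ∈ Icc 0 T, s t = max 0 (min σ (s T)) := by
    intro σ
    have h0 : 0 ≤ s T := hs0 ▸ hmono hT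
    have := intermediate_value_Icc hT hlip.continuous.continuousOn
    rw [hs0] at this
    obtain ⟨t, ht, h⟩ := this (show max 0 (min σ (s T)) ∈ Icc 0 (s T) from
      ⟨le_max_left _ _, max_le h0 (min_le_right _ _)⟩)
    exact ⟨t, ht, h⟩
  choose τ hτ hτs using hex
  refine ⟨s, fun σ => c (τ σ), hmono, hlip, hs0, rfl, ?_, ?_, ?_, hsub⟩
  · refine LipschitzWith.of_dist_le_mul fun x y => ?_
    rw [dist_eq_norm, NNReal.coe_one, one_mul, Real.dist_eq]
    refine (hdist _ _).trans ?_
    rw [hτs, hτs]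
    refine (abs_max_sub_max_le_max _ _ _ _).trans (max_le (by simp) ?_)
    exact (abs_min_sub_min_le_max _ _ _ _).trans (by simp)
  · intro t ht
    have h1 : s (τ (s t)) = s t := by
      rw [hτs, min_eq_left (hmono ht.2), max_eq_right (hs0 ▸ hmono ht.1)]
    have := hdist t (τ (s t))
    rw [h1, sub_self, abs_zero] at this
    exact sub_eq_zero.1 (norm_le_zero_iff.1 this)
  · filter_upwards [LocallyIntegrable.ae_hasDerivAt_integral hli] with t ht
    exact ht 0

/-- The weighted Poincaré-type inequality `Λ ∫ |w|^p f ≤ ∫ |w'|^p f` on `[0,S]`, for all Lipschitz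
functions vanishing at `0`. -/
def Feas (p Λ : ℝ) (f : ℝ → ℝ) (S : ℝ) : Prop :=
  ∀ (w : ℝ → ℝ) (K : NNReal), LipschitzWith K w → w 0 = 0 →
    Λ * ∫ t in (0:ℝ)..S, |w t| ^ p * f t ≤ ∫ t in (0:ℝ)..S, |deriv w t| ^ p * f t

section Integrability

variable {p : ℝ} {f w : ℝ → ℝ} {K : NNReal}

lemma continuous_abs_rpow_mul (hp : 0 ≤ p) (hw : Continuous w) (hf : Continuous f) :
    Continuous fun t => |w t| ^ p * f t :=
  (hw.abs.rpow_const fun _ => Or.inr hp).mul hf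

lemma abs_deriv_rpow_le (hp : 0 ≤ p) (hw : LipschitzWith K w) (t : ℝ) :
    |deriv w t| ^ p ≤ (K:ℝ) ^ p :=
  Real.rpow_le_rpow (abs_nonneg _) (by simpa using norm_deriv_le_of_lipschitz hw) hp

lemma measurable_abs_deriv_rpow : Measurable fun t => |deriv w t| ^ p := by
  have := (measurable_deriv w).abs.pow_const p
  exact this

lemma intervalIntegrable_abs_deriv_rpow_mul (hp : 0 ≤ p) (hw : LipschitzWith K w)
    (hf : Continuous f) (a b : ℝ) :
    IntervalIntegrable (fun t => |deriv w t| ^ p * f t) volume a b := by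
  have h1 : IntervalIntegrable (fun t => |deriv w t| ^ p) volume a b := by
    refine (intervalIntegrable_const (c := (K:ℝ) ^ p)).mono_fun
      measurable_abs_deriv_rpow.aestronglyMeasurable (Eventually.of_forall fun t => ?_)
    beta_reduce
    rw [Real.norm_of_nonneg (by positivity), Real.norm_of_nonneg (by positivity)]
    exact abs_deriv_rpow_le hp hw t
  exact h1.mul_continuousOn hf.continuousOn

end Integrability

lemma Feas.mono {p Λ Λ' : ℝ} {f : ℝ → ℝ} {S : ℝ} (h : Feas p Λ f S) (hΛ : Λ' ≤ Λ) (hS : 0 ≤ S)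
    (hf : ∀ t ∈ Icc 0 S, 0 ≤ f t) : Feas p Λ' f S := fun w K hw hw0 =>
  (mul_le_mul_of_nonneg_right hΛ (intervalIntegral.integral_nonneg hS fun t ht =>
    mul_nonneg (by positivity) (hf t ht))).trans (h w K hw hw0)

lemma Feas.congr {p Λ : ℝ} {f g : ℝ → ℝ} {S : ℝ} (h : Feas p Λ f S) (hS : 0 ≤ S)
    (hfg : ∀ t ∈ Icc 0 S, f t = g t) : Feas p Λ g S := by
  intro w K hw hw0
  have := h w K hw hw0
  rw [← uIcc_of_le hS] at hfg
  have e : ∀ φ : ℝ → ℝ, ∫ t in (0:ℝ)..S, φ t * f t = ∫ t in (0:ℝ)..S, φ t * g t := fun φ =>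
    intervalIntegral.integral_congr fun t ht => by simp only [hfg t ht]
  rwa [e, e] at this

lemma Feas.scale {p Λ : ℝ} {f : ℝ → ℝ} {S : ℝ} (h : Feas p Λ f S) (hS : 0 < S) :
    Feas p (Λ * S ^ p) (fun t => f (S * t)) 1 := by
  intro w K hw hw0
  have hl : LipschitzWith (K * ⟨S⁻¹, by positivity⟩) (fun σ => w (S⁻¹ * σ)) := by
    refine hw.comp (LipschitzWith.of_dist_le_mul fun x y => ?_)
    rw [Real.dist_eq, Real.dist_eq, ← mul_sub, abs_mul, abs_of_pos (by positivity : 0 < S⁻¹)]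
    rfl
  have h1 := h _ _ hl (by simpa using hw0)
  have e1 : ∫ t in (0:ℝ)..S, |w (S⁻¹ * t)| ^ p * f t
      = S * ∫ t in (0:ℝ)..1, |w t| ^ p * f (S * t) := by
    have := intervalIntegral.smul_integral_comp_mul_left (a := 0) (b := 1)
      (fun t => |w (S⁻¹ * t)| ^ p * f t) S
    simp only [mul_zero, mul_one, smul_eq_mul, inv_mul_cancel_left₀ hS.ne'] at this
    exact this.symm
  have e2 : ∫ t in (0:ℝ)..S, |deriv (fun σ => w (S⁻¹ * σ)) t| ^ p * f t
      = S * ((S⁻¹) ^ p * ∫ t in (0:ℝ)..1, |deriv w t| ^ p * f (S * t)) := by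
    have := intervalIntegral.smul_integral_comp_mul_left (E := ℝ) (a := 0) (b := 1)
      (fun t => |deriv (fun σ => w (S⁻¹ * σ)) t| ^ p * f t) S
    simp only [mul_zero, mul_one, smul_eq_mul] at this
    rw [← this, ← intervalIntegral.integral_const_mul (S⁻¹ ^ p)]
    refine congrArg (S * ·) (intervalIntegral.integral_congr fun t _ => ?_)
    simp only [deriv_comp_mul_left, inv_mul_cancel_left₀ hS.ne', smul_eq_mul, abs_mul,
      abs_of_pos (by positivity : 0 < S⁻¹)]
    rw [Real.mul_rpow (by positivity) (abs_nonneg _)]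
    ring
  rw [e1, e2, Real.inv_rpow hS.le] at h1
  have hSp : 0 < S ^ p := Real.rpow_pos_of_pos hS p
  have h2 : Λ * ∫ t in (0:ℝ)..1, |w t| ^ p * f (S * t) ≤
      (S ^ p)⁻¹ * ∫ t in (0:ℝ)..1, |deriv w t| ^ p * f (S * t) := by
    refine le_of_mul_le_mul_left ?_ hS
    linarith
  rw [inv_mul_eq_div, le_div_iff₀ hSp] at h2
  linarith

/-- Feasibility passes to a reparametrized weight, when the original weight follows it
wherever the reparametrization moves. -/
lemma Feas.collapse {p Λ L : ℝ} (hp : 1 < p) (hΛ : 0 ≤ Λ) (hL : 0 < L) {f g : ℝ → ℝ}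
    (hf : Continuous f) (hf0 : ∀ t ∈ Icc (0:ℝ) 1, 0 ≤ f t) (hg : Continuous g)
    {s : ℝ → ℝ} (hs : LipschitzWith ⟨L, hL.le⟩ s) (hm : Monotone s) (hs0 : s 0 = 0)
    (hfg : ∀ᵐ t, t ∈ Icc (0:ℝ) 1 → deriv s t ≠ 0 → f t = g (s t))
    (h : Feas p (Λ * L ^ p) f 1) : Feas p Λ g (s 1) := by
  intro ω K hω hω0
  have hp0 : (0:ℝ) ≤ p := by linarith
  have hds : ∀ t, deriv s t ≤ L := fun t => by
    have := norm_deriv_le_of_lipschitz (x₀ := t) hs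
    exact (le_abs_self _).trans this
  have hds0 : ∀ t, 0 ≤ deriv s t := fun t => hm.deriv_nonneg
  have h1 := h _ _ (hω.comp hs) (by simp [hs0, hω0])
  simp only [Function.comp_apply] at h1
  have c1 := hs.integral_comp_mul_deriv_of_monotone hm zero_le_one (fun σ => |ω σ| ^ p * g σ)
  have c2 := hs.integral_comp_mul_deriv_of_monotone hm zero_le_one
    (fun σ => |deriv ω σ| ^ p * g σ)
  rw [hs0] at c1 c2
  rw [← c1, ← c2]
  have i1 : IntervalIntegrable (fun t => deriv s t * (|ω (s t)| ^ p * g (s t))) volume 0 1 :=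
    IntervalIntegrable.mul_continuousOn
      (hs.locallyIntegrable_deriv.intervalIntegrable_real 0 1)
      (continuous_abs_rpow_mul hp0 (hω.continuous.comp hs.continuous)
        (hg.comp hs.continuous)).continuousOn
  have i2 : IntervalIntegrable (fun t => deriv s t * (|deriv ω (s t)| ^ p * g (s t)))
      volume 0 1 := by
    have : IntervalIntegrable (fun t => deriv s t * |deriv ω (s t)| ^ p) volume 0 1 := by
      refine (intervalIntegrable_const (c := L * (K:ℝ) ^ p)).mono_fun
        ((measurable_deriv s).mul
          (measurable_abs_deriv_rpow.comp hs.continuous.measurable)).aestronglyMeasurable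
        (Eventually.of_forall fun t => ?_)
      beta_reduce
      rw [Real.norm_of_nonneg (mul_nonneg (hds0 t) (by positivity)),
        Real.norm_of_nonneg (by positivity)]
      exact mul_le_mul (hds t) (abs_deriv_rpow_le hp0 hω _) (by positivity) hL.le
    simpa only [mul_assoc, Function.comp_apply] using
      this.mul_continuousOn (hg.comp hs.continuous).continuousOn
  have i3 := (continuous_abs_rpow_mul hp0 (hω.continuous.comp hs.continuous)
    hf).intervalIntegrable (μ := volume) 0 1
  have i4 := intervalIntegrable_abs_deriv_rpow_mul hp0 (hω.comp hs) hf 0 1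
  have hA : ∫ t in (0:ℝ)..1, deriv s t * (|ω (s t)| ^ p * g (s t)) ≤
      L * ∫ t in (0:ℝ)..1, |ω (s t)| ^ p * f t := by
    rw [← intervalIntegral.integral_const_mul]
    refine intervalIntegral.integral_mono_ae_restrict zero_le_one i1 (i3.const_mul L) ?_
    filter_upwards [ae_restrict_of_ae hfg, ae_restrict_mem measurableSet_Icc] with t ht htm
    have hnn : 0 ≤ |ω (s t)| ^ p * f t := mul_nonneg (by positivity) (hf0 t htm)
    by_cases hd : deriv s t = 0
    · rw [hd, zero_mul]
      exact mul_nonneg hL.le hnn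
    · rw [← ht htm hd]
      exact mul_le_mul_of_nonneg_right (hds t) hnn
  have hB : ∫ t in (0:ℝ)..1, |deriv (ω ∘ s) t| ^ p * f t ≤
      L ^ (p - 1) * ∫ t in (0:ℝ)..1, deriv s t * (|deriv ω (s t)| ^ p * g (s t)) := by
    rw [← intervalIntegral.integral_const_mul]
    refine intervalIntegral.integral_mono_ae_restrict zero_le_one i4 (i2.const_mul _) ?_
    filter_upwards [ae_restrict_of_ae hfg, ae_restrict_mem measurableSet_Icc,
      ae_restrict_of_ae (hs.ae_deriv_comp hm hω)] with t ht htm hd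
    have hd' : deriv (ω ∘ s) t = deriv ω (s t) * deriv s t := hd
    rw [hd', abs_mul, Real.mul_rpow (abs_nonneg _) (abs_nonneg _), abs_of_nonneg (hds0 t)]
    by_cases hz : deriv s t = 0
    · rw [hz, Real.zero_rpow (by linarith)]
      simp
    · have e : deriv s t ^ p = deriv s t ^ (p - 1) * deriv s t := by
        rw [← Real.rpow_add_one hz]; ring_nf
      have hpos : 0 < deriv s t := lt_of_le_of_ne (hds0 t) (Ne.symm hz)
      have hnn : 0 ≤ |deriv ω (s t)| ^ p * f t := mul_nonneg (by positivity) (hf0 t htm)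
      rw [e, ← ht htm hz]
      have : deriv s t ^ (p - 1) ≤ L ^ (p - 1) :=
        Real.rpow_le_rpow hpos.le (hds t) (by linarith)
      calc _ = deriv s t ^ (p - 1) * (deriv s t * (|deriv ω (s t)| ^ p * f t)) := by ring
        _ ≤ _ := mul_le_mul_of_nonneg_right this (mul_nonneg hpos.le hnn)
  have e : L ^ p = L ^ (p - 1) * L := by
    rw [← Real.rpow_add_one hL.ne']; ring_nf
  have hLp : 0 < L ^ (p - 1) := Real.rpow_pos_of_pos hL _
  rw [e] at h1
  refine le_of_mul_le_mul_left ?_ hLp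
  calc _ = Λ * L ^ (p - 1) * ∫ t in (0:ℝ)..1, deriv s t * (|ω (s t)| ^ p * g (s t)) := by ring
    _ ≤ Λ * L ^ (p - 1) * (L * ∫ t in (0:ℝ)..1, |ω (s t)| ^ p * f t) :=
        mul_le_mul_of_nonneg_left hA (by positivity)
    _ = Λ * (L ^ (p - 1) * L) * ∫ t in (0:ℝ)..1, |ω (s t)| ^ p * f t := by ring
    _ ≤ _ := h1.trans hB

/-- Testing feasibility with a truncated linear function. -/
lemma Feas.le_of_bounds {p Λ : ℝ} (hp : 0 < p) (hΛ : 0 ≤ Λ) {f : ℝ → ℝ} {S S' m M : ℝ}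
    (hf : Continuous f) (hf0 : ∀ t ∈ Icc 0 S, 0 ≤ f t) (hS' : 0 < S') (hSS : S' ≤ S)
    (h : Feas p Λ f S) (hm : ∀ t ∈ Icc (S' / 2) S', m ≤ f t)
    (hM : ∀ t ∈ Icc 0 (S' / 2), f t ≤ M) : Λ * m ≤ (2 / S') ^ p * M := by
  set K : NNReal := ⟨2 / S', by positivity⟩
  set w : ℝ → ℝ := fun t => min (2 / S' * t) 1 with hwdef
  have hlin : LipschitzWith K fun t : ℝ => 2 / S' * t := by
    refine LipschitzWith.of_dist_le_mul fun x y => ?_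
    rw [Real.dist_eq, Real.dist_eq, ← mul_sub, abs_mul, abs_of_pos (by positivity : 0 < 2 / S')]
    rfl
  have hw : LipschitzWith K w := hlin.min_const 1
  have h1 := h w K hw (by simp [hwdef])
  have hp0 := hp.le
  have h2 : m * (S' / 2) ≤ ∫ t in (0:ℝ)..S, |w t| ^ p * f t := by
    have hc := continuous_abs_rpow_mul hp0 hw.continuous hf
    have hii := fun a b => hc.intervalIntegrable (μ := volume) a b
    have hnn : ∀ t ∈ Icc 0 S, 0 ≤ |w t| ^ p * f t := fun t ht =>
      mul_nonneg (by positivity) (hf0 t ht)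
    rw [← intervalIntegral.integral_add_adjacent_intervals (hii 0 (S' / 2)) (hii (S' / 2) S),
      ← intervalIntegral.integral_add_adjacent_intervals (hii (S' / 2) S') (hii S' S)]
    have a1 : 0 ≤ ∫ t in (0:ℝ)..(S' / 2), |w t| ^ p * f t :=
      intervalIntegral.integral_nonneg (by linarith) fun t ht =>
        hnn t ⟨ht.1, by linarith [ht.2]⟩
    have a2 : 0 ≤ ∫ t in S'..S, |w t| ^ p * f t :=
      intervalIntegral.integral_nonneg hSS fun t ht => hnn t ⟨by linarith [ht.1], ht.2⟩
    have a3 : m * (S' / 2) ≤ ∫ t in (S' / 2)..S', |w t| ^ p * f t := by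
      have := intervalIntegral.integral_mono_on (a := S' / 2) (b := S') (by linarith)
        (intervalIntegrable_const (c := m)) (hii _ _) (fun t ht => by
          have : w t = 1 := by
            simp only [hwdef]
            refine min_eq_right ?_
            have := ht.1
            rw [div_mul_eq_mul_div, le_div_iff₀ hS']
            linarith
          simpa [this] using hm t ht)
      rw [intervalIntegral.integral_const, smul_eq_mul] at this
      linarith
    linarith
  have h3 : ∫ t in (0:ℝ)..S, |deriv w t| ^ p * f t ≤ (2 / S') ^ p * M * (S' / 2) := by
    have hii := fun a b => intervalIntegrable_abs_deriv_rpow_mul hp0 hw hf a b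
    rw [← intervalIntegral.integral_add_adjacent_intervals (hii 0 (S' / 2)) (hii (S' / 2) S)]
    have a1 : ∫ t in (S' / 2)..S, |deriv w t| ^ p * f t = 0 := by
      refine intervalIntegral.integral_zero_ae (Eventually.of_forall fun t ht => ?_)
      rw [uIoc_of_le (by linarith)] at ht
      have hev : w =ᶠ[𝓝 t] fun _ => 1 := by
        filter_upwards [Ioi_mem_nhds ht.1] with r hr
        simp only [hwdef]
        refine min_eq_right ?_
        rw [div_mul_eq_mul_div, le_div_iff₀ hS']
        have : S' / 2 < r := hr
        linarith
      rw [hev.deriv_eq, deriv_const, abs_zero, Real.zero_rpow hp.ne', zero_mul]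
    rw [a1, add_zero]
    have := intervalIntegral.integral_mono_on (a := 0) (b := S' / 2) (by linarith) (hii _ _)
      (intervalIntegrable_const (c := (2 / S') ^ p * M)) (fun t ht => by
        have b1 : |deriv w t| ^ p ≤ (2 / S') ^ p := abs_deriv_rpow_le hp0 hw t
        have b2 := hf0 t ⟨ht.1, by linarith [ht.2]⟩
        exact mul_le_mul b1 (hM t ht) b2 (by positivity))
    rw [intervalIntegral.integral_const, smul_eq_mul] at this
    linarith
  refine le_of_mul_le_mul_right ?_ (by positivity : 0 < S' / 2)
  calc Λ * m * (S' / 2) = Λ * (m * (S' / 2)) := by ring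
    _ ≤ Λ * ∫ t in (0:ℝ)..S, |w t| ^ p * f t := mul_le_mul_of_nonneg_left h2 hΛ
    _ ≤ _ := h1.trans h3

lemma young_of_small {p r lam ρ a b : ℝ} (hp : 1 < p) (hlam : 0 < lam) (hr : 0 ≤ r)
    (hρ : ρ = r * lam) (hκ : (p - 1) ^ (p - 1) * r ^ p * lam ≤ 1) (ha : 0 ≤ a) (hb : 0 ≤ b) :
    p * ρ * (b ^ (p - 1) * a) ≤ a ^ p + lam * b ^ p := by
  have hρ0 : 0 ≤ ρ := by rw [hρ]; positivity
  have hp1 : 0 < p - 1 := by linarith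
  have hpq : p.HolderConjugate (p / (p - 1)) := Real.HolderConjugate.conjExponent hp
  have h1 := Real.young_inequality_of_nonneg ha
    (mul_nonneg hρ0 (Real.rpow_nonneg hb (p - 1))) hpq
  have e1 : (ρ * b ^ (p - 1)) ^ (p / (p - 1)) = ρ ^ (p / (p - 1)) * b ^ p := by
    rw [Real.mul_rpow hρ0 (by positivity), ← Real.rpow_mul hb, mul_div_cancel₀ _ hp1.ne']
  rw [e1] at h1
  have h2 : (p - 1) * ρ ^ (p / (p - 1)) ≤ lam := by
    rw [← Real.rpow_le_rpow_iff (by positivity) hlam.le hp1,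
      Real.mul_rpow hp1.le (by positivity), ← Real.rpow_mul hρ0, div_mul_cancel₀ _ hp1.ne', hρ,
      Real.mul_rpow hr hlam.le]
    have e2 : lam ^ p = lam * lam ^ (p - 1) := by
      rw [mul_comm, ← Real.rpow_add_one hlam.ne']; ring_nf
    rw [e2]
    have : 0 ≤ lam ^ (p - 1) := by positivity
    nlinarith
  have h3 : p * (a * (ρ * b ^ (p - 1))) ≤ a ^ p + (p - 1) * ρ ^ (p / (p - 1)) * b ^ p := by
    have := mul_le_mul_of_nonneg_left h1 (by linarith : 0 ≤ p)
    have e3 : p * (a ^ p / p + ρ ^ (p / (p - 1)) * b ^ p / (p / (p - 1)))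
        = a ^ p + (p - 1) * ρ ^ (p / (p - 1)) * b ^ p := by
      field_simp
    linarith
  have h4 := mul_le_mul_of_nonneg_right h2 (Real.rpow_nonneg hb p)
  linarith

lemma abs_rpow_comp_lipschitzOn {p : ℝ} (hp : 1 < p) {w : ℝ → ℝ} {K : NNReal}
    (hw : LipschitzWith K w) (a b : ℝ) :
    ∃ C, LipschitzOnWith C (fun t => |w t| ^ p) (uIcc a b) := by
  have h1 : LocallyLipschitz fun x : ℝ => |x| ^ p :=
    (contDiff_norm_rpow (E := ℝ) hp).locallyLipschitz
  exact LocallyLipschitzOn.exists_lipschitzOnWith_of_compact isCompact_uIcc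
    ((h1.comp hw.locallyLipschitz).locallyLipschitzOn)

/-- Weighted Poincaré inequality with boundary term on a segment where the weight vanishes like
the `(n-1)`-st power of the distance to the endpoint. -/
lemma segment_inequality {n : ℕ} (hn : 1 ≤ n) {p lam A y : ℝ} (hp : 1 < p) (hlam : 0 < lam)
    (hy : 0 ≤ y) (hA : 0 ≤ A) (hκ : (p - 1) ^ (p - 1) * (2 / n) ^ p * (lam * y ^ p) ≤ 1)
    {w : ℝ → ℝ} {K : NNReal} (hw : LipschitzWith K w) :
    lam * ∫ t in (0:ℝ)..y, |w t| ^ p * (A * (y - t) ^ (n - 1)) ≤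
      (∫ t in (0:ℝ)..y, |deriv w t| ^ p * (A * (y - t) ^ (n - 1))) +
        2 * lam / n * A * y ^ n * |w 0| ^ p := by
  have hn0 : (0:ℝ) < n := by exact_mod_cast hn
  have hp0 : (0:ℝ) ≤ p := by linarith
  set f : ℝ → ℝ := fun t => A * (y - t) ^ (n - 1) with hf
  set q : ℝ → ℝ := fun t => 2 * lam / n * A * (y - t) ^ n with hq
  have hfc : Continuous f := by fun_prop
  have hqd : ∀ t, HasDerivAt q (-(2 * lam * f t)) t := by
    intro t
    have h1 : HasDerivAt (fun t => y - t) (-1) t := by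
      simpa using (hasDerivAt_id t).const_sub y
    have := (h1.fun_pow n).const_mul (2 * lam / n * A)
    have e : 2 * lam / n * A * (n * (y - t) ^ (n - 1) * -1) = -(2 * lam * f t) := by
      simp only [hf]
      field_simp
    rwa [e] at this
  have hqC : ContDiff ℝ 1 q := by fun_prop
  have hqac : AbsolutelyContinuousOnInterval q 0 y := by
    obtain ⟨C, hC⟩ := LocallyLipschitzOn.exists_lipschitzOnWith_of_compact
      (isCompact_uIcc (a := (0:ℝ)) (b := y)) (hqC.locallyLipschitz.locallyLipschitzOn)
    exact hC.absolutelyContinuousOnInterval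
  obtain ⟨C, hC⟩ := abs_rpow_comp_lipschitzOn hp hw 0 y
  have hpart := AbsolutelyContinuousOnInterval.integral_mul_deriv_eq_deriv_mul
    hC.absolutelyContinuousOnInterval hqac
  have hq0 : q 0 = 2 * lam / n * A * y ^ n := by simp [hq]
  have hqy : q y = 0 := by
    simp [hq, show n ≠ 0 by omega]
  have e1 : ∫ t in (0:ℝ)..y, |w t| ^ p * deriv q t
      = -(2 * lam) * ∫ t in (0:ℝ)..y, |w t| ^ p * f t := by
    rw [← intervalIntegral.integral_const_mul]
    refine intervalIntegral.integral_congr fun t _ => ?_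
    simp only [(hqd t).deriv]
    ring
  rw [e1, hq0, hqy] at hpart
  have i1 := (continuous_abs_rpow_mul hp0 hw.continuous hfc).intervalIntegrable (μ := volume) 0 y
  have i2 := intervalIntegrable_abs_deriv_rpow_mul hp0 hw hfc 0 y
  have h2 : ∫ t in (0:ℝ)..y, deriv (fun t => |w t| ^ p) t * q t ≤
      ∫ t in (0:ℝ)..y, (|deriv w t| ^ p * f t + lam * (|w t| ^ p * f t)) := by
    have i3 : IntervalIntegrable (fun t => deriv (fun t => |w t| ^ p) t * q t) volume 0 y :=
      (hC.absolutelyContinuousOnInterval.intervalIntegrable_deriv).mul_continuousOn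
        hqC.continuous.continuousOn
    refine intervalIntegral.integral_mono_ae_restrict hy i3 (i2.add (i1.const_mul _)) ?_
    filter_upwards [ae_restrict_of_ae hw.ae_differentiableAt_real,
      ae_restrict_mem measurableSet_Icc] with t hd ht
    have hder : deriv (fun t => |w t| ^ p) t = p * |w t| ^ (p - 2) * w t * deriv w t :=
      ((hasDerivAt_abs_rpow (w t) hp).comp t hd.hasDerivAt).deriv
    rw [hder]
    have hyt : 0 ≤ y - t := by linarith [ht.2]
    have hft : 0 ≤ f t := mul_nonneg hA (pow_nonneg hyt _)
    have hle : p * |w t| ^ (p - 2) * w t * deriv w t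
        ≤ p * (|w t| ^ (p - 1) * |deriv w t|) := by
      by_cases h0 : w t = 0
      · rw [h0]
        simp only [mul_zero, zero_mul]
        positivity
      · have hw0 : 0 < |w t| := abs_pos.2 h0
        have e : |w t| ^ (p - 1) = |w t| ^ (p - 2) * |w t| := by
          rw [← Real.rpow_add_one hw0.ne']; ring_nf
        rw [e]
        have h5 : w t * deriv w t ≤ |w t| * |deriv w t| := by
          rw [← abs_mul]; exact le_abs_self _
        have h6 : 0 ≤ p * |w t| ^ (p - 2) := by positivity
        nlinarith [mul_le_mul_of_nonneg_left h5 h6]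
    have hqf : q t = (2 / n * (y - t)) * lam * f t := by
      simp only [hq, hf]
      obtain ⟨m, rfl⟩ : ∃ m, n = m + 1 := ⟨n - 1, by omega⟩
      simp only [Nat.add_sub_cancel, pow_succ]
      ring
    have hκt : (p - 1) ^ (p - 1) * (2 / n * (y - t)) ^ p * lam ≤ 1 := by
      refine le_trans ?_ hκ
      rw [Real.mul_rpow (by positivity) hyt]
      have h7 : (y - t) ^ p ≤ y ^ p := Real.rpow_le_rpow hyt (by linarith [ht.1]) hp0
      have h8 : 0 ≤ (p - 1) ^ (p - 1) * (2 / (n:ℝ)) ^ p * lam := by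
        have : 0 ≤ (p - 1) ^ (p - 1) := Real.rpow_nonneg (by linarith) _
        positivity
      nlinarith [mul_le_mul_of_nonneg_left h7 h8]
    have hyoung := young_of_small hp hlam (by positivity) rfl hκt
      (abs_nonneg (deriv w t)) (abs_nonneg (w t))
    have hq0 : 0 ≤ q t := by rw [hqf]; positivity
    calc _ ≤ p * (|w t| ^ (p - 1) * |deriv w t|) * q t := mul_le_mul_of_nonneg_right hle hq0
      _ = p * (2 / n * (y - t) * lam) * (|w t| ^ (p - 1) * |deriv w t|) * f t := by
          rw [hqf]; ring
      _ ≤ (|deriv w t| ^ p + lam * |w t| ^ p) * f t := mul_le_mul_of_nonneg_right hyoung hft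
      _ = _ := by ring
  rw [intervalIntegral.integral_add i2 (i1.const_mul _),
    intervalIntegral.integral_const_mul] at h2
  linarith

/-- If a positive function dominates a power of its own tail integral, the remaining time is
controlled by the tail integral. -/
lemma remaining_length_le {N : ℕ} (hN : 1 ≤ N) {f : ℝ → ℝ} (hf : Continuous f) {a S k : ℝ}
    (haS : a ≤ S) (hk : 0 ≤ k) (hpos : ∀ t ∈ Ico a S, 0 < f t)
    (h : ∀ t ∈ Ico a S, k * (∫ r in t..S, f r) ^ (N - 1) ≤ f t ^ N) :
    k * (S - a) ^ N ≤ (N:ℝ) ^ N * ∫ r in a..S, f r := by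
  have hN0 : (0:ℝ) < N := by exact_mod_cast hN
  have hNn : N ≠ 0 := by omega
  set I : ℝ → ℝ := fun t => ∫ r in t..S, f r with hI
  have hId : ∀ t, HasDerivAt I (-f t) t := fun t =>
    intervalIntegral.integral_hasDerivAt_left (hf.intervalIntegrable _ _)
      hf.stronglyMeasurable.stronglyMeasurableAtFilter hf.continuousAt
  have hIpos : ∀ t ∈ Ico a S, 0 < I t := fun t ht =>
    intervalIntegral.intervalIntegral_pos_of_pos_on (hf.intervalIntegrable _ _)
      (fun r hr => hpos r ⟨ht.1.trans hr.1.le, hr.2⟩) ht.2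
  have hIS : I S = 0 := by simp [hI]
  set b : ℝ := k ^ ((1:ℝ) / N) / N with hb
  have hIc : Continuous I := continuous_iff_continuousAt.2 fun t => (hId t).continuousAt
  have hJc : Continuous fun t => I t ^ ((1:ℝ) / N) + b * t :=
    (hIc.rpow_const fun _ => Or.inr (by positivity)).add (continuous_const.mul continuous_id)
  have hanti : AntitoneOn (fun t => I t ^ ((1:ℝ) / N) + b * t) (Icc a S) := by
    have hder : ∀ t ∈ interior (Icc a S), HasDerivAt (fun t => I t ^ ((1:ℝ) / N) + b * t)
        (-f t * (1 / N) * I t ^ ((1:ℝ) / N - 1) + b) t := by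
      intro t ht
      rw [interior_Icc] at ht
      have h1 := (hId t).rpow_const (p := (1:ℝ) / N) (Or.inl (hIpos t ⟨ht.1.le, ht.2⟩).ne')
      simpa using h1.fun_add ((hasDerivAt_id t).const_mul b)
    refine antitoneOn_of_deriv_nonpos (convex_Icc a S) hJc.continuousOn
      (fun t ht => (hder t ht).differentiableAt.differentiableWithinAt) fun t ht => ?_
    rw [(hder t ht).deriv]
    rw [interior_Icc] at ht
    have ht' : t ∈ Ico a S := ⟨ht.1.le, ht.2⟩
    have hIt := hIpos t ht'
    have h1 : k ^ ((1:ℝ) / N) * I t ^ (((N - 1 : ℕ) : ℝ) / N) ≤ f t := by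
      have := Real.rpow_le_rpow (z := (1:ℝ) / N) (by positivity) (h t ht') (by positivity)
      rw [Real.mul_rpow hk (by positivity), ← Real.rpow_natCast, ← Real.rpow_mul hIt.le,
        ← Real.rpow_natCast, ← Real.rpow_mul (hpos t ht').le, mul_one_div, mul_one_div,
        div_self hN0.ne', Real.rpow_one] at this
      exact this
    have h2 : I t ^ (((N - 1 : ℕ) : ℝ) / N) * I t ^ ((1:ℝ) / N - 1) = 1 := by
      rw [← Real.rpow_add hIt, Nat.cast_sub hN]
      have : (((N:ℝ) - (1:ℕ)) / N + (1 / N - 1)) = 0 := by push_cast; field_simp; ring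
      rw [this, Real.rpow_zero]
    have h3 : 0 ≤ I t ^ ((1:ℝ) / N - 1) := by positivity
    have h4 := mul_le_mul_of_nonneg_right h1 h3
    rw [mul_assoc, h2, mul_one] at h4
    have h5 : b = (1 / N) * k ^ ((1:ℝ) / N) := by rw [hb]; ring
    have h6 : (0:ℝ) ≤ 1 / N := by positivity
    nlinarith [mul_le_mul_of_nonneg_left h4 h6]
  have h1 := hanti (left_mem_Icc.2 haS) (right_mem_Icc.2 haS) haS
  simp only [hIS] at h1
  rw [Real.zero_rpow (by positivity), zero_add] at h1
  have hIa : 0 ≤ I a := by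
    rcases haS.eq_or_lt with rfl | h
    · rw [hIS]
    · exact (hIpos a ⟨le_rfl, h⟩).le
  have h2 : b * (S - a) ≤ I a ^ ((1:ℝ) / N) := by linarith
  have h3 : (b * (S - a)) ^ N ≤ (I a ^ ((1:ℝ) / N)) ^ N :=
    pow_le_pow_left₀ (mul_nonneg (by positivity) (by linarith)) h2 N
  rw [← Real.rpow_natCast (I a ^ ((1:ℝ) / N)), ← Real.rpow_mul hIa, one_div_mul_cancel hN0.ne',
    Real.rpow_one, hb, mul_pow, div_pow, ← Real.rpow_natCast (k ^ ((1:ℝ) / N)),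
    ← Real.rpow_mul hk, one_div_mul_cancel hN0.ne', Real.rpow_one] at h3
  have hNN : (0:ℝ) < (N:ℝ) ^ N := by positivity
  rw [div_mul_eq_mul_div, div_le_iff₀ hNN] at h3
  linarith

lemma exists_running_max {φ : ℝ → ℝ} {K : NNReal} (hφ : LipschitzWith K φ) :
    ∃ U : ℝ → ℝ, Monotone U ∧ LipschitzWith K U ∧ (∀ t, 0 ≤ t → φ t ≤ U t) ∧
      (∀ t ≤ 0, U t = φ 0) ∧
      ∀ t, 0 < t → φ t < U t → U =ᶠ[𝓝 t] fun _ => U t := by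
  have hex : ∀ t : ℝ, ∃ τ ∈ Icc 0 (max t 0), ∀ r ∈ Icc 0 (max t 0), φ r ≤ φ τ := fun t =>
    isCompact_Icc.exists_isMaxOn ⟨0, le_rfl, le_max_right _ _⟩ hφ.continuous.continuousOn
  choose τ hτ hmax using hex
  set U : ℝ → ℝ := fun t => φ (τ t) with hU
  have hle : ∀ t, 0 ≤ t → φ t ≤ U t := fun t ht => hmax t t ⟨ht, le_max_left _ _⟩
  have hmono : Monotone U := fun a b hab =>
    hmax b (τ a) ⟨(hτ a).1, (hτ a).2.trans (max_le_max_right 0 hab)⟩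
  have hneg : ∀ t ≤ 0, U t = φ 0 := by
    intro t ht
    have h := hτ t
    rw [max_eq_right ht] at h
    simp only [hU, le_antisymm h.2 h.1]
  have hstep : ∀ a b, a ≤ b → U b ≤ U a + K * (b - a) := by
    intro a b hab
    by_cases h : τ b ≤ max a 0
    · have : U b ≤ U a := hmax a (τ b) ⟨(hτ b).1, h⟩
      have h2 : 0 ≤ (K:ℝ) * (b - a) := mul_nonneg K.2 (by linarith)
      linarith
    · push Not at h
      have h1 := hφ.dist_le_mul (τ b) (max a 0)
      rw [Real.dist_eq, Real.dist_eq, abs_of_pos (by linarith : 0 < τ b - max a 0)] at h1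
      have h2 : φ (max a 0) ≤ U a := hmax a _ ⟨le_max_right _ _, le_rfl⟩
      have h3 : τ b ≤ b := by
        rcases le_max_iff.1 (hτ b).2 with h' | h'
        · exact h'
        · linarith [le_max_right a 0]
      have h4 : τ b - max a 0 ≤ b - a := by linarith [le_max_left a 0]
      have h5 := mul_le_mul_of_nonneg_left h4 K.2
      have h6 := le_abs_self (φ (τ b) - φ (max a 0))
      change φ (τ b) ≤ _
      change _ ≤ (K:ℝ) * (b - a) at h5
      change _ ≤ (K:ℝ) * (τ b - max a 0) at h1
      change (K:ℝ) * (τ b - max a 0) ≤ _ at h5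
      linarith
  refine ⟨U, hmono, ?_, hle, hneg, ?_⟩
  · refine LipschitzWith.of_dist_le_mul fun a b => ?_
    rw [Real.dist_eq, Real.dist_eq]
    rcases le_total a b with h | h
    · rw [abs_sub_comm, abs_of_nonneg (sub_nonneg.2 (hmono h)), abs_sub_comm,
        abs_of_nonneg (sub_nonneg.2 h)]
      linarith [hstep a b h]
    · rw [abs_of_nonneg (sub_nonneg.2 (hmono h)), abs_of_nonneg (sub_nonneg.2 h)]
      linarith [hstep b a h]
  · intro t ht hlt
    have hτt : τ t < t := by
      have h1 := (hτ t).2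
      rw [max_eq_left ht.le] at h1
      refine lt_of_le_of_ne h1 fun h => ?_
      have : U t = φ t := by simp only [hU, h]
      linarith
    obtain ⟨ε, hε, hball⟩ := Metric.mem_nhds_iff.1
      (hφ.continuous.continuousAt.eventually (gt_mem_nhds hlt))
    filter_upwards [Metric.ball_mem_nhds t hε, Ioi_mem_nhds hτt, Ioi_mem_nhds ht] with r hr hr2 hr3
    refine le_antisymm ?_ (hmax r (τ t) ⟨(hτ t).1, (le_of_lt hr2).trans (le_max_left _ _)⟩)
    by_cases h : τ r ≤ t
    · exact hmax t (τ r) ⟨(hτ r).1, h.trans (le_max_left _ _)⟩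
    · push Not at h
      have h1 := (hτ r).2
      rw [max_eq_left (le_of_lt hr3)] at h1
      have : τ r ∈ Metric.ball t ε := by
        rw [Metric.mem_ball, Real.dist_eq, abs_lt] at hr ⊢
        constructor <;> linarith
      exact (hball this).le

/-- The coordinate `u` on `ℂ`. -/
def uC (z : ℂ) : ℝ := (z.re ^ 2 - z.im ^ 2) / 2

/-- The coordinate `v` on `ℂ`. -/
def vC (z : ℂ) : ℝ := z.re * z.im

lemma continuous_uC : Continuous uC := by unfold uC; fun_prop

lemma continuous_vC : Continuous vC := by unfold vC; fun_prop

lemma sq_eq_uC_vC (z : ℂ) : z ^ 2 = 2 * (uC z + vC z * Complex.I) := by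
  apply Complex.ext <;> simp [uC, vC, sq] <;> ring

/-- The square root of `2 (U + i v)` in the closed first quadrant, for `v ≥ 0`. -/
def quadSqrt (U v : ℝ) : ℂ :=
  ⟨Real.sqrt (Real.sqrt (U ^ 2 + v ^ 2) + U), Real.sqrt (Real.sqrt (U ^ 2 + v ^ 2) - U)⟩

lemma abs_le_sqrt_sq_add (U v : ℝ) : |U| ≤ Real.sqrt (U ^ 2 + v ^ 2) := by
  rw [← Real.sqrt_sq_eq_abs]
  exact Real.sqrt_le_sqrt (by nlinarith)

lemma uC_quadSqrt (U v : ℝ) : uC (quadSqrt U v) = U := by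
  have h := abs_le_sqrt_sq_add U v
  have h1 := neg_abs_le U
  have h2 := le_abs_self U
  simp only [uC, quadSqrt]
  rw [Real.sq_sqrt (by linarith), Real.sq_sqrt (by linarith)]
  ring

lemma vC_quadSqrt (U : ℝ) {v : ℝ} (hv : 0 ≤ v) : vC (quadSqrt U v) = v := by
  have h := abs_le_sqrt_sq_add U v
  have h1 := neg_abs_le U
  have h2 := le_abs_self U
  simp only [vC, quadSqrt]
  rw [← Real.sqrt_mul (by linarith)]
  have : (Real.sqrt (U ^ 2 + v ^ 2) + U) * (Real.sqrt (U ^ 2 + v ^ 2) - U) = v ^ 2 := by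
    ring_nf
    rw [Real.sq_sqrt (by positivity)]
    ring
  rw [this, Real.sqrt_sq hv]

lemma quadSqrt_nonneg (U v : ℝ) : 0 ≤ (quadSqrt U v).re ∧ 0 ≤ (quadSqrt U v).im :=
  ⟨Real.sqrt_nonneg _, Real.sqrt_nonneg _⟩

lemma quadSqrt_pos (U : ℝ) {v : ℝ} (hv : 0 < v) :
    0 < (quadSqrt U v).re ∧ 0 < (quadSqrt U v).im := by
  have h := vC_quadSqrt U hv.le
  have h0 := quadSqrt_nonneg U v
  unfold vC at h
  constructor
  · refine lt_of_le_of_ne h0.1 fun h' => ?_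
    rw [← h', zero_mul] at h; linarith
  · refine lt_of_le_of_ne h0.2 fun h' => ?_
    rw [← h', mul_zero] at h; linarith

lemma quadSqrt_uC_vC {z : ℂ} (h1 : 0 ≤ z.re) (h2 : 0 ≤ z.im) : quadSqrt (uC z) (vC z) = z := by
  have e : (uC z) ^ 2 + (vC z) ^ 2 = ((z.re ^ 2 + z.im ^ 2) / 2) ^ 2 := by
    unfold uC vC; ring
  apply Complex.ext
  · simp only [quadSqrt]
    rw [e, Real.sqrt_sq (by positivity)]
    rw [show (z.re ^ 2 + z.im ^ 2) / 2 + uC z = z.re ^ 2 by unfold uC; ring, Real.sqrt_sq h1]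
  · simp only [quadSqrt]
    rw [e, Real.sqrt_sq (by positivity)]
    rw [show (z.re ^ 2 + z.im ^ 2) / 2 - uC z = z.im ^ 2 by unfold uC; ring, Real.sqrt_sq h2]

lemma norm_le_norm_add_of_nonneg {a b : ℂ} (ha : 0 ≤ a.re ∧ 0 ≤ a.im) (hb : 0 ≤ b.re ∧ 0 ≤ b.im) :
    ‖a‖ ≤ ‖a + b‖ := by
  rw [← sq_le_sq₀ (norm_nonneg _) (norm_nonneg _), Complex.sq_norm, Complex.sq_norm,
    Complex.normSq_apply, Complex.normSq_apply]
  simp only [Complex.add_re, Complex.add_im]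
  nlinarith [mul_nonneg ha.1 hb.1, mul_nonneg ha.2 hb.2, mul_self_nonneg b.re,
    mul_self_nonneg b.im]

lemma sq_norm_eq_two_mul (z : ℂ) : ‖z‖ ^ 2 = 2 * Real.sqrt (uC z ^ 2 + vC z ^ 2) := by
  have e : (uC z) ^ 2 + (vC z) ^ 2 = ((z.re ^ 2 + z.im ^ 2) / 2) ^ 2 := by
    unfold uC vC; ring
  rw [e, Real.sqrt_sq (by positivity), Complex.sq_norm, Complex.normSq_apply]
  ring

lemma hasDerivAt_uC_vC {z : ℝ → ℂ} {z' : ℂ} {t : ℝ} (h : HasDerivAt z z' t) :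
    HasDerivAt (fun t => uC (z t)) (z t * z').re t ∧
      HasDerivAt (fun t => vC (z t)) (z t * z').im t := by
  have hre : HasDerivAt (fun t => (z t).re) z'.re t :=
    Complex.reCLM.hasFDerivAt.comp_hasDerivAt t h
  have him : HasDerivAt (fun t => (z t).im) z'.im t :=
    Complex.imCLM.hasFDerivAt.comp_hasDerivAt t h
  constructor
  · have := ((hre.fun_pow 2).fun_sub (him.fun_pow 2)).div_const 2
    have e : ((2:ℕ) * (z t).re ^ (2 - 1) * z'.re - (2:ℕ) * (z t).im ^ (2 - 1) * z'.im) / 2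
        = (z t * z').re := by
      simp; ring
    rw [e] at this
    exact this
  · have := hre.fun_mul him
    have e : z'.re * (z t).im + (z t).re * z'.im = (z t * z').im := by simp; ring
    rw [e] at this
    exact this

/-- Replacing `u` by its running maximum does not increase the speed of a curve. -/
lemma exists_monotone_u_of_pos {z : ℝ → ℂ} (hz : LipschitzWith 1 z)
    (hpos : ∀ t, 0 < (z t).re ∧ 0 < (z t).im) {m R : ℝ} (hm : 0 < m) (hmv : ∀ t, m ≤ vC (z t))
    (hR : ∀ t, ‖z t‖ ≤ R) (hconst : ∀ t ≤ 0, z t = z 0) (hu0 : 0 ≤ uC (z 0)) :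
    ∃ z' : ℝ → ℂ, LipschitzWith 1 z' ∧ z' 0 = z 0 ∧ (∀ t, 0 < (z' t).re ∧ 0 < (z' t).im) ∧
      (∀ t, vC (z' t) = vC (z t)) ∧ Monotone fun t => uC (z' t) := by
  have hR0 : 0 ≤ R := (norm_nonneg _).trans (hR 0)
  have hsq : ∀ a b, ‖z a ^ 2 - z b ^ 2‖ ≤ 2 * R * |a - b| := by
    intro a b
    have e : z a ^ 2 - z b ^ 2 = (z a + z b) * (z a - z b) := by ring
    rw [e, norm_mul]
    have h1 : ‖z a + z b‖ ≤ 2 * R := (norm_add_le _ _).trans (by linarith [hR a, hR b])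
    have h2 : ‖z a - z b‖ ≤ |a - b| := by
      simpa [dist_eq_norm] using hz.dist_le_mul a b
    exact mul_le_mul h1 h2 (norm_nonneg _) (by positivity)
  have hre : ∀ a b, uC (z a) - uC (z b) = (z a ^ 2 - z b ^ 2).re / 2 := by
    intro a b; rw [sq_eq_uC_vC, sq_eq_uC_vC]; simp; ring
  have him : ∀ a b, vC (z a) - vC (z b) = (z a ^ 2 - z b ^ 2).im / 2 := by
    intro a b; rw [sq_eq_uC_vC, sq_eq_uC_vC]; simp; ring
  have hul : LipschitzWith ⟨R, hR0⟩ fun t => uC (z t) := by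
    refine LipschitzWith.of_dist_le_mul fun a b => ?_
    rw [Real.dist_eq, Real.dist_eq, hre, abs_div, abs_two]
    have := (Complex.abs_re_le_norm _).trans (hsq a b)
    change _ ≤ R * |a - b|
    linarith
  have hvl : ∀ a b, |vC (z a) - vC (z b)| ≤ R * |a - b| := by
    intro a b
    rw [him, abs_div, abs_two]
    have := (Complex.abs_im_le_norm _).trans (hsq a b)
    linarith
  have habs : LipschitzWith ⟨R, hR0⟩ fun t => |uC (z t)| := by
    refine LipschitzWith.of_dist_le_mul fun a b => ?_
    exact (abs_abs_sub_abs_le_abs_sub _ _).trans (hul.dist_le_mul a b)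
  obtain ⟨U, hUm, hUl, hUle, hUneg, hUloc⟩ := exists_running_max habs
  have hUle' : ∀ t, |uC (z t)| ≤ U t := by
    intro t
    rcases le_total 0 t with h | h
    · exact hUle t h
    · rw [hUneg t h, hconst t h]
  set z' : ℝ → ℂ := fun t => quadSqrt (U t) (vC (z t)) with hz'
  have hvpos : ∀ t, 0 < vC (z t) := fun t => hm.trans_le (hmv t)
  have hu' : ∀ t, uC (z' t) = U t := fun t => uC_quadSqrt _ _
  have hv' : ∀ t, vC (z' t) = vC (z t) := fun t => vC_quadSqrt _ (hvpos t).le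
  have hnorm : ∀ t, ‖z t‖ ≤ ‖z' t‖ := by
    intro t
    rw [← sq_le_sq₀ (norm_nonneg _) (norm_nonneg _), sq_norm_eq_two_mul, sq_norm_eq_two_mul,
      hu', hv']
    have : uC (z t) ^ 2 ≤ U t ^ 2 := sq_le_sq' (by linarith [neg_abs_le (uC (z t)), hUle' t])
      ((le_abs_self _).trans (hUle' t))
    gcongr
  have hnpos : ∀ t, Real.sqrt (2 * m) ≤ ‖z t‖ := by
    intro t
    rw [← Real.sqrt_sq (norm_nonneg (z t)), sq_norm_eq_two_mul]
    have : m ≤ Real.sqrt (uC (z t) ^ 2 + vC (z t) ^ 2) :=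
      (hmv t).trans (Real.le_sqrt_of_sq_le (by nlinarith [sq_nonneg (uC (z t))]))
    exact Real.sqrt_le_sqrt (by linarith)
  have hm2 : 0 < Real.sqrt (2 * m) := Real.sqrt_pos.2 (by linarith)
  have hzl : LipschitzWith ⟨4 * R / Real.sqrt (2 * m), by positivity⟩ z' := by
    refine LipschitzWith.of_dist_le_mul fun a b => ?_
    rw [dist_eq_norm, Real.dist_eq]
    change _ ≤ 4 * R / Real.sqrt (2 * m) * |a - b|
    have e : ‖z' a + z' b‖ * ‖z' a - z' b‖ = ‖z' a ^ 2 - z' b ^ 2‖ := by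
      rw [← norm_mul]; ring_nf
    have h1 : Real.sqrt (2 * m) ≤ ‖z' a + z' b‖ :=
      ((hnpos a).trans (hnorm a)).trans
        (norm_le_norm_add_of_nonneg (quadSqrt_nonneg _ _) (quadSqrt_nonneg _ _))
    have h2 : ‖z' a ^ 2 - z' b ^ 2‖ ≤ 4 * R * |a - b| := by
      have h3 : z' a ^ 2 - z' b ^ 2
          = 2 * ((U a - U b : ℝ) + ((vC (z a) - vC (z b) : ℝ) : ℂ) * Complex.I) := by
        rw [sq_eq_uC_vC, sq_eq_uC_vC, hu', hu', hv', hv']; push_cast; ring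
      have h4 : |U a - U b| ≤ R * |a - b| := hUl.dist_le_mul a b
      rw [h3, norm_mul]
      have h5 := norm_add_le ((U a - U b : ℝ) : ℂ) (((vC (z a) - vC (z b) : ℝ) : ℂ) * Complex.I)
      rw [norm_mul, Complex.norm_I, mul_one, Complex.norm_real, Complex.norm_real,
        Real.norm_eq_abs, Real.norm_eq_abs] at h5
      have h6 := hvl a b
      rw [Complex.norm_two]
      linarith
    rw [div_mul_eq_mul_div, le_div_iff₀ hm2]
    calc ‖z' a - z' b‖ * Real.sqrt (2 * m) ≤ ‖z' a - z' b‖ * ‖z' a + z' b‖ :=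
          mul_le_mul_of_nonneg_left h1 (norm_nonneg _)
      _ = ‖z' a ^ 2 - z' b ^ 2‖ := by rw [mul_comm, e]
      _ ≤ _ := h2
  have hne : ∀ᵐ t : ℝ, t ≠ 0 := by simp [ae_iff, measure_singleton]
  refine ⟨z', lipschitzWith_of_ae_norm_deriv_le hzl ?_, ?_, fun t => quadSqrt_pos _ (hvpos t), hv',
    fun a b hab => by simpa only [hu'] using hUm hab⟩
  · filter_upwards [hzl.ae_differentiableAt_real, hz.ae_differentiableAt_real,
      hUl.ae_differentiableAt_real, hne] with t h1 h2 h3 h0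
    obtain ⟨a1, a2⟩ := hasDerivAt_uC_vC h1.hasDerivAt
    obtain ⟨b1, b2⟩ := hasDerivAt_uC_vC h2.hasDerivAt
    simp only [hu'] at a1
    simp only [hv'] at a2
    have him_eq : (z' t * deriv z' t).im = (z t * deriv z t).im := a2.unique b2
    have hre_le : |(z' t * deriv z' t).re| ≤ |(z t * deriv z t).re| := by
      rcases lt_or_gt_of_ne h0 with h | h
      · have hev : U =ᶠ[𝓝 t] fun _ => |uC (z 0)| := by
          filter_upwards [Iio_mem_nhds h] with r hr using hUneg r (le_of_lt hr)
        have : (z' t * deriv z' t).re = 0 :=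
          a1.unique ((hasDerivAt_const t _).congr_of_eventuallyEq hev)
        rw [this, abs_zero]; positivity
      · rcases (hUle' t).lt_or_eq with h' | h'
        · have : (z' t * deriv z' t).re = 0 :=
            a1.unique ((hasDerivAt_const t _).congr_of_eventuallyEq (hUloc t h h'))
          rw [this, abs_zero]; positivity
        · rcases le_total 0 (uC (z t)) with hs | hs
          · have hmin : IsLocalMin (fun r => U r - uC (z r)) t := by
              refine Eventually.of_forall fun r => ?_
              rw [abs_of_nonneg hs] at h'
              have := (le_abs_self _).trans (hUle' r)
              linarith
            have := hmin.hasDerivAt_eq_zero (a1.fun_sub b1)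
            rw [sub_eq_zero.1 this]
          · have hmin : IsLocalMin (fun r => U r + uC (z r)) t := by
              refine Eventually.of_forall fun r => ?_
              rw [abs_of_nonpos hs] at h'
              have := (neg_abs_le (uC (z r)))
              have := hUle' r
              linarith
            have := hmin.hasDerivAt_eq_zero (a1.fun_add b1)
            rw [eq_neg_of_add_eq_zero_left this, abs_neg]
    have hle : ‖z' t * deriv z' t‖ ≤ ‖z t * deriv z t‖ := by
      rw [← sq_le_sq₀ (norm_nonneg _) (norm_nonneg _), Complex.sq_norm, Complex.sq_norm,
        Complex.normSq_apply, Complex.normSq_apply, him_eq]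
      have := sq_le_sq.2 hre_le
      nlinarith
    rw [norm_mul, norm_mul] at hle
    have hd : ‖deriv z t‖ ≤ 1 := by simpa using norm_deriv_le_of_lipschitz (x₀ := t) hz
    have hzp : 0 < ‖z t‖ := hm2.trans_le (hnpos t)
    have : ‖z' t‖ * ‖deriv z' t‖ ≤ ‖z' t‖ * 1 := by
      nlinarith [hnorm t, norm_nonneg (deriv z t)]
    exact le_of_mul_le_mul_left this (hzp.trans_le (hnorm t))
  · simp only [hz']
    rw [hUneg 0 le_rfl, abs_of_nonneg hu0, quadSqrt_uC_vC (hpos 0).1.le (hpos 0).2.le]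

lemma lipschitzWith_clamp {E : Type*} [PseudoMetricSpace E] {z : ℝ → E} {K : NNReal} {a b : ℝ}
    (hab : a ≤ b) (hz : LipschitzOnWith K z (Icc a b)) :
    LipschitzWith K fun t => z (projIcc a b hab t) := by
  have := (lipschitzOnWith_iff_restrict.1 hz).comp (LipschitzWith.projIcc hab)
  rw [mul_one] at this
  exact this

lemma exists_monotone_u {z : ℝ → ℂ} {S : ℝ} (hS : 0 ≤ S) (hz : LipschitzWith 1 z)
    (hpos : ∀ t ∈ Icc 0 S, 0 < (z t).re ∧ 0 < (z t).im) (hu0 : 0 ≤ uC (z 0)) :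
    ∃ z' : ℝ → ℂ, LipschitzWith 1 z' ∧ z' 0 = z 0 ∧
      (∀ t ∈ Icc 0 S, 0 < (z' t).re ∧ 0 < (z' t).im) ∧
      (∀ t ∈ Icc 0 S, vC (z' t) = vC (z t)) ∧ Monotone fun t => uC (z' t) := by
  have hcl := lipschitzWith_clamp hS (hz.lipschitzOnWith (s := Icc 0 S))
  have h0 : ((projIcc 0 S hS 0 : Icc 0 S) : ℝ) = 0 := by simp
  obtain ⟨t1, ht1, hmin⟩ := isCompact_Icc.exists_isMinOn (s := Icc 0 S) ⟨0, le_rfl, hS⟩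
    ((continuous_vC.comp hz.continuous).continuousOn)
  obtain ⟨t2, ht2, hmax⟩ := isCompact_Icc.exists_isMaxOn (s := Icc 0 S) ⟨0, le_rfl, hS⟩
    ((continuous_norm.comp hz.continuous).continuousOn)
  obtain ⟨z', h1, h2, h3, h4, h5⟩ := exists_monotone_u_of_pos hcl
    (fun t => hpos _ (projIcc 0 S hS t).2)
    (m := vC (z t1)) (R := ‖z t2‖) (mul_pos (hpos t1 ht1).1 (hpos t1 ht1).2)
    (fun t => hmin (projIcc 0 S hS t).2) (fun t => hmax (projIcc 0 S hS t).2)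
    (fun t ht => by rw [projIcc_of_le_left hS ht, projIcc_left]) (by simpa only [h0] using hu0)
  refine ⟨z', h1, by rw [h2, h0], fun t _ => h3 t, fun t ht => ?_, h5⟩
  rw [h4, projIcc_of_mem hS ht]

/-- The density `F` on `ℂ`. -/
def FC (n : ℕ) (cn : ℝ) (z : ℂ) : ℝ := cn * vC z ^ (n - 1)

lemma continuous_FC (n : ℕ) (cn : ℝ) : Continuous (FC n cn) :=
  continuous_const.mul (continuous_vC.pow _)

lemma Fvol_eq_FC (n : ℕ) (cn : ℝ) (z : ℂ) : Fvol n cn (z.re, z.im) = FC n cn z := by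
  simp only [Fvol, FC, vC, mul_pow]; ring

lemma FC_nonneg {n : ℕ} {cn : ℝ} (hcn : 0 ≤ cn) {z : ℂ} (h1 : 0 ≤ z.re) (h2 : 0 ≤ z.im) :
    0 ≤ FC n cn z := by unfold FC vC; positivity

lemma gSpeedOn_eq_norm_deriv {s : Set ℝ} {γ : ℝ → ℝ × ℝ} {c : ℝ → ℂ} {t : ℝ} (hs : s ∈ 𝓝 t)
    (h : γ =ᶠ[𝓝 t] fun t => ((c t).re, (c t).im)) (hc : DifferentiableAt ℝ c t) :
    gSpeedOn s γ t = ‖deriv c t‖ := by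
  have h1 : HasDerivAt (fun u => (γ u).1) (deriv c t).re t := by
    refine (Complex.reCLM.hasFDerivAt.comp_hasDerivAt t hc.hasDerivAt).congr_of_eventuallyEq ?_
    filter_upwards [h] with x hx
    simp [hx]
  have h2 : HasDerivAt (fun u => (γ u).2) (deriv c t).im t := by
    refine (Complex.imCLM.hasFDerivAt.comp_hasDerivAt t hc.hasDerivAt).congr_of_eventuallyEq ?_
    filter_upwards [h] with x hx
    simp [hx]
  rw [gSpeedOn, derivWithin_of_mem_nhds hs, derivWithin_of_mem_nhds hs, h1.deriv, h2.deriv,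
    Complex.norm_def, Complex.normSq_apply]
  ring_nf

lemma numH_eq_of_speed {n : ℕ} {cn p : ℝ} (hp : 0 < p) {S : Set ℝ} {γ : ℝ → ℝ × ℝ} {w : ℝ → ℝ}
    {t σ d F : ℝ} (hσ : gSpeedOn S γ t = σ) (hσ0 : 0 ≤ σ) (hF : Fvol n cn (γ t) = F) (hF0 : 0 < F)
    (hd : derivWithin w (Icc 0 1) t = d * σ) :
    numH n cn p 0 1 S γ w t = σ * (|d| ^ p * F) := by
  unfold numH hSpeedOn
  rw [hσ, hF, hd]
  rcases hσ0.eq_or_lt with h | h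
  · rw [← h]; simp [hp.ne']
  · rw [abs_mul, Real.mul_rpow (abs_nonneg _) (abs_nonneg _), abs_of_pos h,
      Real.mul_rpow hF0.le h.le]
    calc _ = (|d| ^ p) * (σ ^ p * σ ^ (1 - p)) * (F ^ p * F ^ (1 - p)) := by ring
      _ = _ := by
        rw [← Real.rpow_add h, ← Real.rpow_add hF0]
        simp only [add_sub_cancel, Real.rpow_one]; ring

section

variable {n : ℕ} {cn x0 y0 : ℝ} {γ : ℝ → ℝ × ℝ}

lemma MemRh.continuousOn (h : MemRh n cn x0 y0 γ) : ContinuousOn γ (Ico 0 1) := by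
  intro t ht
  obtain ⟨a, ha1, ha2⟩ := exists_between ht.2
  obtain ⟨K, hK⟩ := h.2.2.1 a ⟨ht.1.trans ha1.le, ha2⟩
  have : ContinuousWithinAt γ (Icc 0 a) t := hK.continuousOn t ⟨ht.1, ha1.le⟩
  refine this.mono_of_mem_nhdsWithin ?_
  filter_upwards [self_mem_nhdsWithin, mem_nhdsWithin_of_mem_nhds (Iio_mem_nhds ha1)] with x hx hx'
  exact ⟨hx.1, le_of_lt hx'⟩

lemma Fvol_pos (hcn : 0 < cn) {z : ℝ × ℝ} (hz : z ∈ Pint) : 0 < Fvol n cn z := by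
  have h1 := hz.1
  have h2 := hz.2
  unfold Fvol; positivity

lemma continuous_Fvol : Continuous (Fvol n cn) := by unfold Fvol; fun_prop

lemma hSpeedOn_nonneg (hcn : 0 < cn) {S : Set ℝ} {t : ℝ} (hz : γ t ∈ Pint) :
    0 ≤ hSpeedOn n cn S γ t :=
  mul_nonneg (Fvol_pos hcn hz).le (Real.sqrt_nonneg _)

lemma MemRh.intervalIntegrable_denH (hcn : 0 < cn) (h : MemRh n cn x0 y0 γ) {p : ℝ} (hp : 0 ≤ p)
    {w : ℝ → ℝ} (hw : Continuous w) :
    IntervalIntegrable (denH n cn p (Ico 0 1) γ w) volume 0 1 := by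
  have hfac : IntervalIntegrable (fun t => hSpeedOn n cn (Ico 0 1) γ t) volume 0 1 := by
    rw [intervalIntegrable_iff_integrableOn_Ioo_of_le zero_le_one]
    obtain ⟨M, hM⟩ := h.2.2.2.1
    refine Integrable.mono' (integrable_const M) ?_ ?_
    · have hF : AEStronglyMeasurable (fun t => Fvol n cn (γ t)) (volume.restrict (Ioo 0 1)) :=
        ((continuous_Fvol.comp_continuousOn h.continuousOn).mono
          Ioo_subset_Ico_self).aestronglyMeasurable measurableSet_Ioo
      have hg : Measurable fun t => Real.sqrt ((deriv (fun u => (γ u).1) t) ^ 2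
          + (deriv (fun u => (γ u).2) t) ^ 2) :=
        (((measurable_deriv _).pow_const 2).add ((measurable_deriv _).pow_const 2)).sqrt
      refine (hF.mul hg.aestronglyMeasurable).congr ?_
      filter_upwards [ae_restrict_mem measurableSet_Ioo] with t ht
      have hn : Ico (0:ℝ) 1 ∈ 𝓝 t := Ico_mem_nhds ht.1 ht.2
      simp only [hSpeedOn, gSpeedOn, derivWithin_of_mem_nhds hn, Pi.mul_apply]
    · rw [ae_restrict_iff' measurableSet_Ioo]
      filter_upwards [hM] with t ht ht'
      have ht2 := Ioo_subset_Ico_self ht'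
      rw [Real.norm_of_nonneg (hSpeedOn_nonneg hcn (h.2.1 t ht2))]
      exact ht ht2
  exact hfac.continuousOn_mul (hw.abs.rpow_const fun _ => Or.inr hp).continuousOn

lemma MemRh.integral_numH_nonneg (hcn : 0 < cn) (h : MemRh n cn x0 y0 γ) {p : ℝ} {w : ℝ → ℝ} :
    0 ≤ ∫ t in (0:ℝ)..1, numH n cn p 0 1 (Ico 0 1) γ w t := by
  rw [intervalIntegral.integral_of_le zero_le_one, integral_Ioc_eq_integral_Ioo]
  refine setIntegral_nonneg measurableSet_Ioo fun t ht => ?_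
  have hz := h.2.1 t (Ioo_subset_Ico_self ht)
  have h1 := Fvol_pos (n := n) hcn hz
  have h2 := hSpeedOn_nonneg (n := n) (S := Ico 0 1) hcn hz
  unfold numH; positivity

lemma MemRh.lambdaH_le (hcn : 0 < cn) (h : MemRh n cn x0 y0 γ) {p : ℝ} {w : ℝ → ℝ} {K : NNReal}
    (hw : LipschitzWith K w) (hw0 : w 0 = 0)
    (hi : IntervalIntegrable (numH n cn p 0 1 (Ico 0 1) γ w) volume 0 1) (hp : 0 ≤ p)
    (hd : 0 < ∫ t in (0:ℝ)..1, denH n cn p (Ico 0 1) γ w t) :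
    lambdaH n cn p γ * (∫ t in (0:ℝ)..1, denH n cn p (Ico 0 1) γ w t)
      ≤ ∫ t in (0:ℝ)..1, numH n cn p 0 1 (Ico 0 1) γ w t := by
  rw [← le_div_iff₀ hd]
  refine csInf_le ⟨0, ?_⟩ ⟨w, ⟨K, hw.lipschitzOnWith⟩, hw0, hi,
    h.intervalIntegrable_denH hcn hp hw.continuous, hd, rfl⟩
  rintro q ⟨w', -, -, -, -, hd', rfl⟩
  exact div_nonneg (h.integral_numH_nonneg hcn) hd'.le

end

lemma exists_feas_of_memRh {n : ℕ} {cn x0 y0 p lam ε : ℝ} (hcn : 0 < cn) (hp : 0 < p)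
    {γ : ℝ → ℝ × ℝ} (hγ : MemRh n cn x0 y0 γ) (hlam0 : 0 ≤ lam) (hlam : lam ≤ lambdaH n cn p γ)
    (hε : 0 < ε) :
    ∃ (S : ℝ) (z : ℝ → ℂ), 0 ≤ S ∧ LipschitzWith 1 z ∧ z 0 = ⟨x0, y0⟩ ∧
      (∀ t ∈ Icc 0 S, 0 < (z t).re ∧ 0 < (z t).im) ∧ vC (z S) ≤ ε ∧
      Feas p lam (fun t => FC n cn (z t)) S := by
  obtain ⟨T, ⟨hT0, hT1⟩, hTε⟩ : ∃ T ∈ Ico (0:ℝ) 1, (γ T).1 * (γ T).2 < ε := by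
    have h1 := hγ.2.2.2.2.eventually (gt_mem_nhds hε)
    have h2 : ∀ᶠ t in 𝓝[<] (1:ℝ), t ∈ Ico (0:ℝ) 1 :=
      Ico_mem_nhdsLT zero_lt_one
    obtain ⟨T, hT, hT'⟩ := (h2.and h1).exists
    exact ⟨T, hT, hT'⟩
  obtain ⟨K, hK⟩ := hγ.2.2.1 T ⟨hT0, hT1⟩
  set γC : ℝ → ℂ := fun t => ⟨(γ t).1, (γ t).2⟩ with hγC
  obtain ⟨K', hK'⟩ : ∃ K', LipschitzOnWith K' γC (Icc 0 T) :=
    ⟨_, Complex.equivRealProdCLM.symm.lipschitz.comp_lipschitzOnWith hK⟩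
  set c : ℝ → ℂ := fun t => γC (projIcc 0 T hT0 t) with hcdef
  have hc : LipschitzWith K' c := lipschitzWith_clamp hT0 hK'
  have hcin : ∀ t ∈ Icc 0 T, c t = γC t := fun t ht => by
    simp only [hcdef, projIcc_of_mem hT0 ht]
  obtain ⟨s, z, hm, hsL, hs0, -, hz, hzs, hsd, hsub⟩ := exists_arclength hc hT0
  have hcd0 : ∀ t, T < t → deriv c t = 0 := fun t ht => by
    have : c =ᶠ[𝓝 t] fun _ => γC T := by
      filter_upwards [Ioi_mem_nhds ht] with r hr
      simp only [hcdef, projIcc_of_right_le hT0 (le_of_lt hr)]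
    rw [this.deriv_eq, deriv_const]
  have hsT : s 1 = s T := by
    rw [← sub_eq_zero, hsub, intervalIntegral.integral_of_le hT1.le]
    refine setIntegral_eq_zero_of_forall_eq_zero fun t ht => ?_
    rw [hcd0 t ht.1, norm_zero]
  have hpint : ∀ t ∈ Icc 0 T, γ t ∈ Pint := fun t ht => hγ.2.1 t ⟨ht.1, ht.2.trans_lt hT1⟩
  have hsT0 : 0 ≤ s T := hs0 ▸ hm hT0
  have hsurj : ∀ σ ∈ Icc 0 (s T), ∃ t ∈ Icc 0 T, s t = σ := fun σ hσ =>
    intermediate_value_Icc hT0 hsL.continuous.continuousOn (by rwa [hs0])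
  have hpos : ∀ σ ∈ Icc 0 (s T), 0 < (z σ).re ∧ 0 < (z σ).im := by
    intro σ hσ
    obtain ⟨t, ht, rfl⟩ := hsurj σ hσ
    rw [hzs t ht, hcin t ht]
    exact hpint t ht
  refine ⟨s T, z, hsT0, hz, ?_, hpos, ?_, ?_⟩
  · rw [← hs0, hzs 0 ⟨le_rfl, hT0⟩, hcin 0 ⟨le_rfl, hT0⟩, hγC]
    simp only [hγ.1]
  · rw [hzs T ⟨hT0, le_rfl⟩, hcin T ⟨hT0, le_rfl⟩]
    exact hTε.le
  intro ω L hω hω0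
  have hFz : Continuous fun t => FC n cn (z t) := (continuous_FC n cn).comp hz.continuous
  set h2 : ℝ → ℝ := fun σ => |ω σ| ^ p * FC n cn (z σ) with hh2
  set h3 : ℝ → ℝ := fun σ => |deriv ω σ| ^ p * FC n cn (z σ) with hh3
  have c2 := hsL.integral_comp_mul_deriv_of_monotone hm zero_le_one h2
  have c3 := hsL.integral_comp_mul_deriv_of_monotone hm zero_le_one h3
  rw [hs0, hsT] at c2 c3
  set w : ℝ → ℝ := fun t => ω (s t) with hwdef
  have hw : LipschitzWith (L * K') w := hω.comp hsL
  have hFnn : ∀ σ ∈ Icc 0 (s T), 0 ≤ FC n cn (z σ) := fun σ hσ =>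
    FC_nonneg hcn.le (hpos σ hσ).1.le (hpos σ hσ).2.le
  have key : ∀ᵐ t, t ∈ Ioo (0:ℝ) 1 →
      numH n cn p 0 1 (Ico 0 1) γ w t = deriv s t * h3 (s t) ∧
      deriv s t * h2 (s t) ≤ denH n cn p (Ico 0 1) γ w t := by
    have hneT : ∀ᵐ t : ℝ, t ≠ T := by simp [ae_iff]
    filter_upwards [hneT, hsd, hsL.ae_deriv_comp hm hω, hc.ae_differentiableAt_real]
      with t htT hsd hcomp hdiff ht
    have hdw : derivWithin w (Icc 0 1) t = deriv ω (s t) * deriv s t := by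
      rw [derivWithin_of_mem_nhds (Icc_mem_nhds ht.1 ht.2), hcomp]
    rcases lt_or_gt_of_ne htT with hlt | hgt
    · have htI : t ∈ Icc 0 T := ⟨ht.1.le, hlt.le⟩
      have hsp : gSpeedOn (Ico 0 1) γ t = ‖deriv c t‖ := by
        refine gSpeedOn_eq_norm_deriv (Ico_mem_nhds ht.1 ht.2) ?_ hdiff
        filter_upwards [Icc_mem_nhds ht.1 hlt] with r hr
        rw [hcin r hr]
      have hFe : Fvol n cn (γ t) = FC n cn (z (s t)) := by
        rw [hzs t htI, hcin t htI, ← Fvol_eq_FC]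
      have hFp : 0 < FC n cn (z (s t)) := hFe ▸ Fvol_pos hcn (hpint t htI)
      rw [hsd.deriv] at hdw ⊢
      refine ⟨numH_eq_of_speed hp hsp (norm_nonneg _) hFe hFp hdw, le_of_eq ?_⟩
      simp only [denH, hSpeedOn, hsp, hFe, hh2, hwdef]
      ring
    · have hs' : deriv s t = 0 := by rw [hsd.deriv, hcd0 t hgt, norm_zero]
      rw [hs', mul_zero] at hdw
      have hz' := hγ.2.1 t ⟨ht.1.le, ht.2⟩
      refine ⟨?_, ?_⟩
      · simp [numH, hdw, hs', hp.ne']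
      · rw [hs', zero_mul]
        exact mul_nonneg (by positivity) (hSpeedOn_nonneg hcn hz')
  have h_int : ∀ φ : ℝ → ℝ, Measurable φ → (∃ C, ∀ σ, |φ σ| ≤ C) →
      IntervalIntegrable (fun t => deriv s t * (φ (s t) * FC n cn (z (s t)))) volume 0 1 := by
    rintro φ hφ ⟨C, hC⟩
    have h1 : IntervalIntegrable (fun t => deriv s t * φ (s t)) volume 0 1 := by
      refine (intervalIntegrable_const (c := (K':ℝ) * C)).mono_fun
        ((measurable_deriv s).mul (hφ.comp hsL.continuous.measurable)).aestronglyMeasurable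
        (Eventually.of_forall fun t => ?_)
      have h3 : ‖deriv s t‖ ≤ K' := norm_deriv_le_of_lipschitz hsL
      have h4 : (0:ℝ) ≤ C := (abs_nonneg _).trans (hC 0)
      beta_reduce
      rw [norm_mul, Real.norm_of_nonneg (by positivity : 0 ≤ (K':ℝ) * C)]
      exact mul_le_mul h3 (hC _) (norm_nonneg _) (by positivity)
    refine (h1.mul_continuousOn (hFz.comp hsL.continuous).continuousOn).congr ?_
    exact fun t _ => by simp only [Function.comp_apply]; ring
  have hi3 := h_int (fun σ => |deriv ω σ| ^ p) measurable_abs_deriv_rpow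
    ⟨(L:ℝ) ^ p, fun σ => by
      rw [abs_of_nonneg (by positivity)]; exact abs_deriv_rpow_le hp.le hω σ⟩
  have hi2 : IntervalIntegrable (fun t => deriv s t * h2 (s t)) volume 0 1 := by
    have h1 : IntervalIntegrable (deriv s) volume 0 1 :=
      LocallyIntegrable.intervalIntegrable_real hsL.locallyIntegrable_deriv _ _
    exact h1.mul_continuousOn
      ((continuous_abs_rpow_mul hp.le hω.continuous hFz).comp hsL.continuous).continuousOn
  have key' : ∀ᵐ t ∂(volume.restrict (Ioo (0:ℝ) 1)),
      numH n cn p 0 1 (Ico 0 1) γ w t = deriv s t * h3 (s t) ∧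
      deriv s t * h2 (s t) ≤ denH n cn p (Ico 0 1) γ w t :=
    (ae_restrict_iff' measurableSet_Ioo).2 key
  have hui : uIoc (0:ℝ) 1 = Ioc 0 1 := uIoc_of_le zero_le_one
  have hnumeq : numH n cn p 0 1 (Ico 0 1) γ w =ᵐ[volume.restrict (uIoc 0 1)]
      fun t => deriv s t * h3 (s t) := by
    rw [hui, ← restrict_Ioo_eq_restrict_Ioc]
    exact key'.mono fun t h => h.1
  have hnumi : IntervalIntegrable (numH n cn p 0 1 (Ico 0 1) γ w) volume 0 1 :=
    IntervalIntegrable.congr_ae hi3 hnumeq.symm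
  have hnum : ∫ t in (0:ℝ)..1, numH n cn p 0 1 (Ico 0 1) γ w t = ∫ σ in (0:ℝ)..s T, h3 σ := by
    rw [← c3]; exact intervalIntegral.integral_congr_ae_restrict hnumeq
  have hden : ∫ σ in (0:ℝ)..s T, h2 σ ≤ ∫ t in (0:ℝ)..1, denH n cn p (Ico 0 1) γ w t := by
    rw [← c2]
    refine intervalIntegral.integral_mono_ae_restrict zero_le_one hi2
      (hγ.intervalIntegrable_denH hcn hp.le hw.continuous) ?_
    rw [← restrict_Ioo_eq_restrict_Icc]
    exact key'.mono fun t h => h.2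
  rw [← hnum]
  rcases le_or_gt (∫ σ in (0:ℝ)..s T, h2 σ) 0 with h | h
  · exact (mul_nonpos_of_nonneg_of_nonpos hlam0 h).trans (hγ.integral_numH_nonneg hcn)
  · have hd := h.trans_le hden
    have := hγ.lambdaH_le hcn (p := p) hw (by simp [hwdef, hs0, hω0]) hnumi hp.le hd
    calc lam * ∫ σ in (0:ℝ)..s T, h2 σ ≤ lam * _ := mul_le_mul_of_nonneg_left hden hlam0
      _ ≤ _ := mul_le_mul_of_nonneg_right hlam hd.le
      _ ≤ _ := this

lemma integral_sub_pow {n : ℕ} (hn : 1 ≤ n) (A S s : ℝ) :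
    ∫ t in s..S, A * (S - t) ^ (n - 1) = A * (S - s) ^ n / n := by
  rw [intervalIntegral.integral_const_mul,
    intervalIntegral.integral_comp_sub_left (fun r => r ^ (n - 1)) S, integral_pow]
  obtain ⟨m, rfl⟩ : ∃ m, n = m + 1 := ⟨n - 1, by omega⟩
  simp
  ring

lemma deriv_comp_const_add' (w : ℝ → ℝ) (a t : ℝ) :
    deriv (fun x => w (a + x)) t = deriv w (a + t) := by
  simpa using deriv_comp_const_add (f := w) a t

/-- Continue a curve, from time `S` on, by the vertical segment down to the axis. -/
lemma exists_glue_segment {n : ℕ} {cn p lam S : ℝ} {z : ℝ → ℂ} (hn : 1 ≤ n) (hcn : 0 ≤ cn)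
    (hp : 1 < p) (hlam : 0 < lam) (hz : LipschitzWith 1 z) (hS : 0 ≤ S)
    (hpos : 0 < (z S).re ∧ 0 < (z S).im) (hu : Monotone fun t => uC (z t))
    (hκ : (p - 1) ^ (p - 1) * (2 / n) ^ p * (lam * (z S).im ^ p) ≤ 1)
    (hbonus : ∀ (w : ℝ → ℝ) (K : NNReal), LipschitzWith K w → w 0 = 0 →
      lam * ((∫ t in (0:ℝ)..S, |w t| ^ p * FC n cn (z t))
        + |w S| ^ p * (2 * cn / n * ((z S).re ^ (n - 1) * (z S).im ^ n)))
      ≤ ∫ t in (0:ℝ)..S, |deriv w t| ^ p * FC n cn (z t)) :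
    ∃ z' : ℝ → ℂ, LipschitzWith 1 z' ∧ (∀ t ≤ S, z' t = z t) ∧
      (Monotone fun t => uC (z' t)) ∧
      (∀ t ∈ Icc S (S + (z S).im), z' t = ⟨(z S).re, S + (z S).im - t⟩) ∧
      Feas p lam (fun t => FC n cn (z' t)) (S + (z S).im) := by
  set x := (z S).re with hx
  set y := (z S).im with hy
  set φ : ℝ → ℝ := fun t => min (max (t - S) 0) y with hφ
  have hφm : Monotone φ := fun a b hab => by
    simp only [hφ]; gcongr
  have hφ0 : ∀ t ≤ S, φ t = 0 := fun t ht => by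
    simp only [hφ]; rw [max_eq_right (by linarith), min_eq_left hpos.2.le]
  have hφ1 : ∀ t, 0 ≤ φ t ∧ φ t ≤ y := fun t =>
    ⟨le_min (le_max_right _ _) hpos.2.le, min_le_right _ _⟩
  have hsum : ∀ a b, a ≤ b → min b S - min a S + (φ b - φ a) ≤ b - a := by
    intro a b hab
    have : ∀ t, min t S + max (t - S) 0 = t := fun t => by
      rcases le_total t S with h | h
      · rw [min_eq_left h, max_eq_right (by linarith)]; ring
      · rw [min_eq_right h, max_eq_left (by linarith)]; ring
    have h1 := this a
    have h2 := this b
    have h3 : φ b - φ a ≤ max (b - S) 0 - max (a - S) 0 := by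
      have hmax : max (a - S) 0 ≤ max (b - S) 0 := by gcongr
      simp only [hφ]
      rcases le_total (max (a - S) 0) y with h | h
      · rw [min_eq_left h]; linarith [min_le_left (max (b - S) 0) y]
      · rw [min_eq_right h, min_eq_right (h.trans hmax)]; linarith
    linarith
  set z' : ℝ → ℂ := fun t => z (min t S) - (φ t : ℂ) * Complex.I with hz'
  have hz'1 : ∀ t ≤ S, z' t = z t := fun t ht => by
    simp only [hz', min_eq_left ht, hφ0 t ht]; simp
  have hre : ∀ t, (z' t).re = (z (min t S)).re := fun t => by simp [hz']
  have him : ∀ t, (z' t).im = (z (min t S)).im - φ t := fun t => by simp [hz']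
  have hφim : ∀ t, (z (min t S)).im * φ t = y * φ t := fun t => by
    rcases le_total t S with h | h
    · rw [hφ0 t h]; simp
    · rw [min_eq_right h]
  have hz'2 : ∀ t ∈ Icc S (S + y), z' t = ⟨x, S + y - t⟩ := by
    intro t ht
    have h1 : φ t = t - S := by
      simp only [hφ]; rw [max_eq_left (by linarith [ht.1]), min_eq_left (by linarith [ht.2])]
    apply Complex.ext
    · rw [hre, min_eq_right ht.1]
    · rw [him, min_eq_right ht.1, h1]; ring
  have hlip : LipschitzWith 1 z' := by
    refine LipschitzWith.of_dist_le_mul fun a b => ?_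
    wlog hab : b ≤ a generalizing a b
    · rw [dist_comm, dist_comm a b]; exact this b a (le_of_not_ge hab)
    rw [Complex.dist_eq, Real.dist_eq, abs_of_nonneg (sub_nonneg.2 hab)]
    have e : z' a - z' b = (z (min a S) - z (min b S)) - ((φ a - φ b : ℝ) : ℂ) * Complex.I := by
      simp only [hz']; push_cast; ring
    rw [e]
    refine (norm_sub_le _ _).trans ?_
    have h1 := hz.dist_le_mul (min a S) (min b S)
    have h2 : min b S ≤ min a S := by gcongr
    rw [Complex.dist_eq, Real.dist_eq, abs_of_nonneg (sub_nonneg.2 h2)] at h1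
    rw [norm_mul, Complex.norm_I, mul_one, Complex.norm_real, Real.norm_of_nonneg
      (sub_nonneg.2 (hφm hab))]
    have h3 := hsum b a hab
    simp only [NNReal.coe_one, one_mul] at h1 ⊢
    linarith
  have humono : Monotone fun t => uC (z' t) := by
    intro a b hab
    have e : ∀ t, uC (z' t) = uC (z (min t S)) + (2 * y * φ t - φ t ^ 2) / 2 := fun t => by
      simp only [uC, hre, him]
      linear_combination hφim t
    simp only [e]
    have h1 : uC (z (min a S)) ≤ uC (z (min b S)) := hu (by gcongr)
    have h2 := hφm hab
    have h3 := hφ1 a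
    have h4 := hφ1 b
    nlinarith
  refine ⟨z', hlip, hz'1, humono, hz'2, ?_⟩
  intro w K hw hw0
  have hp0 : 0 ≤ p := by linarith
  have hc : Continuous fun t => FC n cn (z' t) := (continuous_FC n cn).comp hlip.continuous
  set A := cn * x ^ (n - 1) with hA
  have hA0 : 0 ≤ A := by have := hpos.1; positivity
  have hsplit : ∀ g : ℝ → ℝ,
      (∀ a b, IntervalIntegrable (fun t => g t * FC n cn (z' t)) volume a b) →
      ∫ t in (0:ℝ)..(S + y), g t * FC n cn (z' t) = (∫ t in (0:ℝ)..S, g t * FC n cn (z t))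
        + ∫ t in (0:ℝ)..y, g (S + t) * (A * (y - t) ^ (n - 1)) := by
    intro g hg
    rw [← intervalIntegral.integral_add_adjacent_intervals (hg 0 S) (hg S (S + y))]
    congr 1
    · refine intervalIntegral.integral_congr fun t ht => ?_
      rw [uIcc_of_le hS] at ht
      simp only [hz'1 t ht.2]
    · have := intervalIntegral.integral_comp_add_left (a := 0) (b := y)
        (fun t => g t * FC n cn (z' t)) S
      rw [add_zero] at this
      rw [← this]
      refine intervalIntegral.integral_congr fun t ht => ?_
      rw [uIcc_of_le hpos.2.le] at ht
      rw [hz'2 (S + t) ⟨by linarith [ht.1], by linarith [ht.2]⟩]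
      simp only [FC, vC, mul_pow, hA]
      ring
  rw [hsplit _ fun a b => (continuous_abs_rpow_mul hp0 hw.continuous hc).intervalIntegrable a b,
    hsplit _ fun a b => intervalIntegrable_abs_deriv_rpow_mul hp0 hw hc a b]
  have hw' : LipschitzWith K fun t => w (S + t) := by
    have : LipschitzWith (K * 1) fun t => w (S + t) := hw.comp ((isometry_add_left S).lipschitz)
    simpa using this
  have h1 := segment_inequality hn hp hlam hpos.2.le hA0 hκ hw'
  simp only [deriv_comp_const_add', add_zero] at h1
  have h2 := hbonus w K hw hw0
  have e : 2 * lam / n * A * y ^ n * |w S| ^ p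
      = lam * (|w S| ^ p * (2 * cn / n * (x ^ (n - 1) * y ^ n))) := by rw [hA]; ring
  rw [e] at h1
  linarith

lemma integral_FC_segment {n : ℕ} {cn S y x : ℝ} {z : ℝ → ℂ} (hn : 1 ≤ n)
    (h : ∀ t ∈ Icc S (S + y), z t = ⟨x, S + y - t⟩) {s : ℝ} (hs : s ∈ Icc S (S + y)) :
    ∫ t in s..(S + y), FC n cn (z t) = cn / n * (x ^ (n - 1) * (S + y - s) ^ n) := by
  have : ∫ t in s..(S + y), FC n cn (z t)
      = ∫ t in s..(S + y), (cn * x ^ (n - 1)) * (S + y - t) ^ (n - 1) := by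
    refine intervalIntegral.integral_congr fun t ht => ?_
    rw [uIcc_of_le hs.2] at ht
    simp only [h t ⟨hs.1.trans ht.1, ht.2⟩, FC, vC, mul_pow]
    ring
  rw [this, integral_sub_pow hn]
  ring

/-- Among curves along which the weighted `p`-Poincaré inequality with constant `lam` holds, one can
arrange that the remaining mass is controlled by the position as soon as the curve is close to the
axis. -/
lemma exists_cut_replace {n : ℕ} {cn p lam S ys : ℝ} {z : ℝ → ℂ} (hn : 1 ≤ n) (hcn : 0 < cn)
    (hp : 1 < p) (hlam : 0 < lam) (hz : LipschitzWith 1 z) (hS : 0 ≤ S)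
    (hpos : ∀ t ∈ Icc 0 S, 0 < (z t).re ∧ 0 < (z t).im) (hu : Monotone fun t => uC (z t))
    (hκ : (p - 1) ^ (p - 1) * (2 / n) ^ p * (lam * ys ^ p) ≤ 1)
    (hF : Feas p lam (fun t => FC n cn (z t)) S) :
    ∃ (z' : ℝ → ℂ) (S' : ℝ), LipschitzWith 1 z' ∧ 0 ≤ S' ∧ z' 0 = z 0 ∧
      (∀ t ∈ Ico 0 S', 0 < (z' t).re ∧ 0 < (z' t).im) ∧
      (∀ t ∈ Icc 0 S', 0 ≤ (z' t).re ∧ 0 ≤ (z' t).im) ∧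
      (Monotone fun t => uC (z' t)) ∧ vC (z' S') ≤ vC (z S) ∧
      Feas p lam (fun t => FC n cn (z' t)) S' ∧
      ∀ s ∈ Icc 0 S', (z' s).im ≤ ys → ∫ t in s..S', FC n cn (z' t)
        ≤ 2 * cn / n * ((z' s).re ^ (n - 1) * (z' s).im ^ n) := by
  have hp0 : 0 ≤ p := by linarith
  have hc : Continuous fun t => FC n cn (z t) := (continuous_FC n cn).comp hz.continuous
  have hci : ∀ a b, IntervalIntegrable (fun t => FC n cn (z t)) volume a b :=
    fun a b => hc.intervalIntegrable a b
  set I : ℝ → ℝ := fun s => ∫ t in s..S, FC n cn (z t) with hI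
  have hIc : Continuous I := by
    have : I = fun s => -∫ t in S..s, FC n cn (z t) := by
      funext s; rw [hI]; exact intervalIntegral.integral_symm _ _
    rw [this]
    exact (intervalIntegral.continuous_primitive hci S).neg
  set D : Set ℝ := Icc 0 S ∩ {s | (z s).im ≤ ys ∧
    2 * cn / n * ((z s).re ^ (n - 1) * (z s).im ^ n) ≤ I s} with hD
  have hre : Continuous fun s => (z s).re := Complex.continuous_re.comp hz.continuous
  have him : Continuous fun s => (z s).im := Complex.continuous_im.comp hz.continuous
  have hDc : IsCompact D := by
    refine isCompact_Icc.inter_right ((isClosed_le him continuous_const).inter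
      (isClosed_le ?_ hIc))
    fun_prop
  rcases D.eq_empty_or_nonempty with hem | hne
  · refine ⟨z, S, hz, hS, rfl, fun t ht => hpos t (Ico_subset_Icc_self ht),
      fun t ht => ⟨(hpos t ht).1.le, (hpos t ht).2.le⟩, hu, le_rfl, hF, fun s hs hys => ?_⟩
    by_contra hlt
    push Not at hlt
    have : s ∈ D := ⟨hs, hys, hlt.le⟩
    rw [hem] at this
    exact this
  obtain ⟨T, ⟨hT, hTys, hTI⟩, hmin⟩ := hDc.exists_isLeast hne
  have hposT := hpos T hT
  obtain ⟨z', hz', h1, hu', h2, hF'⟩ := exists_glue_segment hn hcn.le hp hlam hz hT.1 hposT hu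
    (le_trans (by
      have := hposT.2.le
      have : (0:ℝ) ≤ p - 1 := by linarith
      gcongr) hκ) (by
    intro w K hw hw0
    have hwl : LipschitzWith K fun t => w (min t T) := by
      have : LipschitzWith (K * 1) fun t => w (min t T) :=
        hw.comp (LipschitzWith.id.min_const T)
      simpa using this
    have h := hF _ K hwl (by simp only [min_eq_left hT.1, hw0])
    have hi := fun a b => (continuous_abs_rpow_mul hp0 hwl.continuous hc).intervalIntegrable
      (μ := volume) a b
    have hi' := fun a b => intervalIntegrable_abs_deriv_rpow_mul hp0 hwl hc a b
    rw [← intervalIntegral.integral_add_adjacent_intervals (hi 0 T) (hi T S),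
      ← intervalIntegral.integral_add_adjacent_intervals (hi' 0 T) (hi' T S)] at h
    have e1 : ∫ t in (0:ℝ)..T, |w (min t T)| ^ p * FC n cn (z t)
        = ∫ t in (0:ℝ)..T, |w t| ^ p * FC n cn (z t) := by
      refine intervalIntegral.integral_congr fun t ht => ?_
      rw [uIcc_of_le hT.1] at ht
      simp only [min_eq_left ht.2]
    have e2 : ∫ t in T..S, |w (min t T)| ^ p * FC n cn (z t) = |w T| ^ p * I T := by
      rw [hI, ← intervalIntegral.integral_const_mul]
      refine intervalIntegral.integral_congr fun t ht => ?_
      rw [uIcc_of_le hT.2] at ht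
      simp only [min_eq_right ht.1]
    have e3 : ∫ t in (0:ℝ)..T, |deriv (fun t => w (min t T)) t| ^ p * FC n cn (z t)
        = ∫ t in (0:ℝ)..T, |deriv w t| ^ p * FC n cn (z t) := by
      rw [intervalIntegral.integral_of_le hT.1, intervalIntegral.integral_of_le hT.1,
        integral_Ioc_eq_integral_Ioo, integral_Ioc_eq_integral_Ioo]
      refine setIntegral_congr_fun measurableSet_Ioo fun t ht => ?_
      have : (fun t => w (min t T)) =ᶠ[𝓝 t] w := by
        filter_upwards [Iio_mem_nhds ht.2] with r hr
        rw [min_eq_left (le_of_lt hr)]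
      simp only [this.deriv_eq]
    have e4 : ∫ t in T..S, |deriv (fun t => w (min t T)) t| ^ p * FC n cn (z t) = 0 := by
      rw [intervalIntegral.integral_of_le hT.2]
      refine setIntegral_eq_zero_of_forall_eq_zero fun t ht => ?_
      have : (fun t => w (min t T)) =ᶠ[𝓝 t] fun _ => w T := by
        filter_upwards [Ioi_mem_nhds ht.1] with r hr
        rw [min_eq_right (le_of_lt hr)]
      rw [this.deriv_eq, deriv_const, abs_zero, Real.zero_rpow (by linarith), zero_mul]
    rw [e1, e2, e3, e4, add_zero] at h
    refine le_trans ?_ h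
    gcongr)
  have hc' : Continuous fun t => FC n cn (z' t) := (continuous_FC n cn).comp hz'.continuous
  have hci' : ∀ a b, IntervalIntegrable (fun t => FC n cn (z' t)) volume a b :=
    fun a b => hc'.intervalIntegrable a b
  have hpos' : ∀ t ∈ Ico 0 (T + (z T).im), 0 < (z' t).re ∧ 0 < (z' t).im := by
    intro t ht
    rcases le_total t T with h | h
    · rw [h1 t h]; exact hpos t ⟨ht.1, h.trans hT.2⟩
    · rw [h2 t ⟨h, ht.2.le⟩]; exact ⟨hposT.1, by simpa using ht.2⟩
  have hend : z' (T + (z T).im) = ⟨(z T).re, 0⟩ := by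
    rw [h2 _ ⟨by linarith [hposT.2], le_rfl⟩]; simp
  refine ⟨z', T + (z T).im, hz', by linarith [hT.1, hposT.2], h1 0 hT.1, hpos', ?_, hu', ?_,
    hF', ?_⟩
  · intro t ht
    rcases ht.2.eq_or_lt with h | h
    · rw [h, hend]; exact ⟨hposT.1.le, le_rfl⟩
    · exact ⟨(hpos' t ⟨ht.1, h⟩).1.le, (hpos' t ⟨ht.1, h⟩).2.le⟩
  · rw [hend]
    have := hpos S ⟨hS, le_rfl⟩
    simp only [vC, mul_zero]
    exact (mul_pos this.1 this.2).le
  · intro s hs hys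
    rcases lt_or_ge s T with h | h
    · rw [h1 s h.le] at hys ⊢
      have hsD : s ∉ D := fun hmem => absurd (hmin hmem) (not_le.2 h)
      have hlt : I s < 2 * cn / n * ((z s).re ^ (n - 1) * (z s).im ^ n) := by
        by_contra hcon
        exact hsD ⟨⟨hs.1, h.le.trans hT.2⟩, hys, not_lt.1 hcon⟩
      refine le_trans ?_ hlt.le
      rw [← intervalIntegral.integral_add_adjacent_intervals (hci' s T) (hci' T _),
        integral_FC_segment hn h2 ⟨le_rfl, by linarith [hposT.2]⟩, hI]
      simp only
      rw [← intervalIntegral.integral_add_adjacent_intervals (hci s T) (hci T S)]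
      have e : ∫ t in s..T, FC n cn (z' t) = ∫ t in s..T, FC n cn (z t) := by
        refine intervalIntegral.integral_congr fun t ht => ?_
        rw [uIcc_of_le h.le] at ht
        simp only [h1 t ht.2]
      rw [e]
      have h3 : cn / n * ((z T).re ^ (n - 1) * (T + (z T).im - T) ^ n) ≤
          2 * cn / n * ((z T).re ^ (n - 1) * (z T).im ^ n) := by
        rw [add_sub_cancel_left]
        have := hposT.1
        have := hposT.2
        gcongr
        linarith
      linarith
    · rw [integral_FC_segment hn h2 ⟨h, hs.2⟩, h2 s ⟨h, hs.2⟩]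
      have := hposT.1
      have := hs.2
      have : 0 ≤ T + (z T).im - s := by linarith
      simp only
      gcongr
      linarith

lemma re_ge_im_of_uC_nonneg {z : ℂ} (h : 0 ≤ uC z) (h1 : 0 ≤ z.re) : z.im ≤ z.re := by
  unfold uC at h
  by_contra! hlt
  nlinarith

/-- Normalized curves of length at most `L` with uniform control of the remaining length. -/
structure Good (n : ℕ) (C : ℝ) (z0 : ℂ) (L : ℝ) (c : ℝ → ℂ) : Prop where
  nonneg : 0 ≤ L
  dist_le : ∀ s ∈ Icc (0:ℝ) 1, ∀ t ∈ Icc (0:ℝ) 1, dist (c s) (c t) ≤ L * |s - t|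
  start : c 0 = z0
  mem : ∀ t ∈ Icc (0:ℝ) 1, 0 ≤ (c t).re ∧ 0 ≤ (c t).im
  mono : MonotoneOn (fun t => uC (c t)) (Icc 0 1)
  rem : ∀ t ∈ Icc (0:ℝ) 1, (L * (1 - t)) ^ (2 * n - 1) ≤ C * ((c t).re ^ (n - 1) * (c t).im ^ n)
  rem' : ∀ t ∈ Icc (0:ℝ) 1, √(2 * uC (c t)) ^ (n - 1) * (L * (1 - t)) ^ n
    ≤ C * ((c t).re ^ (n - 1) * (c t).im ^ n)

lemma exists_good_of_mass_bound {n : ℕ} {cn B : ℝ} (hn : 1 ≤ n) (hcn : 0 < cn) (hB : 0 < B) :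
    ∃ C > 0, ∀ (z : ℝ → ℂ) (S : ℝ), LipschitzWith 1 z → 0 ≤ S →
      (∀ t ∈ Ico 0 S, 0 < (z t).re ∧ 0 < (z t).im) →
      (∀ t ∈ Icc 0 S, 0 ≤ (z t).re ∧ 0 ≤ (z t).im) →
      (Monotone fun t => uC (z t)) → 0 ≤ uC (z 0) →
      (∀ s ∈ Icc 0 S, ∫ t in s..S, FC n cn (z t) ≤ B * ((z s).re ^ (n - 1) * (z s).im ^ n)) →
      Good n C (z 0) S fun t => z (S * t) := by
  obtain ⟨m, rfl⟩ : ∃ m, n = m + 1 := ⟨n - 1, by omega⟩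
  simp only [Nat.add_sub_cancel]
  set C1 : ℝ := ((2 * m + 1 : ℕ) : ℝ) ^ (2 * m + 1) * B * B ^ (2 * m) / cn ^ (2 * m + 1) with hC1
  set C2 : ℝ := ((m + 1 : ℕ) : ℝ) ^ (m + 1) * B * B ^ m / cn ^ (m + 1) with hC2
  have hC1p : 0 < C1 := by positivity
  refine ⟨max C1 C2, lt_max_of_lt_left hC1p, fun z S hz hS hpos hnn hu hu0 hI => ?_⟩
  have hc : Continuous fun t => FC (m + 1) cn (z t) := (continuous_FC _ cn).comp hz.continuous
  have hxy : ∀ t ∈ Icc 0 S, (z t).im ≤ (z t).re := fun t ht =>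
    re_ge_im_of_uC_nonneg (hu0.trans (hu ht.1)) (hnn t ht).1
  have hInn : ∀ s ∈ Icc 0 S, 0 ≤ ∫ t in s..S, FC (m + 1) cn (z t) := fun s hs =>
    intervalIntegral.integral_nonneg hs.2 fun t ht =>
      FC_nonneg hcn.le (hnn t ⟨hs.1.trans ht.1, ht.2⟩).1 (hnn t ⟨hs.1.trans ht.1, ht.2⟩).2
  have hFpos : ∀ t ∈ Ico 0 S, 0 < FC (m + 1) cn (z t) := fun t ht => by
    have h1 := (hpos t ht).1
    have h2 := (hpos t ht).2
    unfold FC vC; positivity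
  have hX : ∀ s ∈ Icc 0 S, 0 ≤ (z s).re ^ m * (z s).im ^ (m + 1) := fun s hs => by
    have h1 := (hnn s hs).1
    have h2 := (hnn s hs).2
    positivity
  have hmem : ∀ t ∈ Icc (0:ℝ) 1, S * t ∈ Icc 0 S := fun t ht =>
    ⟨mul_nonneg hS ht.1, mul_le_of_le_one_right hS ht.2⟩
  have r1 : ∀ s ∈ Icc 0 S, (S - s) ^ (2 * m + 1) ≤ C1 * ((z s).re ^ m * (z s).im ^ (m + 1)) := by
    intro s hs
    have := remaining_length_le (N := 2 * m + 1) (by omega) hc (a := s) hs.2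
      (k := cn ^ (2 * m + 1) / B ^ (2 * m)) (by positivity)
      (fun t ht => hFpos t ⟨hs.1.trans ht.1, ht.2⟩) (by
        intro t ht
        have ht' : t ∈ Icc 0 S := ⟨hs.1.trans ht.1, ht.2.le⟩
        have h1 := (hnn t ht').1
        have h2 := (hnn t ht').2
        have h3 := pow_le_pow_left₀ (hInn t ht') (hI t ht') (2 * m)
        simp only [Nat.add_sub_cancel] at h3 ⊢
        have h4 : (z t).im ^ (2 * m) ≤ ((z t).re * (z t).im) ^ m := by
          rw [pow_mul]; gcongr; nlinarith [hxy t ht']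
        rw [div_mul_eq_mul_div, div_le_iff₀ (by positivity)]
        calc cn ^ (2 * m + 1) * (∫ r in t..S, FC (m + 1) cn (z r)) ^ (2 * m)
            ≤ cn ^ (2 * m + 1) * (B * ((z t).re ^ m * (z t).im ^ (m + 1))) ^ (2 * m) := by gcongr
          _ = cn ^ (2 * m + 1) * B ^ (2 * m) * (((z t).re * (z t).im) ^ m) ^ (2 * m)
              * (z t).im ^ (2 * m) := by ring
          _ ≤ cn ^ (2 * m + 1) * B ^ (2 * m) * (((z t).re * (z t).im) ^ m) ^ (2 * m)
              * ((z t).re * (z t).im) ^ m := by gcongr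
          _ = FC (m + 1) cn (z t) ^ (2 * m + 1) * B ^ (2 * m) := by
            simp only [FC, vC, Nat.add_sub_cancel]; ring)
    have h5 := hI s hs
    have h6 : cn ^ (2 * m + 1) / B ^ (2 * m) * (S - s) ^ (2 * m + 1) ≤
        ((2 * m + 1 : ℕ) : ℝ) ^ (2 * m + 1) * (B * ((z s).re ^ m * (z s).im ^ (m + 1))) :=
      this.trans (by gcongr)
    rw [div_mul_eq_mul_div, div_le_iff₀ (by positivity)] at h6
    rw [hC1, div_mul_eq_mul_div, le_div_iff₀ (by positivity)]
    linarith
  have r2 : ∀ s ∈ Icc 0 S, √(2 * uC (z s)) ^ m * (S - s) ^ (m + 1)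
      ≤ C2 * ((z s).re ^ m * (z s).im ^ (m + 1)) := by
    intro s hs
    have := remaining_length_le (N := m + 1) (by omega) hc (a := s) hs.2
      (k := cn ^ (m + 1) * √(2 * uC (z s)) ^ m / B ^ m) (by positivity)
      (fun t ht => hFpos t ⟨hs.1.trans ht.1, ht.2⟩) (by
        intro t ht
        have ht' : t ∈ Icc 0 S := ⟨hs.1.trans ht.1, ht.2.le⟩
        have h1 := (hnn t ht').1
        have h2 := (hnn t ht').2
        have h3 := pow_le_pow_left₀ (hInn t ht') (hI t ht') m
        simp only [Nat.add_sub_cancel] at h3 ⊢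
        have h4 : √(2 * uC (z s)) ≤ (z t).re := by
          refine Real.sqrt_le_iff.2 ⟨h1, ?_⟩
          have := hu ht.1
          simp only [uC] at this ⊢
          nlinarith [sq_nonneg (z t).im]
        rw [div_mul_eq_mul_div, div_le_iff₀ (by positivity)]
        calc cn ^ (m + 1) * √(2 * uC (z s)) ^ m * (∫ r in t..S, FC (m + 1) cn (z r)) ^ m
            ≤ cn ^ (m + 1) * (z t).re ^ m * (B * ((z t).re ^ m * (z t).im ^ (m + 1))) ^ m := by
              gcongr
              exact pow_nonneg (hInn t ht') m
          _ = FC (m + 1) cn (z t) ^ (m + 1) * B ^ m := by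
            simp only [FC, vC, Nat.add_sub_cancel]; ring)
    have h5 := hI s hs
    have h6 : cn ^ (m + 1) * √(2 * uC (z s)) ^ m / B ^ m * (S - s) ^ (m + 1) ≤
        ((m + 1 : ℕ) : ℝ) ^ (m + 1) * (B * ((z s).re ^ m * (z s).im ^ (m + 1))) :=
      this.trans (by gcongr)
    rw [div_mul_eq_mul_div, div_le_iff₀ (by positivity)] at h6
    rw [hC2, div_mul_eq_mul_div, le_div_iff₀ (by positivity)]
    linarith
  have hsub : ∀ t, S * (1 - t) = S - S * t := fun t => by ring
  refine ⟨hS, ?_, by simp, fun t ht => hnn _ (hmem t ht), ?_, ?_, ?_⟩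
  · intro s _ t _
    have := hz.dist_le_mul (S * s) (S * t)
    rwa [Real.dist_eq (S * s), ← mul_sub, abs_mul, abs_of_nonneg hS, NNReal.coe_one,
      one_mul] at this
  · intro a _ b _ hab
    exact hu (mul_le_mul_of_nonneg_left hab hS)
  · intro t ht
    rw [hsub, show 2 * (m + 1) - 1 = 2 * m + 1 by omega]
    refine (r1 _ (hmem t ht)).trans ?_
    exact mul_le_mul_of_nonneg_right (le_max_left _ _) (hX _ (hmem t ht))
  · intro t ht
    rw [hsub]
    refine (r2 _ (hmem t ht)).trans ?_
    exact mul_le_mul_of_nonneg_right (le_max_right _ _) (hX _ (hmem t ht))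

lemma abs_re_sub_le_of_lipschitz {z : ℝ → ℂ} (hz : LipschitzWith 1 z) {t : ℝ} (ht : 0 ≤ t) :
    |(z t).re - (z 0).re| ≤ t ∧ |(z t).im - (z 0).im| ≤ t := by
  have h := hz.dist_le_mul t 0
  rw [Complex.dist_eq, Real.dist_eq, sub_zero, abs_of_nonneg ht, NNReal.coe_one, one_mul] at h
  exact ⟨by simpa using (Complex.abs_re_le_norm (z t - z 0)).trans h,
    by simpa using (Complex.abs_im_le_norm (z t - z 0)).trans h⟩

lemma Feas.le_testBound {n : ℕ} {cn p lam S : ℝ} (hcn : 0 < cn) (hp : 0 < p) (hlam : 0 ≤ lam)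
    {z : ℝ → ℂ} (hz : LipschitzWith 1 z) (hS : 0 ≤ S) (h0 : 0 < (z 0).im)
    (h0' : (z 0).im ≤ (z 0).re)
    (hnn : ∀ t ∈ Icc 0 S, 0 ≤ (z t).re ∧ 0 ≤ (z t).im) (hv : vC (z S) < vC (z 0) / 4)
    (hF : Feas p lam (fun t => FC n cn (z t)) S) :
    lam ≤ (4 / (z 0).im) ^ p * 16 ^ (n - 1) := by
  set x := (z 0).re
  set y := (z 0).im
  have hx0 : 0 < x := h0.trans_le h0'
  have hc : Continuous fun t => FC n cn (z t) := (continuous_FC n cn).comp hz.continuous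
  have hbd : ∀ t, 0 ≤ t → t ≤ y / 2 → (x / 2 ≤ (z t).re ∧ (z t).re ≤ 2 * x) ∧
      (y / 2 ≤ (z t).im ∧ (z t).im ≤ 2 * y) := by
    intro t ht ht'
    have h := abs_re_sub_le_of_lipschitz hz ht
    have h1 := abs_le.1 h.1
    have h2 := abs_le.1 h.2
    refine ⟨⟨?_, ?_⟩, ?_, ?_⟩ <;> linarith [h1.1, h1.2, h2.1, h2.2]
  have hlen : y / 2 ≤ S := by
    by_contra! hlt
    obtain ⟨⟨h1, -⟩, h2, -⟩ := hbd S hS hlt.le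
    have : x / 2 * (y / 2) ≤ (z S).re * (z S).im := mul_le_mul h1 h2 (by positivity) (by linarith)
    simp only [vC] at hv
    change _ < x * y / 4 at hv
    linarith
  set m := cn * (x * y / 4) ^ (n - 1) with hm
  have hmp : 0 < m := by positivity
  have := hF.le_of_bounds hp hlam hc (fun t ht => FC_nonneg hcn.le (hnn t ht).1 (hnn t ht).2)
    (S' := y / 2) (by positivity) hlen (m := m) (M := cn * (4 * (x * y)) ^ (n - 1))
    (by
      intro t ht
      obtain ⟨⟨h1, -⟩, h2, -⟩ := hbd t (by linarith [ht.1]) ht.2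
      have : x / 2 * (y / 2) ≤ (z t).re * (z t).im :=
        mul_le_mul h1 h2 (by positivity) (by linarith)
      simp only [FC, vC, hm]
      gcongr
      linarith)
    (by
      intro t ht
      obtain ⟨⟨h1, h3⟩, h2, h4⟩ := hbd t ht.1 (by linarith [ht.2])
      have : (z t).re * (z t).im ≤ 2 * x * (2 * y) := by gcongr; linarith
      have h5 : 0 ≤ (z t).re * (z t).im := mul_nonneg (by linarith) (by linarith)
      have h6 : (z t).re * (z t).im ≤ 4 * (x * y) := by linarith
      simp only [FC, vC]
      gcongr)
  have e : cn * (4 * (x * y)) ^ (n - 1) = 16 ^ (n - 1) * m := by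
    rw [hm, mul_left_comm (16 ^ (n - 1)), ← mul_pow]; congr 2; ring
  rw [e, ← mul_assoc ((2 / (y / 2)) ^ p)] at this
  have h2 := le_of_mul_le_mul_right this hmp
  rwa [show 2 / (y / 2) = 4 / y by field_simp; norm_num] at h2

lemma exists_mass_bound {n : ℕ} {cn p lam0 ys r : ℝ} (hn : 1 ≤ n) (hcn : 0 < cn)
    (hp : 2 * (n:ℝ) - 1 ≤ p) (hlam0 : 0 < lam0) (hys : 0 < ys) (hr : 0 ≤ r) :
    ∃ B > 0, ∀ (lam : ℝ) (z : ℝ → ℂ) (S : ℝ), lam0 ≤ lam → LipschitzWith 1 z → ‖z 0‖ ≤ r →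
      0 ≤ S → (∀ t ∈ Icc 0 S, 0 ≤ (z t).re ∧ 0 ≤ (z t).im) →
      (Monotone fun t => uC (z t)) → 0 ≤ uC (z 0) →
      Feas p lam (fun t => FC n cn (z t)) S →
      (∀ s ∈ Icc 0 S, (z s).im ≤ ys → ∫ t in s..S, FC n cn (z t)
        ≤ 2 * cn / n * ((z s).re ^ (n - 1) * (z s).im ^ n)) →
      ∀ s ∈ Icc 0 S, ∫ t in s..S, FC n cn (z t) ≤ B * ((z s).re ^ (n - 1) * (z s).im ^ n) := by
  obtain ⟨m, rfl⟩ : ∃ m, n = m + 1 := ⟨n - 1, by omega⟩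
  simp only [Nat.add_sub_cancel]
  have hp0 : 0 < p := by push_cast at hp; have : (0:ℝ) ≤ m := by positivity
                         linarith
  set L : ℝ := max (max 1 r) (2 ^ p * 4 ^ m / (lam0 * (ys ^ 2) ^ m)) with hL
  have hL1 : 1 ≤ L := (le_max_left _ _).trans (le_max_left _ _)
  have hLr : r ≤ L := (le_max_right _ _).trans (le_max_left _ _)
  have hL3 : 2 ^ p * 4 ^ m / (lam0 * (ys ^ 2) ^ m) ≤ L := le_max_right _ _
  set X := r + L with hX
  have hX0 : 0 < X := by linarith
  set B0 : ℝ := 2 * cn / ((m + 1 : ℕ) : ℝ) with hB0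
  have hB0p : 0 < B0 := by positivity
  set B1 : ℝ := L * (cn * (X * X) ^ m) + B0 * (X ^ m * X ^ (m + 1)) with hB1
  have hB1p : 0 < B1 := by positivity
  refine ⟨max B0 (B1 / (ys ^ m * ys ^ (m + 1))), lt_max_of_lt_left hB0p, ?_⟩
  intro lam z S hlam hz hz0 hS hnn hu hu0 hF hP s hs
  have hc : Continuous fun t => FC (m + 1) cn (z t) := (continuous_FC _ cn).comp hz.continuous
  have hci : ∀ a b, IntervalIntegrable (fun t => FC (m + 1) cn (z t)) volume a b :=
    fun a b => hc.intervalIntegrable a b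
  have hFnn : ∀ t ∈ Icc 0 S, 0 ≤ FC (m + 1) cn (z t) := fun t ht =>
    FC_nonneg hcn.le (hnn t ht).1 (hnn t ht).2
  have hxy : ∀ t ∈ Icc 0 S, (z t).im ≤ (z t).re := fun t ht =>
    re_ge_im_of_uC_nonneg (hu0.trans (hu ht.1)) (hnn t ht).1
  have hnorm : ∀ t, 0 ≤ t → ‖z t‖ ≤ r + t := by
    intro t ht
    have h := hz.dist_le_mul t 0
    rw [Complex.dist_eq, Real.dist_eq, sub_zero, abs_of_nonneg ht, NNReal.coe_one, one_mul] at h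
    have := norm_add_le (z t - z 0) (z 0)
    rw [sub_add_cancel] at this
    linarith
  have hreim : ∀ t, 0 ≤ t → ∀ Y, r + t ≤ Y → (z t).re ≤ Y ∧ (z t).im ≤ Y := fun t ht Y hY =>
    ⟨(Complex.re_le_norm _).trans ((hnorm t ht).trans hY),
      (Complex.im_le_norm _).trans ((hnorm t ht).trans hY)⟩
  have hFle : ∀ t ∈ Icc 0 S, ∀ Y, r + t ≤ Y → FC (m + 1) cn (z t) ≤ cn * (Y * Y) ^ m := by
    intro t ht Y hY
    have h1 := hreim t ht.1 Y hY
    have h2 := hnn t ht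
    have h3 : 0 ≤ Y := h2.1.trans h1.1
    have : (z t).re * (z t).im ≤ Y * Y := mul_le_mul h1.1 h1.2 h2.2 h3
    have h5 := mul_nonneg h2.1 h2.2
    simp only [FC, vC, Nat.add_sub_cancel]
    gcongr
  have hlen : ∀ T ∈ Icc 0 S, (∀ t ∈ Icc 0 T, ys < (z t).im) → T ≤ L := by
    intro T hT hTy
    by_contra! hlt
    have hT1 : 1 < T := hL1.trans_lt hlt
    have hT0 : 0 < T := by linarith
    have h1 := hF.le_of_bounds hp0 (hlam0.le.trans hlam) hc hFnn (S' := T) hT0 hT.2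
      (m := cn * (ys ^ 2) ^ m) (M := cn * (2 * T * (2 * T)) ^ m)
      (by
        intro t ht
        have ht' : t ∈ Icc 0 T := ⟨by linarith [ht.1], ht.2⟩
        have h1 := hTy t ht'
        have h2 := hxy t ⟨ht'.1, ht'.2.trans hT.2⟩
        simp only [FC, vC, Nat.add_sub_cancel]
        gcongr
        nlinarith)
      (fun t ht => hFle t ⟨ht.1, by linarith [ht.2, hT.2]⟩ _ (by linarith [ht.2]))
    have hTp : T ^ (2 * m + 1) ≤ T ^ p := by
      rw [← Real.rpow_natCast]
      refine Real.rpow_le_rpow_of_exponent_le hT1.le ?_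
      push_cast at hp ⊢; linarith
    have h2 : lam0 * (ys ^ 2) ^ m * T ≤ 2 ^ p * 4 ^ m := by
      rw [Real.div_rpow (by norm_num) hT0.le, div_mul_eq_mul_div, le_div_iff₀ (by positivity)] at h1
      have h3 : cn * T ^ (2 * m) * (lam0 * (ys ^ 2) ^ m * T) ≤
          cn * T ^ (2 * m) * (2 ^ p * 4 ^ m) := by
        calc cn * T ^ (2 * m) * (lam0 * (ys ^ 2) ^ m * T)
            = lam0 * (cn * (ys ^ 2) ^ m) * T ^ (2 * m + 1) := by ring
          _ ≤ lam * (cn * (ys ^ 2) ^ m) * T ^ p := by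
            have := hlam0.le.trans hlam
            gcongr
          _ ≤ _ := h1
          _ = cn * T ^ (2 * m) * (2 ^ p * 4 ^ m) := by
            have : (2 * T * (2 * T)) ^ m = 4 ^ m * T ^ (2 * m) := by
              rw [pow_mul, ← mul_pow]; ring
            rw [this]; ring
      exact le_of_mul_le_mul_left h3 (by positivity)
    have h3 : T ≤ 2 ^ p * 4 ^ m / (lam0 * (ys ^ 2) ^ m) := by
      rw [le_div_iff₀ (by positivity)]; linarith
    linarith
  have hmass : ∀ T ∈ Icc 0 S, T ≤ L →
      ∫ t in (0:ℝ)..T, FC (m + 1) cn (z t) ≤ L * (cn * (X * X) ^ m) := by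
    intro T hT hTL
    have h := intervalIntegral.integral_mono_on hT.1 (hci 0 T)
      (intervalIntegrable_const (c := cn * (X * X) ^ m)) fun t ht =>
        hFle t ⟨ht.1, ht.2.trans hT.2⟩ X (by linarith [ht.2])
    rw [intervalIntegral.integral_const, sub_zero, smul_eq_mul] at h
    exact h.trans (by gcongr)
  have hI0 : ∫ t in (0:ℝ)..S, FC (m + 1) cn (z t) ≤ B1 := by
    have him : Continuous fun s => (z s).im := Complex.continuous_im.comp hz.continuous
    have hE : IsCompact (Icc 0 S ∩ {s | (z s).im ≤ ys}) :=
      isCompact_Icc.inter_right (isClosed_le him continuous_const)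
    rcases (Icc 0 S ∩ {s | (z s).im ≤ ys}).eq_empty_or_nonempty with hem | hne
    · have hSL : S ≤ L := hlen S ⟨hS, le_rfl⟩ fun t ht => by
        by_contra! hle
        have : t ∈ Icc 0 S ∩ {s | (z s).im ≤ ys} := ⟨ht, hle⟩
        rw [hem] at this; exact this
      have := hmass S ⟨hS, le_rfl⟩ hSL
      have : 0 ≤ B0 * (X ^ m * X ^ (m + 1)) := by positivity
      rw [hB1]; linarith
    · obtain ⟨T, ⟨hT, hTy⟩, hmin⟩ := hE.exists_isLeast hne
      have hTL : T ≤ L := by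
        by_contra! hlt
        set T' := (L + T) / 2 with hT'
        have : T' ≤ L := hlen T' ⟨by linarith, by linarith [hT.2]⟩ fun t ht => by
          by_contra! hle
          have := hmin ⟨⟨ht.1, by linarith [ht.2, hT.2]⟩, hle⟩
          linarith [ht.2]
        linarith
      rw [← intervalIntegral.integral_add_adjacent_intervals (hci 0 T) (hci T S)]
      have h1 := hmass T hT hTL
      have h2 := hP T hT hTy
      have h3 := hreim T hT.1 X (by linarith)
      have h4 := hnn T hT
      have h5 : (z T).re ^ m * (z T).im ^ (m + 1) ≤ X ^ m * X ^ (m + 1) := by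
        have := h4.1
        have := h4.2
        have := h3.1
        have := h3.2
        gcongr
      have h6 := mul_le_mul_of_nonneg_left h5 hB0p.le
      rw [hB1]
      linarith
  have hnns := hnn s hs
  have hY : 0 ≤ (z s).re ^ m * (z s).im ^ (m + 1) :=
    mul_nonneg (pow_nonneg hnns.1 _) (pow_nonneg hnns.2 _)
  rcases le_or_gt (z s).im ys with h | h
  · exact (hP s hs h).trans (mul_le_mul_of_nonneg_right (le_max_left _ _) hY)
  · have h1 : ∫ t in s..S, FC (m + 1) cn (z t) ≤ B1 := by
      rw [← intervalIntegral.integral_add_adjacent_intervals (hci 0 s) (hci s S)] at hI0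
      have : 0 ≤ ∫ t in (0:ℝ)..s, FC (m + 1) cn (z t) :=
        intervalIntegral.integral_nonneg hs.1 fun t ht => hFnn t ⟨ht.1, ht.2.trans hs.2⟩
      linarith
    have h2 : ys ^ m * ys ^ (m + 1) ≤ (z s).re ^ m * (z s).im ^ (m + 1) := by
      have := h.le.trans (hxy s hs)
      have := hnns.1
      gcongr
    calc _ ≤ B1 := h1
      _ = B1 / (ys ^ m * ys ^ (m + 1)) * (ys ^ m * ys ^ (m + 1)) := by field_simp
      _ ≤ max B0 (B1 / (ys ^ m * ys ^ (m + 1))) * ((z s).re ^ m * (z s).im ^ (m + 1)) := by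
        gcongr
        exact le_max_right _ _

/-- All curves of the variational problem can be replaced by well-controlled ones. -/
lemma exists_uniform_good {n : ℕ} {cn x0 y0 p : ℝ} (hn : 2 ≤ n) (hcn : 0 < cn) (hy0 : 0 < y0)
    (hxy : y0 ≤ x0) (hp : 2 * (n:ℝ) - 1 ≤ p) :
    ∃ C > 0, ∃ lam0 > 0, ∃ lam1, lam0 ≤ lam1 ∧
      (∃ (L : ℝ) (c : ℝ → ℂ), Good n C ⟨x0, y0⟩ L c ∧ vC (c 1) ≤ 0 ∧
        Feas p (lam0 * L ^ p) (fun t => FC n cn (c t)) 1) ∧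
      ∀ γ : ℝ → ℝ × ℝ, MemRh n cn x0 y0 γ → ∀ lam, lam0 ≤ lam → lam ≤ lambdaH n cn p γ →
        lam ≤ lam1 ∧ ∀ δ > 0, ∃ (L : ℝ) (c : ℝ → ℂ), Good n C ⟨x0, y0⟩ L c ∧ vC (c 1) ≤ δ ∧
          Feas p (lam * L ^ p) (fun t => FC n cn (c t)) 1 := by
  have hn1 : 1 ≤ n := by omega
  have hn2 : (2:ℝ) ≤ n := by exact_mod_cast hn
  have hp1 : 1 < p := by linarith
  have hp0 : 0 < p := by linarith
  have hx0 : 0 < x0 := by linarith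
  set z0 : ℂ := ⟨x0, y0⟩ with hz0
  have hu00 : 0 ≤ uC z0 := by simp only [uC, hz0]; nlinarith
  set κ : ℝ := (p - 1) ^ (p - 1) * (2 / n) ^ p with hκ
  have hκp : 0 < κ := by have : 0 < p - 1 := by linarith
                         positivity
  set lam0 : ℝ := 1 / (κ * y0 ^ p) with hlam0
  have hlam0p : 0 < lam0 := by positivity
  set lam1 : ℝ := max ((4 / y0) ^ p * 16 ^ (n - 1)) lam0 with hlam1
  have hlam1p : 0 < lam1 := lt_max_of_lt_right hlam0p
  set ys : ℝ := (1 / (κ * lam1)) ^ (1 / p) with hys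
  have hysp : 0 < ys := by positivity
  have hyspow : ys ^ p = 1 / (κ * lam1) := by
    rw [hys, ← Real.rpow_mul (by positivity), one_div_mul_cancel hp0.ne', Real.rpow_one]
  obtain ⟨B, hB, hmass⟩ := exists_mass_bound (p := p) (r := ‖z0‖) hn1 hcn hp hlam0p hysp
    (norm_nonneg _)
  obtain ⟨C, hC, hgood⟩ := exists_good_of_mass_bound (B := max B (cn / n)) hn1 hcn
    (lt_max_of_lt_left hB)
  refine ⟨C, hC, lam0, hlam0p, lam1, le_max_right _ _, ?_, ?_⟩
  · obtain ⟨z, hz, h1, hu, h2, hF⟩ := exists_glue_segment (n := n) (cn := cn) (p := p)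
      (lam := lam0) (S := 0) (z := fun _ => z0) hn1 hcn.le hp1 hlam0p
      ((LipschitzWith.const z0).weaken zero_le_one) le_rfl ⟨hx0, hy0⟩ monotone_const
      (by
        change κ * (lam0 * y0 ^ p) ≤ 1
        rw [hlam0]
        exact le_of_eq (by field_simp)) (by
        intro w K hw hw0
        simp [hw0, Real.zero_rpow hp0.ne'])
    have hI := fun s hs => integral_FC_segment (n := n) (cn := cn) hn1 h2 (s := s) hs
    simp only [zero_add] at h2 hF hI
    change ∀ t ∈ Icc 0 y0, z t = ⟨x0, y0 - t⟩ at h2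
    change Feas p lam0 (fun t => FC n cn (z t)) y0 at hF
    have hz00 : z 0 = z0 := h1 0 le_rfl
    refine ⟨y0, fun t => z (y0 * t), ?_, ?_, ?_⟩
    · rw [← hz00]
      refine hgood z y0 hz hy0.le (fun t ht => ?_) (fun t ht => ?_) hu (by rwa [hz00])
        fun s hs => ?_
      · rw [h2 t (Ico_subset_Icc_self ht)]
        exact ⟨hx0, sub_pos.2 ht.2⟩
      · rw [h2 t ht]
        exact ⟨hx0.le, sub_nonneg.2 ht.2⟩
      · refine (hI s hs).le.trans ?_
        rw [h2 s hs]
        have : 0 ≤ y0 - s := sub_nonneg.2 hs.2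
        have h3 : cn / n ≤ max B (cn / n) := le_max_right _ _
        exact mul_le_mul_of_nonneg_right h3 (by simp only [hz0]; positivity)
    · simp only [mul_one]
      rw [h2 y0 ⟨hy0.le, le_rfl⟩]
      simp [vC]
    · exact hF.scale hy0
  · intro γ hγ lam hlam hlamγ
    have hlamp : 0 < lam := hlam0p.trans_le hlam
    have key : ∀ δ > 0, ∃ (S : ℝ) (z : ℝ → ℂ), 0 ≤ S ∧ LipschitzWith 1 z ∧ z 0 = z0 ∧
        (∀ t ∈ Icc 0 S, 0 < (z t).re ∧ 0 < (z t).im) ∧ vC (z S) ≤ δ ∧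
        vC (z S) < vC z0 / 4 ∧
        Feas p lam (fun t => FC n cn (z t)) S ∧ Monotone fun t => uC (z t) := by
      intro δ hδ
      obtain ⟨S, z, hS, hz, hz0', hpos, hv, hF⟩ := exists_feas_of_memRh hcn hp0 hγ hlamp.le hlamγ
        (ε := min δ (x0 * y0 / 8)) (by positivity)
      obtain ⟨z2, hz2, hz20, hpos2, hv2, hu2⟩ := exists_monotone_u hS hz hpos (by rwa [hz0'])
      have hvS := hv2 S ⟨hS, le_rfl⟩
      refine ⟨S, z2, hS, hz2, hz20.trans hz0', hpos2, hvS.le.trans (hv.trans (min_le_left _ _)),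
        ?_, hF.congr hS fun t ht => ?_, hu2⟩
      · rw [hvS]
        have := hv.trans (min_le_right _ _)
        simp only [vC, hz0] at this ⊢
        nlinarith [mul_pos hx0 hy0]
      · simp only [FC, hv2 t ht]
    have hle : lam ≤ lam1 := by
      obtain ⟨S, z, hS, hz, hz0', hpos, -, hv, hF, -⟩ := key 1 one_pos
      have := hF.le_testBound hcn hp0 hlamp.le hz hS (by rw [hz0']; exact hy0)
        (by rw [hz0']; exact hxy) (fun t ht => ⟨(hpos t ht).1.le, (hpos t ht).2.le⟩)
        (by rwa [hz0'])
      rw [hz0'] at this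
      exact this.trans (le_max_left _ _)
    refine ⟨hle, fun δ hδ => ?_⟩
    obtain ⟨S, z, hS, hz, hz0', hpos, hvδ, hv, hF, hu⟩ := key δ hδ
    obtain ⟨z', S', hz', hS', hz'0, hpos', hnn', hu', hv', hF', hP⟩ :=
      exists_cut_replace (ys := ys) hn1 hcn hp1 hlamp hz hS hpos hu (by
        change κ * (lam * ys ^ p) ≤ 1
        rw [hyspow]
        calc κ * (lam * (1 / (κ * lam1))) ≤ κ * (lam1 * (1 / (κ * lam1))) := by gcongr
          _ = 1 := by field_simp) hF
    rw [hz0'] at hz'0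
    have hS'p : 0 < S' := by
      rcases hS'.eq_or_lt with h | h
      · exfalso
        rw [← h, hz'0] at hv'
        have : 0 < vC z0 := mul_pos hx0 hy0
        linarith
      · exact h
    have hb := hmass lam z' S' hlam hz' (by rw [hz'0]) hS' hnn' hu' (by rwa [hz'0]) hF' hP
    refine ⟨S', fun t => z' (S' * t), ?_, ?_, hF'.scale hS'p⟩
    · rw [← hz'0]
      refine hgood z' S' hz' hS' hpos' hnn' hu' (by rwa [hz'0]) fun s hs => (hb s hs).trans ?_
      have h1 := (hnn' s hs).1
      have h2 := (hnn' s hs).2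
      gcongr
      exact le_max_left _ _
    · simp only [mul_one]
      exact hv'.trans hvδ

section Compactness

variable {n : ℕ} {C : ℝ} {z0 : ℂ} {L : ℝ} {c c' : ℝ → ℂ}

lemma Good.congr (h : Good n C z0 L c) (hcc : ∀ t ∈ Icc (0:ℝ) 1, c t = c' t) :
    Good n C z0 L c' where
  nonneg := h.nonneg
  dist_le s hs t ht := by rw [← hcc s hs, ← hcc t ht]; exact h.dist_le s hs t ht
  start := by rw [← hcc 0 ⟨le_rfl, zero_le_one⟩]; exact h.start
  mem t ht := by rw [← hcc t ht]; exact h.mem t ht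
  mono a ha b hb hab := by
    simp only [← hcc a ha, ← hcc b hb]; exact h.mono ha hb hab
  rem t ht := by rw [← hcc t ht]; exact h.rem t ht
  rem' t ht := by rw [← hcc t ht]; exact h.rem' t ht

lemma Good.lipschitzOnWith (h : Good n C z0 L c) :
    LipschitzOnWith ⟨L, h.nonneg⟩ c (Icc 0 1) :=
  LipschitzOnWith.of_dist_le_mul fun s hs t ht => h.dist_le s hs t ht

lemma Good.le_bound (h : Good n C z0 L c) (hn : 1 ≤ n) :
    L ≤ max 1 (C * (z0.re ^ (n - 1) * z0.im ^ n)) := by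
  have h1 := h.rem 0 ⟨le_rfl, zero_le_one⟩
  rw [h.start, sub_zero, mul_one] at h1
  rcases le_total L 1 with h2 | h2
  · exact h2.trans (le_max_left _ _)
  · exact (le_self_pow₀ h2 (by omega)).trans (h1.trans (le_max_right _ _))

/-- Extend a continuous curve on the unit interval to the line by constants. -/
def extC (c : C(unitInterval, ℂ)) (t : ℝ) : ℂ := c (projIcc 0 1 zero_le_one t)

lemma extC_of_mem (c : C(unitInterval, ℂ)) {t : ℝ} (ht : t ∈ Icc (0:ℝ) 1) :
    extC c t = c ⟨t, ht⟩ := by rw [extC, projIcc_of_mem]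

lemma continuous_extC_apply (t : ℝ) : Continuous fun c : C(unitInterval, ℂ) => extC c t :=
  continuous_eval_const _

lemma Good.exists_extC (h : Good n C z0 L c) :
    ∃ d : C(unitInterval, ℂ), ∀ t ∈ Icc (0:ℝ) 1, c t = extC d t :=
  ⟨⟨fun t => c t, continuousOn_iff_continuous_domRestrict.1 h.lipschitzOnWith.continuousOn⟩,
    fun t ht => by rw [extC_of_mem _ ht]; rfl⟩

lemma isClosed_good (n : ℕ) (C : ℝ) (z0 : ℂ) :
    IsClosed {q : C(unitInterval, ℂ) × ℝ | Good n C z0 q.2 (extC q.1)} := by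
  have hev : ∀ t, Continuous fun q : C(unitInterval, ℂ) × ℝ => extC q.1 t := fun t =>
    (continuous_extC_apply t).comp continuous_fst
  have hre : ∀ t, Continuous fun q : C(unitInterval, ℂ) × ℝ => (extC q.1 t).re := fun t =>
    Complex.continuous_re.comp (hev t)
  have him : ∀ t, Continuous fun q : C(unitInterval, ℂ) × ℝ => (extC q.1 t).im := fun t =>
    Complex.continuous_im.comp (hev t)
  have hu : ∀ t, Continuous fun q : C(unitInterval, ℂ) × ℝ => uC (extC q.1 t) := fun t =>
    continuous_uC.comp (hev t)
  have e : {q : C(unitInterval, ℂ) × ℝ | Good n C z0 q.2 (extC q.1)}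
      = {q | 0 ≤ q.2}
        ∩ {q | ∀ s ∈ Icc (0:ℝ) 1, ∀ t ∈ Icc (0:ℝ) 1,
            dist (extC q.1 s) (extC q.1 t) ≤ q.2 * |s - t|}
        ∩ {q | extC q.1 0 = z0}
        ∩ {q | ∀ t ∈ Icc (0:ℝ) 1, 0 ≤ (extC q.1 t).re ∧ 0 ≤ (extC q.1 t).im}
        ∩ {q | ∀ a ∈ Icc (0:ℝ) 1, ∀ b ∈ Icc (0:ℝ) 1, a ≤ b →
            uC (extC q.1 a) ≤ uC (extC q.1 b)}
        ∩ {q | ∀ t ∈ Icc (0:ℝ) 1, (q.2 * (1 - t)) ^ (2 * n - 1)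
            ≤ C * ((extC q.1 t).re ^ (n - 1) * (extC q.1 t).im ^ n)}
        ∩ {q | ∀ t ∈ Icc (0:ℝ) 1, √(2 * uC (extC q.1 t)) ^ (n - 1) * (q.2 * (1 - t)) ^ n
            ≤ C * ((extC q.1 t).re ^ (n - 1) * (extC q.1 t).im ^ n)} := by
    ext q
    constructor
    · intro h
      exact ⟨⟨⟨⟨⟨⟨h.nonneg, h.dist_le⟩, h.start⟩, h.mem⟩, fun a ha b hb hab => h.mono ha hb hab⟩,
        h.rem⟩, h.rem'⟩
    · rintro ⟨⟨⟨⟨⟨⟨h1, h2⟩, h3⟩, h4⟩, h5⟩, h6⟩, h7⟩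
      exact ⟨h1, h2, h3, h4, fun a ha b hb hab => h5 a ha b hb hab, h6, h7⟩
  rw [e]
  refine (((((((isClosed_le continuous_const continuous_snd).inter ?_).inter
    (isClosed_eq (hev 0) continuous_const)).inter ?_).inter ?_).inter ?_).inter ?_)
  · simp only [ofPred_forall]
    exact isClosed_iInter fun s => isClosed_iInter fun _ => isClosed_iInter fun t =>
      isClosed_iInter fun _ => isClosed_le ((hev s).dist (hev t))
        (continuous_snd.mul continuous_const)
  · simp only [ofPred_forall, ofPred_and]
    exact isClosed_iInter fun s => isClosed_iInter fun _ =>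
      (isClosed_le continuous_const (hre s)).inter (isClosed_le continuous_const (him s))
  · simp only [ofPred_forall]
    exact isClosed_iInter fun s => isClosed_iInter fun _ => isClosed_iInter fun t =>
      isClosed_iInter fun _ => isClosed_iInter fun _ => isClosed_le (hu s) (hu t)
  · simp only [ofPred_forall]
    exact isClosed_iInter fun s => isClosed_iInter fun _ => isClosed_le
      ((continuous_snd.mul continuous_const).pow _)
      (continuous_const.mul (((hre s).pow _).mul ((him s).pow _)))
  · simp only [ofPred_forall]
    exact isClosed_iInter fun s => isClosed_iInter fun _ => isClosed_le
      (((Real.continuous_sqrt.comp (continuous_const.mul (hu s))).pow _).mul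
        ((continuous_snd.mul continuous_const).pow _))
      (continuous_const.mul (((hre s).pow _).mul ((him s).pow _)))

lemma isCompact_lipschitz_start (L : ℝ) (z0 : ℂ) :
    IsCompact {c : C(unitInterval, ℂ) | c 0 = z0 ∧ ∀ s t, dist (c s) (c t) ≤ L * dist s t} := by
  refine ArzelaAscoli.isCompact_of_equicontinuous _ ?_ ?_
  · have e : ContinuousMap.toFun ''
        {c : C(unitInterval, ℂ) | c 0 = z0 ∧ ∀ s t, dist (c s) (c t) ≤ L * dist s t}
        = {f : unitInterval → ℂ | f 0 = z0 ∧ ∀ s t, dist (f s) (f t) ≤ L * dist s t} := by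
      ext f
      constructor
      · rintro ⟨c, hc, rfl⟩
        exact hc
      · rintro ⟨h0, h⟩
        have hL : LipschitzWith (Real.toNNReal L) f := LipschitzWith.of_dist_le_mul fun s t =>
          (h s t).trans (by gcongr; exact Real.le_coe_toNNReal L)
        exact ⟨⟨f, hL.continuous⟩, ⟨h0, h⟩, rfl⟩
    rw [e]
    refine (isCompact_univ_pi fun _ : unitInterval =>
      isCompact_closedBall z0 |L|).of_isClosed_subset ?_ ?_
    · rw [ofPred_and]
      refine (isClosed_eq (continuous_apply 0) continuous_const).inter ?_
      simp only [ofPred_forall]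
      exact isClosed_iInter fun s => isClosed_iInter fun t => isClosed_le
        ((continuous_apply s).dist (continuous_apply t)) continuous_const
    · rintro f ⟨h0, h⟩ t -
      rw [Metric.mem_closedBall, ← h0]
      refine (h t 0).trans ?_
      have h1 : dist t 0 ≤ 1 := by
        rw [Subtype.dist_eq, Real.dist_eq]
        simpa [abs_of_nonneg t.2.1] using t.2.2
      calc L * dist t 0 ≤ |L| * 1 := mul_le_mul (le_abs_self L) h1 dist_nonneg (abs_nonneg _)
        _ = |L| := mul_one _
  · refine (LipschitzWith.uniformEquicontinuous _ (Real.toNNReal L) fun c => ?_).equicontinuous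
    exact LipschitzWith.of_dist_le_mul fun s t =>
      (c.2.2 s t).trans (by gcongr; exact Real.le_coe_toNNReal L)

lemma isCompact_good (hn : 1 ≤ n) (C : ℝ) (z0 : ℂ) :
    IsCompact {q : C(unitInterval, ℂ) × ℝ | Good n C z0 q.2 (extC q.1)} := by
  set M := max 1 (C * (z0.re ^ (n - 1) * z0.im ^ n))
  refine ((isCompact_lipschitz_start M z0).prod
    (isCompact_Icc (a := 0) (b := M))).of_isClosed_subset (isClosed_good n C z0) ?_
  rintro ⟨c, L⟩ h
  have hL := Good.le_bound h hn
  refine ⟨⟨?_, fun s t => ?_⟩, h.nonneg, hL⟩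
  · have := h.start
    simp only at this
    rwa [extC_of_mem c ⟨le_rfl, zero_le_one⟩] at this
  · have := h.dist_le s s.2 t t.2
    simp only at this
    rw [extC_of_mem c s.2, extC_of_mem c t.2] at this
    refine this.trans ?_
    rw [Subtype.dist_eq, Real.dist_eq]
    gcongr

lemma continuous_integral_extC {g : ℝ → ℝ} (hg : IntervalIntegrable g volume 0 1) {F : ℂ → ℝ}
    (hF : Continuous F) :
    Continuous fun c : C(unitInterval, ℂ) => ∫ t in (0:ℝ)..1, g t * F (extC c t) := by
  have h1 : Continuous fun φ : C(unitInterval, ℝ) =>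
      ∫ t in (0:ℝ)..1, g t * φ (projIcc 0 1 zero_le_one t) := by
    refine LipschitzWith.continuous (K := Real.toNNReal (∫ t in (0:ℝ)..1, ‖g t‖))
      (LipschitzWith.of_dist_le_mul fun φ ψ => ?_)
    have hi : ∀ φ : C(unitInterval, ℝ), IntervalIntegrable
        (fun t => g t * φ (projIcc 0 1 zero_le_one t)) volume 0 1 := fun φ =>
      hg.mul_continuousOn (φ.continuous.comp continuous_projIcc).continuousOn
    rw [Real.dist_eq, ← intervalIntegral.integral_sub (hi φ) (hi ψ), ← Real.norm_eq_abs]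
    have h2 : ‖∫ t in (0:ℝ)..1, (g t * φ (projIcc 0 1 zero_le_one t)
        - g t * ψ (projIcc 0 1 zero_le_one t))‖ ≤ ∫ t in (0:ℝ)..1, ‖g t‖ * dist φ ψ := by
      refine intervalIntegral.norm_integral_le_of_norm_le zero_le_one
        (Eventually.of_forall fun t _ => ?_) (hg.norm.mul_const _)
      rw [← mul_sub, norm_mul]
      refine mul_le_mul_of_nonneg_left ?_ (norm_nonneg _)
      rw [← dist_eq_norm]
      exact ContinuousMap.dist_apply_le_dist _
    rw [intervalIntegral.integral_mul_const] at h2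
    refine h2.trans ?_
    gcongr
    exact Real.le_coe_toNNReal _
  exact h1.comp (ContinuousMap.continuous_postcomp ⟨F, hF⟩)

lemma isClosed_feas {cn p : ℝ} (hp : 0 < p) (n : ℕ) (Λ : ℝ) :
    IsClosed {q : C(unitInterval, ℂ) × ℝ |
      Feas p (Λ * q.2 ^ p) (fun t => FC n cn (extC q.1 t)) 1} := by
  simp only [Feas, ofPred_forall]
  refine isClosed_iInter fun w => isClosed_iInter fun K => isClosed_iInter fun hw =>
    isClosed_iInter fun _ => isClosed_le ?_ ?_
  · refine (continuous_const.mul (continuous_snd.rpow_const fun _ => Or.inr hp.le)).mul ?_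
    exact (continuous_integral_extC ((hw.continuous.abs.rpow_const fun _ =>
      Or.inr hp.le).intervalIntegrable _ _) (continuous_FC n cn)).comp continuous_fst
  · have hi : IntervalIntegrable (fun t => |deriv w t| ^ p) volume 0 1 := by
      simpa using intervalIntegrable_abs_deriv_rpow_mul hp.le hw continuous_const
        (f := fun _ => 1) 0 1
    exact (continuous_integral_extC hi (continuous_FC n cn)).comp continuous_fst

end Compactness

section Existence

lemma Good.FC_nonneg {n : ℕ} {C : ℝ} {z0 : ℂ} {L : ℝ} {c : ℝ → ℂ} (h : Good n C z0 L c) {cn : ℝ}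
    (hcn : 0 ≤ cn) : ∀ t ∈ Icc (0:ℝ) 1, 0 ≤ FC n cn (c t) := fun t ht =>
  _root_.FC_nonneg hcn (h.mem t ht).1 (h.mem t ht).2

/-- A closed-set form of the compactness argument: admissible curves which almost reach the
boundary and almost satisfy the optimal inequality accumulate at an optimal curve. -/
lemma exists_good_limit {n : ℕ} {C cn p Λ : ℝ} {z0 : ℂ} (hn : 1 ≤ n) (hcn : 0 ≤ cn) (hp : 0 < p)
    (h : ∀ ε > 0, ∃ (L : ℝ) (c : ℝ → ℂ), Good n C z0 L c ∧ vC (c 1) ≤ ε ∧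
      Feas p ((Λ - ε) * L ^ p) (fun t => FC n cn (c t)) 1) :
    ∃ q : C(unitInterval, ℂ) × ℝ, Good n C z0 q.2 (extC q.1) ∧ vC (extC q.1 1) ≤ 0 ∧
      Feas p (Λ * q.2 ^ p) (fun t => FC n cn (extC q.1 t)) 1 := by
  set M : ℕ → Set (C(unitInterval, ℂ) × ℝ) := fun k =>
    {q | Good n C z0 q.2 (extC q.1)} ∩ ({q | vC (extC q.1 1) ≤ 1 / ((k:ℝ) + 1)} ∩
      {q | Feas p ((Λ - 1 / ((k:ℝ) + 1)) * q.2 ^ p) (fun t => FC n cn (extC q.1 t)) 1}) with hM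
  have hcl : ∀ k, IsClosed (M k) := fun k => (isClosed_good n C z0).inter
    ((isClosed_le (continuous_vC.comp ((continuous_extC_apply 1).comp continuous_fst))
      continuous_const).inter (isClosed_feas hp n _))
  have hne : ∀ k, (M k).Nonempty := by
    intro k
    obtain ⟨L, c, hG, hv, hF⟩ := h (1 / ((k:ℝ) + 1)) (by positivity)
    obtain ⟨d, hd⟩ := hG.exists_extC
    refine ⟨(d, L), hG.congr hd, ?_, hF.congr zero_le_one fun t ht => by rw [hd t ht]⟩
    change vC (extC d 1) ≤ _
    rw [← hd 1 ⟨zero_le_one, le_rfl⟩]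
    exact hv
  have hnest : ∀ k, M (k + 1) ⊆ M k := by
    rintro k q ⟨hG, hv, hF⟩
    have e : 1 / (((k + 1 : ℕ) : ℝ) + 1) ≤ 1 / ((k:ℝ) + 1) := by
      push_cast
      gcongr
      linarith
    refine ⟨hG, hv.trans e, hF.mono ?_ zero_le_one (hG.FC_nonneg hcn)⟩
    have : 0 ≤ q.2 ^ p := Real.rpow_nonneg hG.nonneg p
    exact mul_le_mul_of_nonneg_right (by linarith) this
  obtain ⟨q, hq⟩ := IsCompact.nonempty_iInter_of_sequence_nonempty_isCompact_isClosed M hnest hne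
    ((isCompact_good hn C z0).of_isClosed_subset (hcl 0) inter_subset_left) hcl
  have hq' : ∀ k, q ∈ M k := mem_iInter.1 hq
  have hlim : Tendsto (fun k : ℕ => 1 / ((k:ℝ) + 1)) atTop (𝓝 0) :=
    tendsto_one_div_add_atTop_nhds_zero_nat
  refine ⟨q, (hq' 0).1, ge_of_tendsto' hlim fun k => (hq' k).2.1, fun w K hw hw0 => ?_⟩
  have h2 : Tendsto (fun k : ℕ => (Λ - 1 / ((k:ℝ) + 1)) * q.2 ^ p *
      ∫ t in (0:ℝ)..1, |w t| ^ p * FC n cn (extC q.1 t)) atTop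
      (𝓝 ((Λ - 0) * q.2 ^ p * ∫ t in (0:ℝ)..1, |w t| ^ p * FC n cn (extC q.1 t))) :=
    ((tendsto_const_nhds.sub hlim).mul_const _).mul_const _
  rw [sub_zero] at h2
  exact le_of_tendsto' h2 fun k => (hq' k).2.2 w K hw hw0

/-- There is a shortest optimal curve. -/
lemma exists_shortest_good {n : ℕ} {cn x0 y0 p : ℝ} (hn : 2 ≤ n) (hcn : 0 < cn) (hy0 : 0 < y0)
    (hxy : y0 ≤ x0) (hp : 2 * (n:ℝ) - 1 ≤ p) :
    ∃ C > 0, ∃ Λ > 0, (∀ γ : ℝ → ℝ × ℝ, MemRh n cn x0 y0 γ → lambdaH n cn p γ ≤ Λ) ∧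
      ∃ (L : ℝ) (c : ℝ → ℂ), Good n C ⟨x0, y0⟩ L c ∧ vC (c 1) ≤ 0 ∧
        Feas p (Λ * L ^ p) (fun t => FC n cn (c t)) 1 ∧
        ∀ L' c', Good n C ⟨x0, y0⟩ L' c' → vC (c' 1) ≤ 0 →
          Feas p (Λ * L' ^ p) (fun t => FC n cn (c' t)) 1 → L ≤ L' := by
  obtain ⟨C, hC, lam0, hlam0, lam1, h01, ⟨L0, c0, hG0, hv0, hF0⟩, hall⟩ :=
    exists_uniform_good hn hcn hy0 hxy hp
  have hp0 : 0 < p := by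
    have : (2:ℝ) ≤ n := by exact_mod_cast hn
    linarith
  have hn1 : 1 ≤ n := by omega
  set A : Set ℝ := {lam | lam ≤ lam1 ∧ ∀ δ > 0, ∃ (L : ℝ) (c : ℝ → ℂ), Good n C ⟨x0, y0⟩ L c ∧
    vC (c 1) ≤ δ ∧ Feas p (lam * L ^ p) (fun t => FC n cn (c t)) 1} with hA
  have hA0 : lam0 ∈ A := ⟨h01, fun δ hδ => ⟨L0, c0, hG0, hv0.trans hδ.le, hF0⟩⟩
  have hAb : BddAbove A := ⟨lam1, fun a ha => ha.1⟩
  have hΛ0 : lam0 ≤ sSup A := le_csSup hAb hA0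
  set Λ := sSup A
  have hlim := exists_good_limit (C := C) (Λ := Λ) (z0 := ⟨x0, y0⟩) hn1 hcn.le hp0 fun ε hε => by
    obtain ⟨lam, hlam, hlt⟩ := exists_lt_of_lt_csSup ⟨lam0, hA0⟩ (sub_lt_self Λ hε)
    obtain ⟨L, c, hG, hv, hF⟩ := hlam.2 ε hε
    refine ⟨L, c, hG, hv, hF.mono ?_ zero_le_one (hG.FC_nonneg hcn.le)⟩
    exact mul_le_mul_of_nonneg_right hlt.le (Real.rpow_nonneg hG.nonneg p)
  refine ⟨C, hC, Λ, hlam0.trans_le hΛ0, fun γ hγ => ?_, ?_⟩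
  · rcases le_total (lambdaH n cn p γ) lam0 with h | h
    · exact h.trans hΛ0
    · exact le_csSup hAb (hall γ hγ _ h le_rfl)
  set M : Set (C(unitInterval, ℂ) × ℝ) := {q | Good n C ⟨x0, y0⟩ q.2 (extC q.1)} ∩
    ({q | vC (extC q.1 1) ≤ 0} ∩
      {q | Feas p (Λ * q.2 ^ p) (fun t => FC n cn (extC q.1 t)) 1}) with hM
  have hcl : IsClosed M := (isClosed_good n C _).inter
    ((isClosed_le (continuous_vC.comp ((continuous_extC_apply 1).comp continuous_fst))
      continuous_const).inter (isClosed_feas hp0 n _))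
  obtain ⟨q0, hq0⟩ := hlim
  obtain ⟨q, hq, hmin⟩ := ((isCompact_good hn1 C ⟨x0, y0⟩).of_isClosed_subset hcl
    inter_subset_left).exists_isMinOn ⟨q0, hq0⟩ (continuous_snd.continuousOn)
  refine ⟨q.2, extC q.1, hq.1, hq.2.1, hq.2.2, fun L' c' hG hv hF => ?_⟩
  obtain ⟨d, hd⟩ := hG.exists_extC
  refine hmin (show (d, L') ∈ M from ⟨hG.congr hd, ?_, hF.congr zero_le_one fun t ht => by
    rw [hd t ht]⟩)
  change vC (extC d 1) ≤ _
  rw [← hd 1 ⟨zero_le_one, le_rfl⟩]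
  exact hv

end Existence

lemma LipschitzWith.intervalIntegrable_norm_deriv {c : ℝ → ℂ} {K : NNReal} (hc : LipschitzWith K c)
    (a b : ℝ) : IntervalIntegrable (fun t => ‖deriv c t‖) volume a b := by
  have h : LocallyIntegrable (fun t => ‖deriv c t‖) volume := fun x =>
    let ⟨U, hU, h⟩ := hc.locallyIntegrable_deriv x
    ⟨U, hU, h.norm⟩
  exact h.intervalIntegrable_real a b

section Shortcut

variable {n : ℕ} {C : ℝ} {z0 : ℂ} {L : ℝ} {c : ℝ → ℂ} {a b : ℝ}

/-- The time change which freezes a loop `[a,b]` at its starting time. -/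
def freeze (a b t : ℝ) : ℝ := if a < t ∧ t < b then a else t

lemma freeze_le (a b t : ℝ) : freeze a b t ≤ t := by
  unfold freeze; split_ifs with h
  · exact h.1.le
  · exact le_rfl

lemma freeze_mono (a b : ℝ) : Monotone (freeze a b) := by
  intro s t hst
  unfold freeze
  split_ifs with h1 h2 h2
  · exact le_rfl
  · exact h1.1.le.trans hst
  · by_contra! h
    exact h1 ⟨h, hst.trans_lt h2.2⟩
  · exact hst

lemma freeze_mem (ha : 0 ≤ a) {t : ℝ} (ht : t ∈ Icc (0:ℝ) 1) : freeze a b t ∈ Icc (0:ℝ) 1 := by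
  refine ⟨?_, (freeze_le a b t).trans ht.2⟩
  unfold freeze; split_ifs
  · exact ha
  · exact ht.1

lemma comp_freeze_eq (hab : a ≤ b) (hc : c a = c b) (t : ℝ) :
    c (freeze a b t) = c (min t a) + c (max t b) - c b := by
  unfold freeze
  split_ifs with h
  · rw [min_eq_right h.1.le, max_eq_right h.2.le]; ring
  · rcases le_or_gt t a with h1 | h1
    · rw [min_eq_left h1, max_eq_right (h1.trans hab)]; ring
    · have h2 : b ≤ t := not_lt.1 fun h2 => h ⟨h1, h2⟩
      rw [min_eq_right h1.le, max_eq_left h2, hc]; ring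

lemma lipschitzWith_comp_freeze {K : NNReal} (hab : a ≤ b) (hc : c a = c b)
    (hl : LipschitzWith K c) : LipschitzWith (K + K) fun t => c (freeze a b t) := by
  have h : (fun t => c (freeze a b t)) = fun t => (c (min t a) + c (max t b)) - c b :=
    funext (comp_freeze_eq hab hc)
  rw [h]
  have h1 : LipschitzWith K fun t => c (min t a) := by
    simpa [Function.comp_def] using hl.comp (LipschitzWith.id.min_const a)
  have h2 : LipschitzWith K fun t => c (max t b) := by
    simpa [Function.comp_def] using hl.comp (LipschitzWith.id.max_const b)
  simpa using (h1.add h2).sub (LipschitzWith.const (c b))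

lemma deriv_comp_freeze_of_mem {t : ℝ} (ht : t ∈ Ioo a b) :
    deriv (fun t => c (freeze a b t)) t = 0 := by
  have : (fun t => c (freeze a b t)) =ᶠ[𝓝 t] fun _ => c a := by
    filter_upwards [isOpen_Ioo.mem_nhds ht] with x hx
    simp only [freeze, if_pos (show a < x ∧ x < b from hx)]
  rw [this.deriv_eq, deriv_const]

lemma deriv_comp_freeze_of_notMem {t : ℝ} (ht : t ∉ Icc a b) :
    deriv (fun t => c (freeze a b t)) t = deriv c t := by
  refine Filter.EventuallyEq.deriv_eq ?_
  filter_upwards [isClosed_Icc.isOpen_compl.mem_nhds ht] with x hx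
  simp only [freeze, if_neg (fun h : a < x ∧ x < b => hx ⟨h.1.le, h.2.le⟩)]

lemma ae_norm_deriv_comp_freeze_le :
    ∀ᵐ t, ‖deriv (fun t => c (freeze a b t)) t‖ ≤ ‖deriv c t‖ := by
  have h : ∀ᵐ t : ℝ, t ≠ a ∧ t ≠ b := by
    rw [eventually_and]
    constructor <;> simp [ae_iff]
  filter_upwards [h] with t ht
  by_cases h1 : t ∈ Icc a b
  · rw [deriv_comp_freeze_of_mem ⟨lt_of_le_of_ne h1.1 ht.1.symm, lt_of_le_of_ne h1.2 ht.2⟩,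
      norm_zero]
    exact norm_nonneg _
  · rw [deriv_comp_freeze_of_notMem h1]

/-- Cutting out a loop from an admissible curve and passing to constant speed gives an admissible
curve. -/
lemma Good.exists_shortcut {cn p Λ : ℝ} (h : Good n C z0 L c)
    (hl : LipschitzWith ⟨L, h.nonneg⟩ c) (hcn : 0 < cn) (hp : 1 < p) (hΛ : 0 ≤ Λ)
    (hz0 : 0 < vC z0) (hv : vC (c 1) ≤ 0) (hL : 0 < L)
    (hF : Feas p (Λ * L ^ p) (fun t => FC n cn (c t)) 1)
    (ha : 0 ≤ a) (hab : a ≤ b) (hb : b ≤ 1) (hc : c a = c b) :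
    ∃ S c', Good n C z0 S c' ∧ vC (c' 1) ≤ 0 ∧ Feas p (Λ * S ^ p) (fun t => FC n cn (c' t)) 1 ∧
      S ≤ (∫ t in (0:ℝ)..1, ‖deriv c t‖) ∧ S ≤ L * (1 - (b - a)) := by
  set e : ℝ → ℂ := fun t => c (freeze a b t) with he
  have hel := lipschitzWith_comp_freeze hab hc hl
  obtain ⟨s, z, hsm, hsl, hs0, hs1, hz, hzs, hsd, hsab⟩ := exists_arclength hel zero_le_one
  have hsd' : ∀ᵐ t, ‖deriv s t‖ ≤ L := by
    filter_upwards [hsd, ae_norm_deriv_comp_freeze_le (c := c) (a := a) (b := b)] with t h1 h2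
    rw [h1.deriv, norm_norm]
    exact h2.trans (norm_deriv_le_of_lipschitz hl)
  have hsL : LipschitzWith ⟨L, hL.le⟩ s := lipschitzWith_of_ae_norm_deriv_le hsl hsd'
  have hsLle : ∀ x y, x ≤ y → s y - s x ≤ L * (y - x) := by
    intro x y hxy
    have := hsL.dist_le_mul y x
    rw [Real.dist_eq, Real.dist_eq, abs_of_nonneg (sub_nonneg.2 hxy)] at this
    exact (le_abs_self _).trans this
  have he0 : e 0 = z0 := by
    rw [he]; simp only [freeze, if_neg (fun h : a < 0 ∧ 0 < b => not_lt.2 ha h.1)]; exact h.start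
  have he1 : e 1 = c 1 := by
    rw [he]; simp only [freeze, if_neg (fun h : a < 1 ∧ 1 < b => not_lt.2 hb h.2)]
  have hI0 : (0:ℝ) ∈ Icc (0:ℝ) 1 := ⟨le_rfl, zero_le_one⟩
  have hI1 : (1:ℝ) ∈ Icc (0:ℝ) 1 := ⟨zero_le_one, le_rfl⟩
  have hS : 0 < s 1 := by
    refine lt_of_le_of_ne (hs0 ▸ hsm zero_le_one) fun h0 => ?_
    have h1 : e 1 = e 0 := by
      rw [show e 1 = z (s 1) from (hzs 1 hI1).symm, show e 0 = z (s 0) from (hzs 0 hI0).symm, hs0,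
        ← h0]
    rw [he1, he0] at h1
    rw [h1] at hv
    exact absurd hz0 (not_lt.2 hv)
  have hcol : Feas p Λ (fun t => FC n cn (z t)) (s 1) := by
    refine Feas.collapse hp hΛ hL (f := fun t => FC n cn (c t))
      ((continuous_FC n cn).comp hl.continuous) (h.FC_nonneg hcn.le)
      ((continuous_FC n cn).comp hz.continuous) hsL hsm hs0 ?_ hF
    filter_upwards [hsd] with t h1 ht h2
    rw [h1.deriv] at h2
    have h3 : t ∉ Ioo a b := fun h3 => h2 (by rw [deriv_comp_freeze_of_mem h3, norm_zero])
    have h4 : e t = c t := by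
      rw [he]; simp only [freeze, if_neg (show ¬(a < t ∧ t < b) from h3)]
    rw [Function.comp_apply, hzs t ht, ← h4]
  have hpre : ∀ τ ∈ Icc (0:ℝ) 1, ∃ t ∈ Icc (0:ℝ) 1, s t = s 1 * τ := by
    intro τ hτ
    have := intermediate_value_Icc zero_le_one hsL.continuous.continuousOn
      (show s 1 * τ ∈ Icc (s 0) (s 1) from
        ⟨by rw [hs0]; exact mul_nonneg hS.le hτ.1, mul_le_of_le_one_right hS.le hτ.2⟩)
    exact this
  have hpre' : ∀ τ ∈ Icc (0:ℝ) 1, ∃ t ∈ Icc (0:ℝ) 1, z (s 1 * τ) = c t ∧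
      s 1 * (1 - τ) ≤ L * (1 - t) := by
    intro τ hτ
    obtain ⟨t, ht, hst⟩ := hpre τ hτ
    refine ⟨freeze a b t, freeze_mem ha ht, by rw [← hst]; exact hzs t ht, ?_⟩
    have h1 := hsLle t 1 ht.2
    have h2 : L * (1 - t) ≤ L * (1 - freeze a b t) :=
      mul_le_mul_of_nonneg_left (by linarith [freeze_le a b t]) hL.le
    linarith
  have hmono : MonotoneOn (fun t => uC (e t)) (Icc 0 1) := fun x hx y hy hxy =>
    h.mono (freeze_mem ha hx) (freeze_mem ha hy) (freeze_mono a b hxy)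
  refine ⟨s 1, fun τ => z (s 1 * τ), ⟨hS.le, ?_, ?_, ?_, ?_, ?_, ?_⟩, ?_, hcol.scale hS, ?_, ?_⟩
  · intro x _ y _
    have := hz.dist_le_mul (s 1 * x) (s 1 * y)
    rw [NNReal.coe_one, one_mul, Real.dist_eq, ← mul_sub, abs_mul, abs_of_pos hS] at this
    exact this
  · simp only [mul_zero]
    rw [← hs0, hzs 0 hI0]
    exact he0
  · intro τ hτ
    obtain ⟨t, ht, h1, -⟩ := hpre' τ hτ
    simp only [h1]
    exact h.mem t ht
  · intro x hx y hy hxy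
    obtain ⟨t, ht, h1⟩ := hpre x hx
    obtain ⟨t', ht', h1'⟩ := hpre y hy
    simp only
    rcases le_total t t' with h2 | h2
    · rw [← h1, ← h1', hzs t ht, hzs t' ht']
      exact hmono ht ht' h2
    · have h3 := hsm h2
      rw [h1, h1'] at h3
      rw [le_antisymm h3 (mul_le_mul_of_nonneg_left hxy hS.le)]
  · intro τ hτ
    obtain ⟨t, ht, h1, h2⟩ := hpre' τ hτ
    simp only [h1]
    exact (pow_le_pow_left₀ (mul_nonneg hS.le (by linarith [hτ.2])) h2 _).trans (h.rem t ht)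
  · intro τ hτ
    obtain ⟨t, ht, h1, h2⟩ := hpre' τ hτ
    simp only [h1]
    exact (mul_le_mul_of_nonneg_left (pow_le_pow_left₀ (mul_nonneg hS.le (by linarith [hτ.2])) h2 _)
      (by positivity)).trans (h.rem' t ht)
  · simp only [mul_one]
    rw [hzs 1 hI1, show c (freeze a b 1) = c 1 from he1]
    exact hv
  · rw [hs1]
    exact intervalIntegral.integral_mono_ae zero_le_one
      (hel.intervalIntegrable_norm_deriv _ _)
      (hl.intervalIntegrable_norm_deriv _ _) ae_norm_deriv_comp_freeze_le
  · have h1 := hsLle 0 a ha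
    have h2 := hsLle b 1 hb
    have h3 : s b - s a = 0 := by
      rw [hsab, intervalIntegral.integral_of_le hab, integral_Ioc_eq_integral_Ioo]
      exact setIntegral_eq_zero_of_forall_eq_zero fun t ht => by
        rw [deriv_comp_freeze_of_mem ht, norm_zero]
    rw [hs0] at h1
    linarith

/-- A shortest optimal curve is simple and has constant speed. -/
lemma Good.injOn_and_speed {cn p Λ : ℝ} (h : Good n C z0 L c)
    (hl : LipschitzWith ⟨L, h.nonneg⟩ c) (hcn : 0 < cn) (hp : 1 < p) (hΛ : 0 ≤ Λ)
    (hz0 : 0 < vC z0) (hv : vC (c 1) ≤ 0) (hL : 0 < L)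
    (hF : Feas p (Λ * L ^ p) (fun t => FC n cn (c t)) 1)
    (hmin : ∀ L' c', Good n C z0 L' c' → vC (c' 1) ≤ 0 →
      Feas p (Λ * L' ^ p) (fun t => FC n cn (c' t)) 1 → L ≤ L') :
    InjOn c (Icc 0 1) ∧ ∀ᵐ t, t ∈ Icc (0:ℝ) 1 → ‖deriv c t‖ = L := by
  have key : ∀ a ∈ Icc (0:ℝ) 1, ∀ b ∈ Icc (0:ℝ) 1, a ≤ b → c a = c b → a = b := by
    intro a ha b hb hab hc
    obtain ⟨S, c', h1, h2, h3, -, h5⟩ :=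
      h.exists_shortcut hl hcn hp hΛ hz0 hv hL hF ha.1 hab hb.2 hc
    have h6 := hmin S c' h1 h2 h3
    nlinarith
  refine ⟨fun a ha b hb hc => ?_, ?_⟩
  · rcases le_total a b with h1 | h1
    · exact key a ha b hb h1 hc
    · exact (key b hb a ha h1 hc.symm).symm
  · obtain ⟨S, c', h1, h2, h3, h4, -⟩ :=
      h.exists_shortcut hl hcn hp hΛ hz0 hv hL hF le_rfl le_rfl zero_le_one rfl
    have h5 : L ≤ ∫ t in (0:ℝ)..1, ‖deriv c t‖ := (hmin S c' h1 h2 h3).trans h4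
    have hi : IntervalIntegrable (fun t => ‖deriv c t‖) volume 0 1 :=
      hl.intervalIntegrable_norm_deriv _ _
    have hle : ∀ t, ‖deriv c t‖ ≤ L := fun t => norm_deriv_le_of_lipschitz hl
    have h6 : ∫ t in (0:ℝ)..1, (L - ‖deriv c t‖) = 0 := by
      refine le_antisymm ?_ (intervalIntegral.integral_nonneg zero_le_one fun t _ =>
        sub_nonneg.2 (hle t))
      rw [intervalIntegral.integral_sub (by simp) hi]
      simpa using h5
    rw [intervalIntegral.integral_eq_zero_iff_of_le_of_nonneg_ae zero_le_one
      (Eventually.of_forall fun t => sub_nonneg.2 (hle t))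
      ((intervalIntegrable_const).sub hi)] at h6
    rw [restrict_Ioc_eq_restrict_Icc, EventuallyEq, ae_restrict_iff' measurableSet_Icc] at h6
    filter_upwards [h6] with t ht hI
    have := ht hI
    simp only [Pi.zero_apply] at this
    linarith

end Shortcut

section Final

variable {n : ℕ} {C : ℝ} {z0 : ℂ} {L : ℝ} {c : ℝ → ℂ}

lemma ae_mem_Icc_imp_of_Ioo {P : ℝ → Prop} (h : ∀ᵐ t : ℝ, t ∈ Ioo (0:ℝ) 1 → P t) :
    ∀ᵐ t : ℝ, t ∈ Icc (0:ℝ) 1 → P t := by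
  have h0 : ∀ᵐ t : ℝ, t ≠ 0 ∧ t ≠ 1 := by
    rw [eventually_and]
    constructor <;> simp [ae_iff]
  filter_upwards [h, h0] with t h1 h2 h3
  exact h1 ⟨lt_of_le_of_ne h3.1 h2.1.symm, lt_of_le_of_ne h3.2 h2.2⟩

/-- The weighted inequality bounds from below any Rayleigh-type infimum whose integrands are those
of a curve of constant speed `L` along which the weight is `f`. -/
lemma Feas.le_sInf_quotient {p Λ : ℝ} {f : ℝ → ℝ} (hp : 0 < p) (hL : 0 < L) (hf : Continuous f)
    (hf0 : ∀ t ∈ Ioo (0:ℝ) 1, 0 < f t) (h : Feas p (Λ * L ^ p) f 1) {N D : (ℝ → ℝ) → ℝ → ℝ}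
    (hN : ∀ w, ∀ᵐ t, t ∈ Icc (0:ℝ) 1 →
      N w t = L ^ (1 - p) * (|derivWithin w (Icc 0 1) t| ^ p * f t))
    (hD : ∀ w, ∀ᵐ t, t ∈ Icc (0:ℝ) 1 → D w t = L * (|w t| ^ p * f t)) :
    Λ ≤ sInf {q | ∃ w : ℝ → ℝ, (∃ K, LipschitzOnWith K w (Icc 0 1)) ∧ w 0 = 0 ∧
      IntervalIntegrable (N w) volume 0 1 ∧ IntervalIntegrable (D w) volume 0 1 ∧
      (0 < ∫ t in (0:ℝ)..1, D w t) ∧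
      q = (∫ t in (0:ℝ)..1, N w t) / (∫ t in (0:ℝ)..1, D w t)} := by
  have hrestr : ∀ {φ ψ : ℝ → ℝ}, (∀ᵐ t, t ∈ Icc (0:ℝ) 1 → φ t = ψ t) →
      φ =ᵐ[volume.restrict (uIoc 0 1)] ψ := by
    intro φ ψ hφ
    rw [uIoc_of_le zero_le_one, EventuallyEq, ae_restrict_iff' measurableSet_Ioc]
    exact hφ.mono fun t ht h1 => ht (Ioc_subset_Icc_self h1)
  have hd : ∀ {w ω : ℝ → ℝ}, EqOn w ω (Icc 0 1) →
      ∀ t ∈ Ioo (0:ℝ) 1, derivWithin w (Icc 0 1) t = deriv ω t := by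
    intro w ω hw t ht
    rw [derivWithin_of_mem_nhds (Icc_mem_nhds ht.1 ht.2)]
    refine EventuallyEq.deriv_eq ?_
    filter_upwards [Icc_mem_nhds ht.1 ht.2] with x hx using hw hx
  have hN' : ∀ {w ω : ℝ → ℝ}, EqOn w ω (Icc 0 1) →
      N w =ᵐ[volume.restrict (uIoc 0 1)] fun t => L ^ (1 - p) * (|deriv ω t| ^ p * f t) := by
    intro w ω hw
    refine hrestr (ae_mem_Icc_imp_of_Ioo ?_)
    filter_upwards [hN w] with t h1 h2
    rw [h1 (Ioo_subset_Icc_self h2), hd hw t h2]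
  have hD' : ∀ {w ω : ℝ → ℝ}, EqOn w ω (Icc 0 1) →
      D w =ᵐ[volume.restrict (uIoc 0 1)] fun t => L * (|ω t| ^ p * f t) := by
    intro w ω hw
    refine hrestr ?_
    filter_upwards [hD w] with t h1 h2
    rw [h1 h2, hw h2]
  refine le_csInf ?_ ?_
  · have hid : LipschitzWith 1 (id : ℝ → ℝ) := LipschitzWith.id
    have hcont : Continuous fun t : ℝ => L * (|id t| ^ p * f t) :=
      continuous_const.mul (continuous_abs_rpow_mul hp.le continuous_id hf)
    refine ⟨_, id, ⟨1, hid.lipschitzOnWith⟩, rfl, ?_, ?_, ?_, rfl⟩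
    · exact ((intervalIntegrable_abs_deriv_rpow_mul hp.le hid hf 0 1).const_mul _).congr_ae
        (hN' fun _ _ => rfl).symm
    · exact (hcont.intervalIntegrable 0 1).congr_ae (hD' fun _ _ => rfl).symm
    · rw [intervalIntegral.integral_congr_ae_restrict (hD' fun _ _ => rfl)]
      refine intervalIntegral.intervalIntegral_pos_of_pos_on (hcont.intervalIntegrable 0 1)
        (fun t ht => ?_) zero_lt_one
      have h1 := hf0 t ht
      have h2 : 0 < |id t| := abs_pos.2 ht.1.ne'
      positivity
  · rintro q ⟨w, ⟨K, hw⟩, hw0, -, -, hpos, rfl⟩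
    obtain ⟨ω, hω, hwω⟩ := hw.extend_real
    rw [le_div_iff₀ hpos, intervalIntegral.integral_congr_ae_restrict (hN' hwω),
      intervalIntegral.integral_congr_ae_restrict (hD' hwω), intervalIntegral.integral_const_mul,
      intervalIntegral.integral_const_mul]
    have h1 := h ω K hω (by rw [← hwω ⟨le_rfl, zero_le_one⟩, hw0])
    have h2 : L ^ (1 - p) * L ^ p = L := by rw [← Real.rpow_add hL]; simp
    calc Λ * (L * ∫ t in (0:ℝ)..1, |ω t| ^ p * f t)
        = L ^ (1 - p) * (Λ * L ^ p * ∫ t in (0:ℝ)..1, |ω t| ^ p * f t) := by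
          linear_combination (-(Λ * ∫ t in (0:ℝ)..1, |ω t| ^ p * f t)) * h2
      _ ≤ _ := mul_le_mul_of_nonneg_left h1 (by positivity)

lemma ae_gSpeedOn_eq {K : NNReal} (hl : LipschitzWith K c)
    (hs : ∀ᵐ t, t ∈ Icc (0:ℝ) 1 → ‖deriv c t‖ = L) {γ : ℝ → ℝ × ℝ}
    (hγ : ∀ t ∈ Icc (0:ℝ) 1, γ t = ((c t).re, (c t).im)) {S : Set ℝ} (hS : Ioo 0 1 ⊆ S) :
    ∀ᵐ t, t ∈ Icc (0:ℝ) 1 → gSpeedOn S γ t = L := by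
  refine ae_mem_Icc_imp_of_Ioo ?_
  filter_upwards [hs, hl.ae_differentiableAt] with t h1 h2 h3
  rw [gSpeedOn_eq_norm_deriv (mem_of_superset (isOpen_Ioo.mem_nhds h3) hS) ?_ h2,
    h1 (Ioo_subset_Icc_self h3)]
  filter_upwards [isOpen_Ioo.mem_nhds h3] with x hx using hγ x (Ioo_subset_Icc_self hx)

lemma FC_pos {cn : ℝ} (hcn : 0 < cn) {z : ℂ} (h1 : 0 < z.re) (h2 : 0 < z.im) : 0 < FC n cn z :=
  mul_pos hcn (pow_pos (mul_pos h1 h2) _)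

lemma Feas.le_lambdaH {cn p Λ : ℝ} (hcn : 0 < cn) (hp : 0 < p) (hL : 0 < L) {K : NNReal}
    (hl : LipschitzWith K c) (hpos : ∀ t ∈ Ico (0:ℝ) 1, 0 < (c t).re ∧ 0 < (c t).im)
    (hs : ∀ᵐ t, t ∈ Icc (0:ℝ) 1 → ‖deriv c t‖ = L)
    (h : Feas p (Λ * L ^ p) (fun t => FC n cn (c t)) 1) :
    Λ ≤ lambdaH n cn p fun t => ((c t).re, (c t).im) := by
  have hsp := ae_gSpeedOn_eq hl hs (γ := fun t => ((c t).re, (c t).im)) (fun _ _ => rfl)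
    Ioo_subset_Ico_self
  refine Feas.le_sInf_quotient hp hL ((continuous_FC n cn).comp hl.continuous)
    (fun t ht => FC_pos hcn (hpos t (Ioo_subset_Ico_self ht)).1 (hpos t (Ioo_subset_Ico_self ht)).2)
    h (fun w => ae_mem_Icc_imp_of_Ioo ?_) (fun w => ?_)
  · filter_upwards [hsp] with t h1 h2
    have h3 := hpos t (Ioo_subset_Ico_self h2)
    have hLp : L ^ (1 - p) = L * (L ^ p)⁻¹ := by
      rw [Real.rpow_sub hL, Real.rpow_one, div_eq_mul_inv]
    rw [numH_eq_of_speed hp (h1 (Ioo_subset_Icc_self h2)) hL.le (Fvol_eq_FC n cn (c t))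
      (FC_pos hcn h3.1 h3.2) (d := derivWithin w (Icc 0 1) t / L) (by field_simp), abs_div,
      abs_of_pos hL, Real.div_rpow (abs_nonneg _) hL.le, hLp, Function.comp_apply]
    ring
  · filter_upwards [hsp] with t h1 h2
    rw [denH, hSpeedOn, h1 h2, Fvol_eq_FC, Function.comp_apply]
    ring

lemma Feas.le_lambdaG {cn p Λ : ℝ} (hcn : 0 < cn) (hp : 0 < p) (hL : 0 < L) {K : NNReal}
    (hl : LipschitzWith K c) (hpos : ∀ t ∈ Ico (0:ℝ) 1, 0 < (c t).re ∧ 0 < (c t).im)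
    (hs : ∀ᵐ t, t ∈ Icc (0:ℝ) 1 → ‖deriv c t‖ = L)
    (h : Feas p (Λ * L ^ p) (fun t => FC n cn (c t)) 1) {γ : ℝ → ℝ × ℝ}
    (hγ : ∀ t ∈ Icc (0:ℝ) 1, γ t = ((c t).re, (c t).im)) :
    Λ ≤ lambdaG n cn p γ := by
  have hsp := ae_gSpeedOn_eq hl hs hγ Ioo_subset_Icc_self
  refine Feas.le_sInf_quotient hp hL ((continuous_FC n cn).comp hl.continuous)
    (fun t ht => FC_pos hcn (hpos t (Ioo_subset_Ico_self ht)).1 (hpos t (Ioo_subset_Ico_self ht)).2)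
    h (fun w => ?_) (fun w => ?_)
  · filter_upwards [hsp] with t h1 h2
    rw [numG, h1 h2, hγ t h2, Fvol_eq_FC, Function.comp_apply]
    ring
  · filter_upwards [hsp] with t h1 h2
    rw [denG, h1 h2, hγ t h2, Fvol_eq_FC, Function.comp_apply]
    ring

lemma Good.pos (h : Good n C z0 L c) (hn : 2 ≤ n) (hL : 0 < L) :
    ∀ t ∈ Ico (0:ℝ) 1, 0 < (c t).re ∧ 0 < (c t).im := by
  intro t ht
  have ht' := Ico_subset_Icc_self ht
  have h1 := h.rem t ht'
  have h2 : 0 < (L * (1 - t)) ^ (2 * n - 1) := pow_pos (mul_pos hL (by linarith [ht.2])) _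
  obtain ⟨h3, h4⟩ := h.mem t ht'
  refine ⟨h3.lt_of_ne fun e => ?_, h4.lt_of_ne fun e => ?_⟩
  · rw [← e, zero_pow (by omega)] at h1
    linarith
  · rw [← e, zero_pow (by omega)] at h1
    linarith

lemma LipschitzWith.re_im {K : NNReal} (hl : LipschitzWith K c) :
    LipschitzWith K fun t => ((c t).re, (c t).im) := by
  refine LipschitzWith.of_dist_le_mul fun s t => ?_
  refine le_trans ?_ (hl.dist_le_mul s t)
  rw [Prod.dist_eq, dist_eq_norm (c s), Real.dist_eq, Real.dist_eq, ← Complex.sub_re,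
    ← Complex.sub_im]
  exact max_le (Complex.abs_re_le_norm _) (Complex.abs_im_le_norm _)

lemma Good.vC_one (h : Good n C z0 L c) (hv : vC (c 1) ≤ 0) : vC (c 1) = 0 :=
  have := h.mem 1 ⟨zero_le_one, le_rfl⟩
  le_antisymm hv (mul_nonneg this.1 this.2)

lemma Good.memRg {K : NNReal} (h : Good n C z0 L c) (hn : 2 ≤ n) (hL : 0 < L)
    (hl : LipschitzWith K c) (hv : vC (c 1) ≤ 0) :
    MemRg z0.re z0.im fun t => ((c t).re, (c t).im) :=
  ⟨⟨K, hl.re_im.lipschitzOnWith⟩, by simp only [h.start],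
    ⟨h.mem 1 ⟨zero_le_one, le_rfl⟩, mul_eq_zero.1 (h.vC_one hv)⟩, h.pos hn hL⟩

lemma Good.memRh {K : NNReal} (h : Good n C z0 L c) (hn : 2 ≤ n) (hL : 0 < L)
    (hl : LipschitzWith K c) (hv : vC (c 1) ≤ 0)
    (hs : ∀ᵐ t, t ∈ Icc (0:ℝ) 1 → ‖deriv c t‖ = L) (cn : ℝ) :
    MemRh n cn z0.re z0.im fun t => ((c t).re, (c t).im) := by
  refine ⟨by simp only [h.start], h.pos hn hL, fun a _ => ⟨K, hl.re_im.lipschitzOnWith⟩, ?_, ?_⟩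
  · obtain ⟨M, hM⟩ := (isCompact_Icc (a := (0:ℝ)) (b := 1)).exists_bound_of_continuousOn
      ((continuous_FC n cn).comp hl.continuous).continuousOn
    refine ⟨M * L, ?_⟩
    filter_upwards [ae_gSpeedOn_eq hl hs (γ := fun t => ((c t).re, (c t).im)) (fun _ _ => rfl)
      Ioo_subset_Ico_self] with t h1 h2
    rw [hSpeed, hSpeedOn, h1 (Ico_subset_Icc_self h2), Fvol_eq_FC]
    exact mul_le_mul_of_nonneg_right
      ((le_abs_self _).trans (hM t (Ico_subset_Icc_self h2))) hL.le
  · have h1 : Tendsto (fun t => vC (c t)) (𝓝[<] (1:ℝ)) (𝓝 (vC (c 1))) :=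
      ((continuous_vC.comp hl.continuous).tendsto 1).mono_left nhdsWithin_le_nhds
    rwa [h.vC_one hv] at h1

end Final

section Endpoint

variable {n : ℕ} {C : ℝ} {z0 : ℂ} {L : ℝ} {c : ℝ → ℂ}

/-- An injective constant-speed curve on the diagonal ending at the origin is a straight segment. -/
lemma eq_segment_of_diagonal {K : NNReal} (hl : LipschitzWith K c) (hinj : InjOn c (Icc 0 1))
    (hs : ∀ᵐ t, t ∈ Icc (0:ℝ) 1 → ‖deriv c t‖ = L)
    (hdiag : ∀ t ∈ Icc (0:ℝ) 1, (c t).re = (c t).im) (h0 : 0 ≤ (c 0).re) (h1 : (c 1).re = 0) :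
    ∀ t ∈ Icc (0:ℝ) 1, (c t).re = (1 - t) * (c 0).re ∧ (c t).im = (1 - t) * (c 0).re := by
  have hI0 : (0:ℝ) ∈ Icc (0:ℝ) 1 := ⟨le_rfl, zero_le_one⟩
  have hI1 : (1:ℝ) ∈ Icc (0:ℝ) 1 := ⟨zero_le_one, le_rfl⟩
  set r : ℝ → ℝ := fun t => (c t).re with hr
  have hrl : LipschitzWith K r := LipschitzWith.of_dist_le_mul fun s t => by
    refine le_trans ?_ (hl.dist_le_mul s t)
    rw [dist_eq_norm (c s), Real.dist_eq, hr]
    simp only [← Complex.sub_re]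
    exact Complex.abs_re_le_norm _
  have hrinj : InjOn r (Icc 0 1) := fun s hs t ht hst =>
    hinj hs ht (Complex.ext hst (by rw [← hdiag s hs, ← hdiag t ht]; exact hst))
  have hanti : AntitoneOn r (Icc 0 1) := by
    rcases hrl.continuous.continuousOn.strictMonoOn_of_injOn_Icc' zero_le_one hrinj with h | h
    · have := h hI0 hI1 zero_lt_one
      simp only [hr, h1] at this
      exact absurd h0 (not_le.2 this)
    · exact h.antitoneOn
  have hd : ∀ᵐ t, t ∈ Icc (0:ℝ) 1 → deriv r t = -√(L ^ 2 / 2) := by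
    refine ae_mem_Icc_imp_of_Ioo ?_
    filter_upwards [hs, hl.ae_differentiableAt] with t ht hdt hI
    have e1 : HasDerivAt r (deriv c t).re t :=
      Complex.reCLM.hasFDerivAt.comp_hasDerivAt t hdt.hasDerivAt
    have e2 : HasDerivAt r (deriv c t).im t := by
      refine (Complex.imCLM.hasFDerivAt.comp_hasDerivAt t hdt.hasDerivAt).congr_of_eventuallyEq ?_
      filter_upwards [Icc_mem_nhds hI.1 hI.2] with x hx using hdiag x hx
    have e3 := e1.unique e2
    have e4 : deriv r t ≤ 0 := by
      rw [← derivWithin_of_mem_nhds (Icc_mem_nhds hI.1 hI.2)]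
      exact hanti.derivWithin_nonpos
    have e5 : L ^ 2 / 2 = (-deriv r t) ^ 2 := by
      rw [← ht (Ioo_subset_Icc_self hI), Complex.sq_norm, Complex.normSq_apply, ← e3, e1.deriv]
      ring
    rw [e5, Real.sqrt_sq (by linarith), neg_neg]
  have hr' : ∀ t ∈ Icc (0:ℝ) 1, r t = r 0 - t * √(L ^ 2 / 2) := by
    intro t ht
    have e1 := hrl.integral_deriv_eq 0 t
    have e2 : ∫ x in (0:ℝ)..t, deriv r x = ∫ x in (0:ℝ)..t, -√(L ^ 2 / 2) := by
      refine intervalIntegral.integral_congr_ae ?_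
      filter_upwards [hd] with x hx hx'
      rw [uIoc_of_le ht.1] at hx'
      exact hx ⟨hx'.1.le, hx'.2.trans ht.2⟩
    rw [e2, intervalIntegral.integral_const, smul_eq_mul] at e1
    linarith
  have hr1 := hr' 1 hI1
  rw [show r 1 = 0 from h1] at hr1
  intro t ht
  have e : (c t).re = (1 - t) * (c 0).re := by
    have := hr' t ht
    simp only [hr] at this hr1
    rw [this]
    linear_combination (-t) * hr1
  exact ⟨e, by rw [← hdiag t ht, e]⟩

/-- An admissible curve whose endpoint has `u > 0` approaches the boundary at a linear rate. -/
lemma Good.exists_linear_le_vC (h : Good n C z0 L c) (hn : 2 ≤ n) (hL : 0 < L)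
    (hc : Continuous c) (hu : 0 < uC (c 1)) :
    ∃ k > 0, ∀ t ∈ Icc (0:ℝ) 1, k * (1 - t) ≤ vC (c t) := by
  set U := uC (c 1) with hU
  have hI1 : (1:ℝ) ∈ Icc (0:ℝ) 1 := ⟨zero_le_one, le_rfl⟩
  obtain ⟨δ, hδ, hball⟩ := Metric.eventually_nhds_iff.1
    (((continuous_uC.comp hc).tendsto 1).eventually (lt_mem_nhds (half_lt_self hu)))
  set k1 : ℝ := √U * L / max 1 C with hk1
  have hCm : 0 < max 1 C := lt_max_of_lt_left one_pos
  have hk1p : 0 < k1 := by positivity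
  have near : ∀ t ∈ Icc (0:ℝ) 1, U / 2 < uC (c t) → k1 * (1 - t) ≤ vC (c t) := by
    intro t ht hut
    obtain ⟨hx, hy⟩ := h.mem t ht
    set x := (c t).re
    set y := (c t).im
    have ht1 : 0 ≤ 1 - t := by linarith [ht.2]
    have hux : √U ≤ √(2 * uC (c t)) := Real.sqrt_le_sqrt (by linarith)
    have hxu : √(2 * uC (c t)) ≤ x := by
      rw [Real.sqrt_le_left hx]
      have : uC (c t) = (x ^ 2 - y ^ 2) / 2 := rfl
      nlinarith [sq_nonneg y]
    have h1 : √U ^ (n - 1) * (L * (1 - t)) ^ n ≤ C * (x ^ (n - 1) * y ^ n) :=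
      (mul_le_mul_of_nonneg_right (pow_le_pow_left₀ (Real.sqrt_nonneg _) hux _)
        (by positivity)).trans (h.rem' t ht)
    have h2 : (√U * (L * (1 - t))) ^ n ≤ (max 1 C * (x * y)) ^ n := by
      obtain ⟨m, rfl⟩ : ∃ m, n = m + 1 := ⟨n - 1, by omega⟩
      simp only [Nat.add_sub_cancel] at h1
      have h3 : C ≤ max 1 C ^ (m + 1) :=
        (le_max_right _ _).trans (le_self_pow₀ (le_max_left _ _) (by omega))
      calc (√U * (L * (1 - t))) ^ (m + 1)
          = √U * (√U ^ m * (L * (1 - t)) ^ (m + 1)) := by rw [mul_pow, pow_succ]; ring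
        _ ≤ x * (C * (x ^ m * y ^ (m + 1))) :=
          mul_le_mul (hux.trans hxu) h1 (by positivity) hx
        _ = C * (x * y) ^ (m + 1) := by rw [mul_pow, pow_succ]; ring
        _ ≤ max 1 C ^ (m + 1) * (x * y) ^ (m + 1) :=
          mul_le_mul_of_nonneg_right h3 (by positivity)
        _ = _ := (mul_pow _ _ _).symm
    have h3 := le_of_pow_le_pow_left₀ (by omega) (by positivity) h2
    rw [hk1, div_mul_eq_mul_div, div_le_iff₀ hCm]
    change _ ≤ x * y * _
    linarith
  set t0 : ℝ := max 0 (1 - δ / 2) with ht0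
  have ht01 : t0 < 1 := max_lt one_pos (by linarith)
  obtain ⟨τ, hτ, hmin⟩ := (isCompact_Icc (a := (0:ℝ)) (b := t0)).exists_isMinOn
    ⟨0, le_rfl, le_max_left _ _⟩ (continuous_vC.comp hc).continuousOn
  have hτpos : 0 < vC (c τ) := by
    have := h.pos hn hL τ ⟨hτ.1, hτ.2.trans_lt ht01⟩
    exact mul_pos this.1 this.2
  refine ⟨min k1 (vC (c τ)), lt_min hk1p hτpos, fun t ht => ?_⟩
  have ht1 : 0 ≤ 1 - t := by linarith [ht.2]
  rcases le_or_gt t t0 with h1 | h1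
  · have h2 : vC (c τ) ≤ vC (c t) := hmin (show t ∈ Icc 0 t0 from ⟨ht.1, h1⟩)
    calc min k1 (vC (c τ)) * (1 - t) ≤ vC (c τ) * 1 :=
          mul_le_mul (min_le_right _ _) (by linarith [ht.1]) ht1 hτpos.le
      _ ≤ _ := by rwa [mul_one]
  · refine (mul_le_mul_of_nonneg_right (min_le_left _ _) ht1).trans (near t ht (hball ?_))
    have h2 : 1 - δ / 2 ≤ t0 := le_max_right _ _
    rw [Real.dist_eq, abs_sub_comm, abs_of_nonneg ht1]
    linarith

end Endpoint

/-- For `p ≥ 2n-1`, if either `x₀ ≠ y₀`, or `x₀ = y₀` and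
`Λ_p > λ_{1,p}(σ)`, then there is a curve `α ∈ R_g^*` with `λ_{1,p}(α) = Λ_p`,
where `Λ_p = sup{λ_{1,p}(γ) : γ ∈ R_h}`. -/
theorem simons_stmt11 (n : ℕ) (hn : 2 ≤ n) (cn : ℝ) (hcn : 0 < cn)
    (x0 y0 : ℝ) (hy0 : 0 < y0) (hxy : y0 ≤ x0)
    (p : ℝ) (hp : 2 * (n : ℝ) - 1 ≤ p)
    (hyp : x0 ≠ y0 ∨ (x0 = y0 ∧ ∃ γ : ℝ → ℝ × ℝ, MemRh n cn x0 y0 γ ∧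
      lambdaG n cn p (simonsCurve x0) < lambdaH n cn p γ)) :
    ∃ α : ℝ → ℝ × ℝ, MemRgStar x0 y0 α ∧ MemRh n cn x0 y0 α ∧
      ∀ γ : ℝ → ℝ × ℝ, MemRh n cn x0 y0 γ →
        lambdaH n cn p γ ≤ lambdaH n cn p α := by
  have hn2 : (2:ℝ) ≤ n := by exact_mod_cast hn
  have hp1 : 1 < p := by linarith
  have hp0 : 0 < p := by linarith
  have hx0 : 0 < x0 := by linarith
  have hI0 : (0:ℝ) ∈ Icc (0:ℝ) 1 := ⟨le_rfl, zero_le_one⟩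
  have hI1 : (1:ℝ) ∈ Icc (0:ℝ) 1 := ⟨zero_le_one, le_rfl⟩
  obtain ⟨C, hC, Λ, hΛ, hsup, L, c', hG', hv', hF', hmin⟩ :=
    exists_shortest_good hn hcn hy0 hxy hp
  set c : ℝ → ℂ := fun t => c' (projIcc 0 1 zero_le_one t) with hc
  have hcc : ∀ t ∈ Icc (0:ℝ) 1, c' t = c t := fun t ht => by
    rw [hc]; simp only [projIcc_of_mem zero_le_one ht]
  have hG : Good n C ⟨x0, y0⟩ L c := hG'.congr hcc
  have hl : LipschitzWith ⟨L, hG.nonneg⟩ c := lipschitzWith_clamp zero_le_one hG'.lipschitzOnWith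
  have hv : vC (c 1) ≤ 0 := by rwa [← hcc 1 hI1]
  have hF : Feas p (Λ * L ^ p) (fun t => FC n cn (c t)) 1 :=
    hF'.congr zero_le_one fun t ht => by rw [hcc t ht]
  have hz0 : 0 < vC ⟨x0, y0⟩ := mul_pos hx0 hy0
  have hL : 0 < L := by
    refine hG.nonneg.lt_of_ne fun h0 => ?_
    have h1 := hG.dist_le 1 hI1 0 hI0
    rw [← h0, zero_mul] at h1
    rw [dist_le_zero.1 h1, hG.start] at hv
    exact absurd hz0 (not_lt.2 hv)
  obtain ⟨hinj, hs⟩ := hG.injOn_and_speed hl hcn hp1 hΛ.le hz0 hv hL hF hmin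
  have hpos := hG.pos hn hL
  set α : ℝ → ℝ × ℝ := fun t => ((c t).re, (c t).im) with hα
  have hge : Λ ≤ lambdaH n cn p α := hF.le_lambdaH hcn hp0 hL hl hpos hs
  have hsp := ae_gSpeedOn_eq hl hs (γ := α) (fun _ _ => rfl) Ioo_subset_Icc_self
  have hLg : Lg α = L := by
    have : Lg α = ∫ t in (0:ℝ)..1, L := by
      refine intervalIntegral.integral_congr_ae ?_
      filter_upwards [hsp] with t h1 h2
      rw [uIoc_of_le zero_le_one] at h2
      exact h1 (Ioc_subset_Icc_self h2)
    simpa using this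
  have hu0 : 0 ≤ uC (c 0) := by
    rw [hG.start]
    simp only [uC]
    nlinarith
  have hu : 0 < uC (c 1) := by
    rcases hyp with hne | ⟨heq, γ, hγ, hlt⟩
    · refine lt_of_lt_of_le ?_ (hG.mono hI0 hI1 zero_le_one)
      have : y0 < x0 := lt_of_le_of_ne hxy hne.symm
      simp only [hG.start, uC]
      nlinarith
    · by_contra! hu1
      have hzero : ∀ t ∈ Icc (0:ℝ) 1, uC (c t) = 0 := fun t ht =>
        le_antisymm ((hG.mono ht hI1 ht.2).trans hu1) (hu0.trans (hG.mono hI0 ht ht.1))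
      have hdiag : ∀ t ∈ Icc (0:ℝ) 1, (c t).re = (c t).im := by
        intro t ht
        have h1 := hzero t ht
        have h2 := hG.mem t ht
        simp only [uC] at h1
        exact (pow_left_inj₀ h2.1 h2.2 two_ne_zero).1 (by linarith)
      have hre1 : (c 1).re = 0 := by
        have h1 := hG.vC_one hv
        rw [vC, ← hdiag 1 hI1] at h1
        exact mul_self_eq_zero.1 h1
      have hre0 : (c 0).re = x0 := by rw [hG.start]
      have hseg := eq_segment_of_diagonal hl hinj hs hdiag (by rw [hre0]; exact hx0.le) hre1
      have h1 := hF.le_lambdaG hcn hp0 hL hl hpos hs (γ := simonsCurve x0) fun t ht => by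
        rw [(hseg t ht).1, (hseg t ht).2, hre0]; rfl
      exact absurd (h1.trans_lt hlt) (not_lt.2 (hsup γ hγ))
  refine ⟨α, ⟨hG.memRg hn hL hl hv, fun s hs t ht hst => hinj hs ht ?_, ?_, hu,
    hG.exists_linear_le_vC hn hL hl.continuous hu⟩, hG.memRh hn hL hl hv hs cn,
    fun γ hγ => (hsup γ hγ).trans hge⟩
  · exact Complex.ext (congrArg Prod.fst hst) (congrArg Prod.snd hst)
  · rw [hLg]
    exact hsp
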